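/- Suppose k ∈ ℕ, 1 ≤ p < ∞ and s ∈ ℝ with s ∉ {-k, ..., -1}. Then for every q ∈ I_{k,p} the weighted Sobolev spaces W^{k,q,p}_s and W^{k,p,p}_s coincide as sets, and their norms are equivalent. Furthermore, if s < -k, the norm of W^{k,p,p}_s is equivalent to the seminorm u ↦ ||\,|∇^k u|\,||_{L^p_s}. -/

import Mathlib

open MeasureTheory Metric Filter Topology ENNReal

noncomputable section

/-- Euclidean space `ℝ^N`. -/
abbrev Euc (N : ℕ) := EuclideanSpace ℝ (Fin N)

/-- Iterated classical partial derivative along a list of coordinate directions. -/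
def pderivList {N : ℕ} : List (Fin N) → (Euc N → ℝ) → Euc N → ℝ
  | [], φ => φ
  | i :: l, φ => pderivList l fun x => fderiv ℝ φ x (EuclideanSpace.single i 1)

/-- `g` is the weak (distributional) partial derivative of `u` of order given by the
list `l` of coordinate directions, i.e. `g = ∂_{l₁} ⋯ ∂_{l_r} u` in `D'(ℝ^N)`. -/
def IsWeakDerivList {N : ℕ} (l : List (Fin N)) (u g : Euc N → ℝ) : Prop :=
  LocallyIntegrable u volume ∧ LocallyIntegrable g volume ∧
    ∀ φ : Euc N → ℝ, ContDiff ℝ (⊤ : ℕ∞) φ → HasCompactSupport φ →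
      ∫ x, u x * pderivList l φ x = (-1 : ℝ) ^ l.length * ∫ x, g x * φ x

/-- `g` is the weak partial derivative `∂ᵢ u`. -/
def IsWeakPartialDeriv {N : ℕ} (i : Fin N) (u g : Euc N → ℝ) : Prop :=
  IsWeakDerivList [i] u g

/-- The weight `(1+|x|)^{-s-N/q}` of the space `L^q_s` (with `N/∞ := 0`). -/
def wt (N : ℕ) (s : ℝ) (q : ℝ≥0∞) (x : Euc N) : ℝ :=
  (1 + ‖x‖) ^ (-s - (N : ℝ) / q.toReal)

/-- Membership in the weighted space `L^q_s`. -/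
def MemLs (N : ℕ) (s : ℝ) (q : ℝ≥0∞) (u : Euc N → ℝ) : Prop :=
  MemLp (fun x => wt N s q x * u x) q volume

/-- The norm of the weighted space `L^q_s`. -/
def LsNorm (N : ℕ) (s : ℝ) (q : ℝ≥0∞) (u : Euc N → ℝ) : ℝ :=
  (eLpNorm (fun x => wt N s q x * u x) q volume).toReal

/-- Membership in the exponentially weighted space `L^q_{exp,s}`. -/
def MemLexp (N : ℕ) (s : ℝ) (q : ℝ≥0∞) (u : Euc N → ℝ) : Prop :=
  MemLp (fun x => Real.exp (-(s * ‖x‖)) * u x) q volume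

/-- The norm of the exponentially weighted space `L^q_{exp,s}`. -/
def LexpNorm (N : ℕ) (s : ℝ) (q : ℝ≥0∞) (u : Euc N → ℝ) : ℝ :=
  (eLpNorm (fun x => Real.exp (-(s * ‖x‖)) * u x) q volume).toReal

/-- The pointwise Euclidean (Frobenius) norm `|∇^k u|` of the `k`-th gradient, whose
components `g m` are indexed by the `k`-tuples `m` of coordinate directions. -/
def gradNormK {N k : ℕ} (g : (Fin k → Fin N) → Euc N → ℝ) (x : Euc N) : ℝ :=
  Real.sqrt (∑ m : Fin k → Fin N, g m x ^ 2)

/-- The pointwise Euclidean norm `|∇u|` of a first-order gradient. -/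
def gradNorm1 {N : ℕ} (g : Fin N → Euc N → ℝ) (x : Euc N) : ℝ :=
  Real.sqrt (∑ i, g i x ^ 2)

/-- The interval `I_{j,p}` of admissible exponents `q`. -/
def Ijp (N j : ℕ) (p : ℝ) : Set ℝ≥0∞ :=
  if p = (N : ℝ) / (j : ℝ) ∧ 1 < N then Set.Ico (ENNReal.ofReal p) ⊤
  else if p < (N : ℝ) / (j : ℝ) then
    Set.Icc (ENNReal.ofReal p) (ENNReal.ofReal ((N : ℝ) * p / ((N : ℝ) - (j : ℝ) * p)))
  else Set.Icc (ENNReal.ofReal p) ⊤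

/-- The average of `u` on the ball `B_ρ`. -/
def ballAvg {N : ℕ} (ρ : ℝ) (u : Euc N → ℝ) : ℝ :=
  (volume (ball (0 : Euc N) ρ)).toReal⁻¹ * ∫ y in ball (0 : Euc N) ρ, u y

/-- The radial symmetrization `u_S(x) = (Nω_N)⁻¹ ∫_{S^{N-1}} u(|x|σ) dσ`. -/
def radialSymmetrization {N : ℕ} (u : Euc N → ℝ) (x : Euc N) : ℝ :=
  ((N : ℝ) * (volume (ball (0 : Euc N) 1)).toReal)⁻¹ *
    ∫ σ : sphere (0 : Euc N) 1, u (‖x‖ • (σ : Euc N)) ∂((volume : Measure (Euc N)).toSphere)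

/-- `u` is radially symmetric: `u x` only depends on `|x|`. -/
def RadSymm {N : ℕ} (u : Euc N → ℝ) : Prop :=
  ∀ x y : Euc N, ‖x‖ = ‖y‖ → u x = u y

/-- Evaluation of a polynomial on `ℝ^N` at a point. -/
def polyEval {N : ℕ} (π : MvPolynomial (Fin N) ℝ) (x : Euc N) : ℝ :=
  MvPolynomial.eval (fun i => x i) π


namespace WS

/-- Jensen / Hölder in the form used throughout. -/
lemma jensen {T : Type*} [MeasurableSpace T] (μ : Measure T) {p : ℝ} (hp : 1 ≤ p)
    {g : T → ℝ≥0∞} (hg : AEMeasurable g μ) :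
    (∫⁻ t, g t ∂μ) ^ p ≤ μ Set.univ ^ (p - 1) * ∫⁻ t, g t ^ p ∂μ := by
  have hp0 : 0 < p := by linarith
  rcases eq_or_lt_of_le hp with h1 | h1
  · subst h1; simp
  have hpq : p.HolderConjugate (p / (p - 1)) := Real.HolderConjugate.conjExponent h1
  have h := ENNReal.lintegral_mul_le_Lp_mul_Lq μ hpq hg (aemeasurable_const (b := (1 : ℝ≥0∞)))
  simp only [Pi.mul_apply, mul_one, ENNReal.one_rpow, lintegral_one] at h
  calc (∫⁻ t, g t ∂μ) ^ p ≤ ((∫⁻ t, g t ^ p ∂μ) ^ (1 / p) * μ Set.univ ^ (1 / (p / (p - 1)))) ^ p := by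
        gcongr
    _ = μ Set.univ ^ (p - 1) * ∫⁻ t, g t ^ p ∂μ := by
        rw [ENNReal.mul_rpow_of_nonneg _ _ hp0.le, ← ENNReal.rpow_mul, ← ENNReal.rpow_mul, mul_comm]
        have : 1 / (p / (p - 1)) * p = p - 1 := by
          have : p - 1 ≠ 0 := by linarith
          field_simp
        rw [this, one_div_mul_cancel hp0.ne', ENNReal.rpow_one]

lemma pow_cmp (a : ℝ) {c A B : ℝ} (hc : 1 ≤ c) (hA : 0 < A) (hB : 0 < B) (h1 : A ≤ c * B)
    (h2 : B ≤ c * A) : A ^ a ≤ c ^ |a| * B ^ a := by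
  have hc0 : 0 < c := by linarith
  rcases le_or_gt 0 a with ha | ha
  · rw [abs_of_nonneg ha, ← Real.mul_rpow hc0.le hB.le]
    exact Real.rpow_le_rpow hA.le h1 ha
  · rw [abs_of_neg ha, Real.rpow_neg hc0.le, ← Real.inv_rpow hc0.le,
      ← Real.mul_rpow (by positivity) hB.le]
    apply Real.rpow_le_rpow_of_nonpos (by positivity) _ ha.le
    rw [inv_mul_le_iff₀ hc0]; exact h2

lemma lintegral_dil {N : ℕ} {c : ℝ} (hc : 0 < c) (f : Euc N → ℝ≥0∞) :
    ∫⁻ x, f (c • x) = ENNReal.ofReal (c ^ (-(N : ℝ))) * ∫⁻ x, f x := by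
  have h := Measure.map_addHaar_smul (volume : Measure (Euc N)) hc.ne'
  have he : MeasurableEmbedding (fun x : Euc N => c • x) :=
    (Homeomorph.smulOfNeZero c hc.ne').measurableEmbedding
  rw [← he.lintegral_map f, h, lintegral_smul_measure, smul_eq_mul]
  congr 2
  rw [finrank_euclideanSpace, Fintype.card_fin, abs_of_nonneg (by positivity),
    Real.rpow_neg hc.le, Real.rpow_natCast]

lemma enn_ofReal_rpow {x p : ℝ} (hx : 0 < x) : ENNReal.ofReal x ^ p = ENNReal.ofReal (x ^ p) :=
  ENNReal.ofReal_rpow_of_pos hx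

/-- weighted norms with values in `ℝ≥0∞`. -/
def Wn (N : ℕ) (σ : ℝ) (q : ℝ≥0∞) (u : Euc N → ℝ) : ℝ≥0∞ :=
  eLpNorm (fun x => wt N σ q x * u x) q volume

/-- weighted integrals -/
def K {N : ℕ} (a p : ℝ) (f : Euc N → ℝ≥0∞) : ℝ≥0∞ :=
  ∫⁻ x, ENNReal.ofReal ((1 + ‖x‖) ^ a) * f x ^ p

lemma one_add_norm_pos {N : ℕ} (x : Euc N) : 0 < 1 + ‖x‖ := by positivity

lemma Wn_rpow {N : ℕ} (σ : ℝ) {p : ℝ} (hp : 1 ≤ p) (u : Euc N → ℝ) :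
    Wn N σ (ENNReal.ofReal p) u ^ p = K (-σ * p - N) p (fun x => ‖u x‖ₑ) := by
  have hp0 : 0 < p := by linarith
  unfold Wn K
  rw [eLpNorm_eq_lintegral_rpow_enorm_toReal (by simpa using hp0) (by simp),
    ENNReal.toReal_ofReal hp0.le, ← ENNReal.rpow_mul, one_div_mul_cancel hp0.ne', ENNReal.rpow_one]
  congr 1; ext x
  rw [enorm_mul, ENNReal.mul_rpow_of_nonneg _ _ hp0.le]
  congr 1
  unfold wt
  rw [Real.enorm_of_nonneg (by positivity), enn_ofReal_rpow (by positivity),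
    ← Real.rpow_mul (by positivity), ENNReal.toReal_ofReal hp0.le]
  congr 2
  field_simp

lemma rpow_le_of_le {p : ℝ} (hp : 1 ≤ p) {a b c : ℝ≥0∞} (h : a ^ p ≤ c * b ^ p) :
    a ≤ c ^ (1 / p) * b := by
  have hp0 : 0 < p := by linarith
  have := ENNReal.rpow_le_rpow h (z := 1 / p) (by positivity)
  rwa [ENNReal.mul_rpow_of_nonneg _ _ (by positivity), ← ENNReal.rpow_mul, ← ENNReal.rpow_mul,
    mul_one_div_cancel hp0.ne', ENNReal.rpow_one, ENNReal.rpow_one] at this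

/-- A family of transformations, averaged. The main tool to bound averaged quantities. -/
lemma K_avg {N : ℕ} {T : Type*} [MeasurableSpace T] (μ : Measure T) [IsFiniteMeasure μ]
    (a : ℝ) {p : ℝ} (hp : 1 ≤ p) (F : Euc N → ℝ≥0∞) (g : T → Euc N → ℝ≥0∞)
    (hg : Measurable (Function.uncurry g)) (hF : ∀ x, F x ≤ ∫⁻ t, g t x ∂μ) (M : ℝ≥0∞)
    (hM : ∀ᵐ t ∂μ, K a p (g t) ≤ M) :
    K a p F ≤ μ Set.univ ^ p * M := by
  have hp0 : 0 < p := by linarith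
  have hw : Measurable fun x : Euc N => ENNReal.ofReal ((1 + ‖x‖) ^ a) := by fun_prop
  calc K a p F ≤ ∫⁻ x, ENNReal.ofReal ((1 + ‖x‖) ^ a) *
          (μ Set.univ ^ (p - 1) * ∫⁻ t, g t x ^ p ∂μ) := by
        unfold K
        gcongr with x
        refine le_trans (by gcongr; exact hF x) (jensen μ hp ?_)
        exact (hg.comp (measurable_id.prodMk measurable_const)).aemeasurable
    _ = μ Set.univ ^ (p - 1) * ∫⁻ x, ∫⁻ t, ENNReal.ofReal ((1 + ‖x‖) ^ a) * g t x ^ p ∂μ := by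
        rw [← lintegral_const_mul' _ _ (by finiteness)]
        congr 1; ext x
        rw [lintegral_const_mul]
        · ring
        · exact (hg.comp (measurable_id.prodMk measurable_const)).pow_const p
    _ = μ Set.univ ^ (p - 1) * ∫⁻ t, K a p (g t) ∂μ := by
        congr 1
        rw [lintegral_lintegral_swap]
        · rfl
        · apply Measurable.aemeasurable
          exact (hw.comp measurable_fst).mul ((hg.comp measurable_swap).pow_const p)
    _ ≤ μ Set.univ ^ (p - 1) * ∫⁻ t, M ∂μ := by
        gcongr 1; exact lintegral_mono_ae hM
    _ = μ Set.univ ^ p * M := by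
        rw [lintegral_const, mul_comm M, ← mul_assoc]
        congr 1
        nth_rw 2 [← ENNReal.rpow_one (μ Set.univ)]
        rw [← ENNReal.rpow_add_of_nonneg _ _ (by linarith) (by norm_num)]
        congr 1; ring

lemma absorb {X A : ℝ≥0∞} (hX : X ≠ ∞) {θ : ℝ} (h0 : 0 ≤ θ) (h1 : θ < 1)
    (h : X ≤ A + ENNReal.ofReal θ * X) : X ≤ ENNReal.ofReal (1 - θ)⁻¹ * A := by
  have h2 : 0 < (1 - θ)⁻¹ := by rw [inv_pos]; linarith
  rcases eq_or_ne A ∞ with hA | hA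
  · rw [hA, ENNReal.mul_top (by simpa using h2)]; exact le_top
  lift X to NNReal using hX
  lift A to NNReal using hA
  have h3 := ENNReal.toReal_mono (by finiteness) h
  rw [ENNReal.toReal_add (by finiteness) (by finiteness), ENNReal.toReal_mul,
    ENNReal.toReal_ofReal h0] at h3
  simp only [ENNReal.coe_toReal] at h3
  rw [← ENNReal.ofReal_coe_nnreal, ← ENNReal.ofReal_coe_nnreal (p := A), ← ENNReal.ofReal_mul h2.le]
  apply ENNReal.ofReal_le_ofReal
  rw [← div_eq_inv_mul, le_div_iff₀ (by linarith)]
  linarith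

lemma eLpNorm_dil {N : ℕ} {c : ℝ} (hc : 0 < c) {p : ℝ} (hp : 1 ≤ p) (f : Euc N → ℝ) :
    eLpNorm (fun x => f (c • x)) (ENNReal.ofReal p) volume
      = ENNReal.ofReal (c ^ (-(N : ℝ) / p)) * eLpNorm f (ENNReal.ofReal p) volume := by
  have hp0 : 0 < p := by linarith
  rw [eLpNorm_eq_lintegral_rpow_enorm_toReal (by simpa using hp0) (by simp),
    eLpNorm_eq_lintegral_rpow_enorm_toReal (by simpa using hp0) (by simp),
    ENNReal.toReal_ofReal hp0.le, lintegral_dil hc (fun x => ‖f x‖ₑ ^ p),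
    ENNReal.mul_rpow_of_nonneg _ _ (by positivity), enn_ofReal_rpow (by positivity),
    ← Real.rpow_mul hc.le]
  congr 3
  field_simp

/-- `u ↦ u(2 x) - c u(x)`. -/
def Td {N : ℕ} (c : ℝ) (u : Euc N → ℝ) (x : Euc N) : ℝ := u ((2 : ℝ) • x) - c * u x

lemma aesm_dil {N : ℕ} {c : ℝ} (hc : 0 < c) {u : Euc N → ℝ}
    (hu : AEStronglyMeasurable u volume) :
    AEStronglyMeasurable (fun x => u (c • x)) volume := by
  apply hu.comp_quasiMeasurePreserving
  refine ⟨measurable_const_smul c, ?_⟩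
  rw [Measure.map_addHaar_smul _ hc.ne']
  exact Measure.smul_absolutelyContinuous

lemma aesm_Td {N : ℕ} (c : ℝ) {u : Euc N → ℝ} (hu : AEStronglyMeasurable u volume) :
    AEStronglyMeasurable (Td c u) volume :=
  (aesm_dil (by norm_num) hu).sub (hu.const_mul c)

lemma wt_meas {N : ℕ} (σ : ℝ) (q : ℝ≥0∞) : Measurable (wt N σ q) := by
  unfold wt; fun_prop

lemma wt_pos {N : ℕ} (σ : ℝ) (q : ℝ≥0∞) (x : Euc N) : 0 < wt N σ q x := by
  unfold wt; positivity

lemma max_scale (a x : ℝ) (hx : 0 ≤ x) :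
    (1 + x) ^ a ≤ 2 ^ (max 0 (-a)) * (1 + 2 * x) ^ a := by
  rcases le_total 0 a with ha | ha
  · rw [max_eq_left (by linarith), Real.rpow_zero, one_mul]
    exact Real.rpow_le_rpow (by positivity) (by linarith) ha
  · rw [max_eq_right (by linarith), Real.rpow_neg (by norm_num), ← Real.inv_rpow (by norm_num),
      ← Real.mul_rpow (by positivity) (by positivity)]
    exact Real.rpow_le_rpow_of_nonpos (by positivity) (by linarith) ha

lemma D1 {N : ℕ} {p σ c ε : ℝ} (hp : 1 ≤ p) (hε : 0 < ε)
    (hc : (2 : ℝ) ^ (max (-(N : ℝ) / p) σ + ε) < c) :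
    ∃ C : ℝ≥0∞, C ≠ ∞ ∧ ∀ u : Euc N → ℝ, AEStronglyMeasurable u volume →
      Wn N (σ + ε) (ENNReal.ofReal p) u ≠ ∞ →
      Wn N σ (ENNReal.ofReal p) u ≤ C * Wn N σ (ENNReal.ofReal p) (Td c u) := by
  have hp0 : 0 < p := by linarith
  set P := ENNReal.ofReal p with hP
  have hP1 : 1 ≤ P := by rw [hP]; exact ENNReal.one_le_ofReal.2 hp
  have hPr : P.toReal = p := ENNReal.toReal_ofReal hp0.le
  set θ0 := (2 : ℝ) ^ (max (-(N : ℝ) / p) σ + ε) with hθ0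
  have hθ0p : 0 < θ0 := by positivity
  have hc0 : 0 < c := by linarith
  set a := -σ - (N : ℝ) / p with ha
  refine ⟨ENNReal.ofReal (1 - θ0 / c)⁻¹ * ENNReal.ofReal c⁻¹, by finiteness, ?_⟩
  intro u hu hfin
  -- truncated weights
  let w : ℝ → Euc N → ℝ := fun δ x => wt N σ P x * (1 + δ * ‖x‖) ^ (-ε)
  have hwm : ∀ δ, Measurable (w δ) := fun δ => (wt_meas σ P).mul (by fun_prop)
  have key : ∀ δ : ℝ, 0 < δ → δ ≤ 1 → eLpNorm (fun x => w δ x * u x) P volume ≤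
      ENNReal.ofReal (1 - θ0 / c)⁻¹ * ENNReal.ofReal c⁻¹ * Wn N σ P (Td c u) := by
    intro δ hδ hδ1
    set X := eLpNorm (fun x => w δ x * u x) P volume with hX
    have hXfin : X ≠ ∞ := by
      have : X ≤ ENNReal.ofReal (δ ^ (-ε)) * Wn N (σ + ε) P u := by
        rw [hX, Wn, ← Real.enorm_of_nonneg (by positivity), ← eLpNorm_const_smul]
        apply eLpNorm_mono
        intro x
        simp only [Pi.smul_apply, smul_eq_mul, ← mul_assoc, norm_mul]
        gcongr
        simp only [w, wt, norm_mul]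
        rw [Real.norm_of_nonneg (by positivity), Real.norm_of_nonneg (by positivity),
          Real.norm_of_nonneg (by positivity), Real.norm_of_nonneg (by positivity),
          show -(σ + ε) - (N : ℝ) / P.toReal = (-σ - (N : ℝ) / P.toReal) + (-ε) by ring,
          Real.rpow_add (by positivity)]
        rw [show δ ^ (-ε) * ((1 + ‖x‖) ^ (-σ - (N : ℝ) / P.toReal) * (1 + ‖x‖) ^ (-ε))
          = (1 + ‖x‖) ^ (-σ - (N : ℝ) / P.toReal) * (δ ^ (-ε) * (1 + ‖x‖) ^ (-ε)) by ring]
        gcongr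
        rw [← Real.mul_rpow hδ.le (by positivity)]
        apply Real.rpow_le_rpow_of_nonpos (by positivity) _ (by linarith)
        nlinarith [norm_nonneg x]
      exact ne_top_of_le_ne_top (by finiteness) this
    have hT : eLpNorm (fun x => w δ x * u ((2 : ℝ) • x)) P volume ≤ ENNReal.ofReal θ0 * X := by
      have h1 : eLpNorm (fun x => w δ x * u ((2 : ℝ) • x)) P volume ≤
          ENNReal.ofReal (2 ^ (max 0 (-a)) * 2 ^ ε) *
          eLpNorm (fun x => (fun y => w δ y * u y) ((2 : ℝ) • x)) P volume := by
        rw [← Real.enorm_of_nonneg (by positivity), ← eLpNorm_const_smul]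
        apply eLpNorm_mono
        intro x
        simp only [Pi.smul_apply, smul_eq_mul, ← mul_assoc, norm_mul]
        gcongr
        simp only [w, wt, norm_mul]
        rw [Real.norm_of_nonneg (by positivity), Real.norm_of_nonneg (by positivity),
          Real.norm_of_nonneg (by positivity), Real.norm_of_nonneg (by positivity),
          Real.norm_of_nonneg (by positivity), Real.norm_of_nonneg (by positivity), norm_smul,
          Real.norm_of_nonneg (by norm_num), hPr, ← ha]
        have e1 := max_scale a ‖x‖ (norm_nonneg x)
        have e2 := max_scale (-ε) (δ * ‖x‖) (by positivity)
        rw [neg_neg, max_eq_right hε.le, show 2 * (δ * ‖x‖) = δ * (2 * ‖x‖) by ring] at e2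
        calc _ ≤ (2 ^ max 0 (-a) * (1 + 2 * ‖x‖) ^ a) * (2 ^ ε * (1 + δ * (2 * ‖x‖)) ^ (-ε)) := by
              gcongr
          _ = _ := by ring
      have h2 := eLpNorm_dil (c := (2 : ℝ)) (by norm_num) hp (fun y => w δ y * u y)
      rw [← hP] at h2
      rw [h2, ← mul_assoc, ← ENNReal.ofReal_mul (by positivity)] at h1
      refine h1.trans (le_of_eq ?_)
      congr 2
      rw [hθ0, ← Real.rpow_add (by norm_num), ← Real.rpow_add (by norm_num)]
      congr 1
      rw [ha, ← max_add_add_right]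
      rcases le_total (-(N : ℝ) / p) σ with h | h
      · rw [max_eq_right, max_eq_right]
        · ring
        · linarith
        · have : -(N : ℝ) / p = - (N / p) := by ring
          linarith
      · rw [max_eq_left, max_eq_left]
        · ring
        · linarith
        · have : -(N : ℝ) / p = - (N / p) := by ring
          linarith
    have hTd : eLpNorm (fun x => w δ x * Td c u x) P volume ≤ Wn N σ P (Td c u) := by
      apply eLpNorm_mono
      intro x
      simp only [norm_mul, w]
      gcongr
      rw [Real.norm_of_nonneg (r := (1 + δ * ‖x‖) ^ (-ε)) (by positivity)]
      apply mul_le_of_le_one_right (norm_nonneg _)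
      apply Real.rpow_le_one_of_one_le_of_nonpos
      · have := norm_nonneg x; nlinarith
      · linarith
    have hsum : X ≤ ENNReal.ofReal c⁻¹ * Wn N σ P (Td c u) + ENNReal.ofReal (θ0 / c) * X := by
      have : (fun x => w δ x * u x) =
          c⁻¹ • ((fun x => w δ x * u ((2 : ℝ) • x)) - (fun x => w δ x * Td c u x)) := by
        ext x
        simp only [Pi.smul_apply, Pi.sub_apply, smul_eq_mul, Td]
        field_simp; ring
      have hXe : X = ENNReal.ofReal c⁻¹ * eLpNorm ((fun x => w δ x * u ((2 : ℝ) • x)) -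
          (fun x => w δ x * Td c u x)) P volume := by
        rw [hX, this, eLpNorm_const_smul, Real.enorm_of_nonneg (by positivity)]
      refine hXe.le.trans ?_
      refine (mul_le_mul_right (eLpNorm_sub_le ?_ ?_ hP1) _).trans ?_
      · exact (hwm δ).aestronglyMeasurable.mul (aesm_dil (by norm_num) hu)
      · exact (hwm δ).aestronglyMeasurable.mul (aesm_Td c hu)
      · rw [mul_add, add_comm, div_eq_inv_mul, ENNReal.ofReal_mul (by positivity), mul_assoc]
        gcongr
    have := absorb hXfin (by positivity) (by rw [div_lt_one hc0]; exact hc) hsum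
    rwa [← mul_assoc] at this
  have hlim := Lp.eLpNorm_lim_le_liminf_eLpNorm (p := P) (μ := (volume : Measure (Euc N)))
    (f := fun (n : ℕ) x => w (1 / ((n : ℝ) + 1)) x * u x)
    (fun n => (hwm _).aestronglyMeasurable.mul hu) (fun x => wt N σ P x * u x) (by
      filter_upwards with x
      apply Filter.Tendsto.mul_const
      simp only [w]
      nth_rw 2 [← mul_one (wt N σ P x)]
      apply Filter.Tendsto.const_mul
      have h1 : Tendsto (fun n : ℕ => 1 + 1 / ((n : ℝ) + 1) * ‖x‖) atTop (𝓝 (1 + 0 * ‖x‖)) :=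
        (tendsto_one_div_add_atTop_nhds_zero_nat.mul_const _).const_add 1
      have h2 := h1.rpow_const (p := -ε) (Or.inl (by simp))
      simpa using h2)
  refine hlim.trans ?_
  refine liminf_le_of_le ⟨0, by simp⟩ ?_
  intro b hb
  obtain ⟨n, hn⟩ := hb.exists
  refine hn.trans (key _ (by positivity) ?_)
  rw [div_le_one (by positivity)]
  have : (0 : ℝ) ≤ n := by positivity
  linarith

lemma D2 {N : ℕ} {p σ σ' c : ℝ} (hp : 1 ≤ p) (hc0 : 0 < c) (hc : c < (2 : ℝ) ^ σ) :
    ∃ C : ℝ≥0∞, C ≠ ∞ ∧ ∀ u : Euc N → ℝ, AEStronglyMeasurable u volume →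
      Wn N σ' (ENNReal.ofReal p) u ≠ ∞ →
      Wn N σ (ENNReal.ofReal p) u ≤ C * (Wn N σ (ENNReal.ofReal p) (Td c u) +
        Wn N σ' (ENNReal.ofReal p) u) := by
  have hp0 : 0 < p := by linarith
  set P := ENNReal.ofReal p with hP
  have hP1 : 1 ≤ P := by rw [hP]; exact ENNReal.one_le_ofReal.2 hp
  have hPr : P.toReal = p := ENNReal.toReal_ofReal hp0.le
  set a := -σ - (N : ℝ) / p with ha
  set b := -σ' - (N : ℝ) / p with hb
  set θ := c * 2 ^ (-σ) with hθ
  have hθ1 : θ < 1 := by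
    rw [hθ, Real.rpow_neg (by norm_num), ← div_eq_mul_inv, div_lt_one (by positivity)]; exact hc
  have hθ0 : 0 < θ := by positivity
  -- homogeneous weighted norms on sets
  let f : Set (Euc N) → (Euc N → ℝ) → Euc N → ℝ :=
    fun S u => S.indicator (fun x => ‖x‖ ^ a * u x)
  let m : Set (Euc N) → (Euc N → ℝ) → ℝ≥0∞ := fun S u => eLpNorm (f S u) P volume
  let E : ℝ → ℝ → Set (Euc N) := fun r R => {x | r < ‖x‖ ∧ ‖x‖ ≤ R}
  have hE : ∀ r R, MeasurableSet (E r R) := fun r R =>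
    (measurableSet_lt measurable_const measurable_norm).inter
      (measurableSet_le measurable_norm measurable_const)
  have hfm : ∀ r R u, AEStronglyMeasurable u volume →
      AEStronglyMeasurable (f (E r R) u) volume := by
    intro r R u hu
    refine AEStronglyMeasurable.indicator ?_ (hE r R)
    exact (Measurable.aestronglyMeasurable (by fun_prop)).mul hu
  have hw1 : ∀ (x : Euc N) (e : ℝ), 1 < ‖x‖ → ‖x‖ ^ e ≤ 2 ^ |e| * (1 + ‖x‖) ^ e := fun x e hx =>
    pow_cmp e (by norm_num) (by linarith) (by positivity) (by linarith) (by linarith)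
  have hw2 : ∀ (x : Euc N) (e : ℝ), 1 < ‖x‖ → (1 + ‖x‖) ^ e ≤ 2 ^ |e| * ‖x‖ ^ e := fun x e hx =>
    pow_cmp e (by norm_num) (by positivity) (by linarith) (by linarith) (by linarith)
  -- local bounds
  have hloc : ∀ R : ℝ, 2 ≤ R → ∀ (x : Euc N), ‖x‖ ≤ R →
      (1 + ‖x‖) ^ a ≤ (1 + R) ^ |a - b| * (1 + ‖x‖) ^ b := by
    intro R hR x hx
    have : (1 + ‖x‖) ^ (a - b) ≤ (1 + R) ^ |a - b| * 1 ^ (a - b) :=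
      pow_cmp (a - b) (by linarith) (by positivity) (by norm_num) (by linarith)
        (by have := norm_nonneg x; nlinarith)
    rw [Real.one_rpow, mul_one] at this
    calc (1 + ‖x‖) ^ a = (1 + ‖x‖) ^ (a - b) * (1 + ‖x‖) ^ b := by
          rw [← Real.rpow_add (by positivity)]; congr 1; ring
      _ ≤ _ := by gcongr
  have hmloc : ∀ R : ℝ, 2 ≤ R → ∀ u, m (E 1 R) u ≤
      ENNReal.ofReal (2 ^ |a| * (1 + R) ^ |a - b|) * Wn N σ' P u := by
    intro R hR u
    simp only [m, Wn]
    rw [← Real.enorm_of_nonneg (by positivity), ← eLpNorm_const_smul]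
    apply eLpNorm_mono
    intro x
    simp only [f]
    by_cases hx : x ∈ E 1 R
    · rw [Set.indicator_of_mem hx]
      simp only [Pi.smul_apply, smul_eq_mul, norm_mul, ← mul_assoc]
      gcongr
      simp only [wt, hPr, ← hb]
      rw [Real.norm_of_nonneg (by positivity), Real.norm_of_nonneg (by positivity),
        Real.norm_of_nonneg (by positivity), Real.norm_of_nonneg (by positivity), mul_assoc]
      refine (hw1 x a hx.1).trans ?_
      gcongr
      exact hloc R hR x hx.2
    · rw [Set.indicator_of_notMem hx, norm_zero]; exact norm_nonneg _
  have hmTd : ∀ R : ℝ, ∀ u, m (E 1 R) u ≤ ENNReal.ofReal (2 ^ |a|) * Wn N σ P u := by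
    intro R u
    simp only [m, Wn]
    rw [← Real.enorm_of_nonneg (by positivity), ← eLpNorm_const_smul]
    apply eLpNorm_mono
    intro x
    simp only [f]
    by_cases hx : x ∈ E 1 R
    · rw [Set.indicator_of_mem hx]
      simp only [Pi.smul_apply, smul_eq_mul, norm_mul, ← mul_assoc]
      gcongr
      simp only [wt, hPr, ← ha]
      rw [Real.norm_of_nonneg (by positivity), Real.norm_of_nonneg (by positivity),
        Real.norm_of_nonneg (by positivity)]
      exact hw1 x a hx.1
    · rw [Set.indicator_of_notMem hx, norm_zero]; exact norm_nonneg _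
  -- scaling
  have hscale : ∀ R : ℝ, ∀ u, AEStronglyMeasurable u volume → m (E 2 (2 * R)) u ≤
      ENNReal.ofReal (2 ^ (-σ)) * m (E 1 R) (Td c u) + ENNReal.ofReal θ * m (E 1 R) u := by
    intro R u hu
    have h1 := eLpNorm_dil (c := (2 : ℝ)) (by norm_num) hp (f (E 2 (2 * R)) u)
    have h2 : (fun x => f (E 2 (2 * R)) u ((2 : ℝ) • x)) =
        ((2 : ℝ) ^ a) • (f (E 1 R) (Td c u) + c • f (E 1 R) u) := by
      ext x
      have hn : ‖(2 : ℝ) • x‖ = 2 * ‖x‖ := by rw [norm_smul, Real.norm_of_nonneg (by norm_num)]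
      simp only [f, Pi.smul_apply, Pi.add_apply, smul_eq_mul]
      by_cases hx : x ∈ E 1 R
      · have hx2 : (2 : ℝ) • x ∈ E 2 (2 * R) := by
          simp only [E, Set.mem_ofPred_eq, hn] at hx ⊢
          constructor <;> linarith [hx.1, hx.2]
        rw [Set.indicator_of_mem hx, Set.indicator_of_mem hx2, Set.indicator_of_mem hx, hn,
          Real.mul_rpow (by norm_num) (norm_nonneg _), Td]
        ring
      · have hx2 : (2 : ℝ) • x ∉ E 2 (2 * R) := by
          intro h
          apply hx
          simp only [E, Set.mem_ofPred_eq, hn] at h ⊢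
          constructor <;> linarith [h.1, h.2]
        rw [Set.indicator_of_notMem hx, Set.indicator_of_notMem hx2, Set.indicator_of_notMem hx]
        simp
    rw [h2, eLpNorm_const_smul, Real.enorm_of_nonneg (by positivity), ← hP] at h1
    have h3 : m (E 2 (2 * R)) u = ENNReal.ofReal (2 ^ (-σ)) *
        eLpNorm (f (E 1 R) (Td c u) + c • f (E 1 R) u) P volume := by
      have : ENNReal.ofReal (2 ^ ((N : ℝ) / p)) * (ENNReal.ofReal (2 ^ (-(N : ℝ) / p)) *
          m (E 2 (2 * R)) u) = m (E 2 (2 * R)) u := by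
        rw [← mul_assoc, ← ENNReal.ofReal_mul (by positivity), ← Real.rpow_add (by norm_num)]
        rw [show (N : ℝ) / p + -(N : ℝ) / p = 0 by ring]
        simp
      rw [← this, ← h1, ← mul_assoc, ← ENNReal.ofReal_mul (by positivity),
        ← Real.rpow_add (by norm_num)]
      congr 3
      rw [ha]; ring
    rw [h3]
    refine (mul_le_mul_right (eLpNorm_add_le (hfm _ _ _ (aesm_Td c hu))
      ((hfm _ _ _ hu).const_smul c) hP1) _).trans ?_
    rw [mul_add, eLpNorm_const_smul, Real.enorm_of_nonneg hc0.le, ← mul_assoc (ENNReal.ofReal _)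
      (ENNReal.ofReal c), ← ENNReal.ofReal_mul (by positivity), mul_comm _ c]
  have habs : ∀ R : ℝ, 2 ≤ R → ∀ u, AEStronglyMeasurable u volume → Wn N σ' P u ≠ ∞ →
      m (E 1 R) u ≤ ENNReal.ofReal (1 - θ)⁻¹ * (m (E 1 2) u +
        ENNReal.ofReal (2 ^ (-σ)) * m (E 1 R) (Td c u)) := by
    intro R hR u hu hfin
    apply absorb _ hθ0.le hθ1
    · have h1 : m (E 1 R) u ≤ m (E 1 2) u + m (E 2 (2 * R)) u := by
        refine le_trans ?_ (eLpNorm_add_le (hfm _ _ _ hu) (hfm _ _ _ hu) hP1)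
        apply eLpNorm_mono
        intro x
        simp only [f, Pi.add_apply]
        by_cases hx : x ∈ E 1 R
        · by_cases hx2 : ‖x‖ ≤ 2
          · rw [Set.indicator_of_mem hx, Set.indicator_of_mem (show x ∈ E 1 2 from ⟨hx.1, hx2⟩),
              Set.indicator_of_notMem (fun h => not_lt.2 hx2 h.1), add_zero]
          · push Not at hx2
            rw [Set.indicator_of_mem hx, Set.indicator_of_notMem (fun h => not_le.2 hx2 h.2),
              Set.indicator_of_mem (show x ∈ E 2 (2 * R) from ⟨hx2, by linarith [hx.2]⟩), zero_add]
        · rw [Set.indicator_of_notMem hx, norm_zero]; exact norm_nonneg _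
      refine h1.trans ((add_le_add_right (hscale R u hu) _).trans ?_)
      rw [add_assoc]
    · exact ne_top_of_le_ne_top (by finiteness) (hmloc R hR u)
  set C1 := ENNReal.ofReal ((1 + 2) ^ |a - b|)
  set C2 := ENNReal.ofReal (2 ^ |a|)
  set C3 := ENNReal.ofReal (2 ^ |a| * (1 + 2) ^ |a - b|)
  set C4 := ENNReal.ofReal (2 ^ (-σ))
  set C5 := ENNReal.ofReal (1 - θ)⁻¹
  refine ⟨C1 + C2 * C5 * C3 + C2 * C5 * C4 * C2, by finiteness, ?_⟩
  intro u hu hfin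
  have key : ∀ R : ℝ, 2 ≤ R →
      eLpNorm ((closedBall (0 : Euc N) R).indicator (fun x => wt N σ P x * u x)) P volume ≤
      (C1 + C2 * C5 * C3 + C2 * C5 * C4 * C2) * (Wn N σ P (Td c u) + Wn N σ' P u) := by
    intro R hR
    have h1 : eLpNorm ((closedBall (0 : Euc N) R).indicator (fun x => wt N σ P x * u x)) P volume ≤
        C1 * Wn N σ' P u + C2 * m (E 1 R) u := by
      simp only [C1, C2, m, Wn]
      rw [← Real.enorm_of_nonneg (by positivity), ← eLpNorm_const_smul,
        ← Real.enorm_of_nonneg (by positivity), ← eLpNorm_const_smul,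
        ← eLpNorm_norm (((1 + 2 : ℝ) ^ |a - b|) • _),
        ← eLpNorm_norm (((2 : ℝ) ^ |a|) • _)]
      refine le_trans ?_ (eLpNorm_add_le ?_ ?_ hP1)
      · apply eLpNorm_mono
        intro x
        simp only [Pi.add_apply]
        rw [Real.norm_of_nonneg (add_nonneg (norm_nonneg _) (norm_nonneg _))]
        by_cases hx : x ∈ closedBall (0 : Euc N) R
        · rw [Set.indicator_of_mem hx]
          rw [mem_closedBall_zero_iff] at hx
          by_cases hx1 : 1 < ‖x‖
          · refine le_trans ?_ (le_add_of_nonneg_left (norm_nonneg _))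
            simp only [f, Pi.smul_apply]
            rw [Set.indicator_of_mem (show x ∈ E 1 R from ⟨hx1, hx⟩)]
            simp only [smul_eq_mul, norm_mul, ← mul_assoc]
            gcongr
            simp only [wt, hPr, ← ha]
            rw [Real.norm_of_nonneg (by positivity), Real.norm_of_nonneg (by positivity),
              Real.norm_of_nonneg (by positivity)]
            exact hw2 x a hx1
          · refine le_trans ?_ (le_add_of_nonneg_right (norm_nonneg _))
            simp only [Pi.smul_apply, smul_eq_mul, norm_mul, ← mul_assoc]
            gcongr
            simp only [wt, hPr, ← ha, ← hb]
            rw [Real.norm_of_nonneg (by positivity), Real.norm_of_nonneg (by positivity),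
              Real.norm_of_nonneg (by positivity)]
            exact hloc 2 le_rfl x (by linarith)
        · rw [Set.indicator_of_notMem hx, norm_zero]; positivity
      · exact (((wt_meas σ' P).aestronglyMeasurable.mul hu).const_smul _).norm
      · exact ((hfm _ _ _ hu).const_smul _).norm
    calc _ ≤ C1 * Wn N σ' P u + C2 * m (E 1 R) u := h1
      _ ≤ C1 * Wn N σ' P u + C2 * (C5 * (C3 * Wn N σ' P u + C4 * (C2 * Wn N σ P (Td c u)))) := by
          gcongr
          refine (habs R hR u hu hfin).trans ?_
          gcongr
          · exact hmloc 2 le_rfl u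
          · exact hmTd R _
      _ = (C1 + C2 * C5 * C3) * Wn N σ' P u + C2 * C5 * C4 * C2 * Wn N σ P (Td c u) := by ring
      _ ≤ (C1 + C2 * C5 * C3) * (Wn N σ P (Td c u) + Wn N σ' P u) +
          C2 * C5 * C4 * C2 * (Wn N σ P (Td c u) + Wn N σ' P u) := by
          gcongr
          · exact le_add_self
          · exact le_self_add
      _ = _ := by ring
  have hlim := Lp.eLpNorm_lim_le_liminf_eLpNorm (p := P) (μ := (volume : Measure (Euc N)))
    (f := fun (n : ℕ) => (closedBall (0 : Euc N) ((n : ℝ) + 2)).indicator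
      (fun x => wt N σ P x * u x))
    (fun n => ((wt_meas σ P).aestronglyMeasurable.mul hu).indicator measurableSet_closedBall)
    (fun x => wt N σ P x * u x) (by
      filter_upwards with x
      apply tendsto_const_nhds.congr'
      obtain ⟨n0, hn0⟩ := exists_nat_ge ‖x‖
      filter_upwards [eventually_ge_atTop n0] with n hn
      rw [Set.indicator_of_mem]
      rw [mem_closedBall_zero_iff]
      have : (n0 : ℝ) ≤ n := by exact_mod_cast hn
      linarith)
  refine hlim.trans ?_
  refine liminf_le_of_le ⟨0, by simp⟩ ?_
  intro b hb
  obtain ⟨n, hn⟩ := hb.exists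
  refine hn.trans (key _ ?_)
  have : (0 : ℝ) ≤ n := by positivity
  linarith

lemma Wn_mono {N : ℕ} (σ : ℝ) (q : ℝ≥0∞) {u v : Euc N → ℝ} (h : ∀ x, |u x| ≤ |v x|) :
    Wn N σ q u ≤ Wn N σ q v := by
  apply eLpNorm_mono
  intro x
  rw [norm_mul, norm_mul]
  exact mul_le_mul_of_nonneg_left (h x) (norm_nonneg _)

lemma Wn_add_le {N : ℕ} (σ : ℝ) {q : ℝ≥0∞} (hq : 1 ≤ q) {u v : Euc N → ℝ}
    (hu : AEStronglyMeasurable u volume) (hv : AEStronglyMeasurable v volume) :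
    Wn N σ q (u + v) ≤ Wn N σ q u + Wn N σ q v := by
  unfold Wn
  have := eLpNorm_add_le ((wt_meas σ q).aestronglyMeasurable.mul hu)
    ((wt_meas σ q).aestronglyMeasurable.mul hv) hq
  refine le_trans (le_of_eq ?_) this
  congr 1; ext x; simp [mul_add]

lemma Wn_const_mul {N : ℕ} (σ : ℝ) (q : ℝ≥0∞) (c : ℝ) (u : Euc N → ℝ) :
    Wn N σ q (fun x => c * u x) = ‖c‖ₑ * Wn N σ q u := by
  unfold Wn
  rw [← eLpNorm_const_smul]
  congr 1; ext x; simp; ring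

lemma Td_bdd {N : ℕ} {p : ℝ} (hp : 1 ≤ p) (σ c : ℝ) :
    ∃ C : ℝ≥0∞, C ≠ ∞ ∧ ∀ u : Euc N → ℝ, AEStronglyMeasurable u volume →
      Wn N σ (ENNReal.ofReal p) (Td c u) ≤ C * Wn N σ (ENNReal.ofReal p) u := by
  have hp0 : 0 < p := by linarith
  set P := ENNReal.ofReal p with hP
  have hP1 : 1 ≤ P := by rw [hP]; exact ENNReal.one_le_ofReal.2 hp
  have hPr : P.toReal = p := ENNReal.toReal_ofReal hp0.le
  set a := -σ - (N : ℝ) / p with ha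
  refine ⟨ENNReal.ofReal (2 ^ |a|) * ENNReal.ofReal (2 ^ (-(N : ℝ) / p)) + ‖-c‖ₑ, by finiteness, ?_⟩
  intro u hu
  have h1 : Wn N σ P (fun x => u ((2 : ℝ) • x)) ≤
      ENNReal.ofReal (2 ^ |a|) * (ENNReal.ofReal (2 ^ (-(N : ℝ) / p)) * Wn N σ P u) := by
    unfold Wn
    rw [← eLpNorm_dil (by norm_num) hp]
    rw [← Real.enorm_of_nonneg (by positivity), ← eLpNorm_const_smul]
    apply eLpNorm_mono
    intro x
    simp only [Pi.smul_apply, smul_eq_mul, norm_mul, ← mul_assoc]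
    gcongr
    simp only [wt, hPr, ← ha]
    rw [Real.norm_of_nonneg (by positivity), Real.norm_of_nonneg (by positivity),
      Real.norm_of_nonneg (by positivity)]
    have := norm_nonneg x
    apply pow_cmp a (by norm_num) (by positivity) (by positivity)
    · rw [norm_smul]; norm_num; linarith
    · rw [norm_smul]; norm_num; linarith
  have h2 : Td c u = (fun x => u ((2 : ℝ) • x)) + fun x => (-c) * u x := by
    ext x; simp [Td]; ring
  rw [h2]
  refine (Wn_add_le σ hP1 (aesm_dil (by norm_num) hu) (hu.const_mul _)).trans ?_
  rw [Wn_const_mul, add_mul, mul_assoc]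
  gcongr

/-- iterated dilation differences -/
def V {N : ℕ} : ℝ → ℕ → (Euc N → ℝ) → Euc N → ℝ
  | _, 0, u => u
  | a, n + 1, u => Td ((2 : ℝ) ^ a) (V (a + 1) n u)

lemma aesm_V {N : ℕ} (n : ℕ) : ∀ (a : ℝ) {u : Euc N → ℝ}, AEStronglyMeasurable u volume →
    AEStronglyMeasurable (V a n u) volume := by
  induction n with
  | zero => intro a u hu; exact hu
  | succ n ih => intro a u hu; exact aesm_Td _ (ih (a + 1) hu)

lemma V_bdd {N : ℕ} {p : ℝ} (hp : 1 ≤ p) (σ : ℝ) (n : ℕ) : ∀ a : ℝ,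
    ∃ C : ℝ≥0∞, C ≠ ∞ ∧ ∀ u : Euc N → ℝ, AEStronglyMeasurable u volume →
      Wn N σ (ENNReal.ofReal p) (V a n u) ≤ C * Wn N σ (ENNReal.ofReal p) u := by
  induction n with
  | zero => intro a; exact ⟨1, by simp, fun u _ => by simp [V]⟩
  | succ n ih =>
    intro a
    obtain ⟨C, hC, h⟩ := ih (a + 1)
    obtain ⟨C', hC', h'⟩ := Td_bdd (N := N) hp σ ((2 : ℝ) ^ a)
    refine ⟨C' * C, by finiteness, fun u hu => ?_⟩
    refine (h' _ (aesm_V n _ hu)).trans ?_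
    rw [mul_assoc]; gcongr; exact h u hu

lemma DV {N : ℕ} {p σ ε : ℝ} (hp : 1 ≤ p) (hε : 0 < ε) (n : ℕ) : ∀ a : ℝ,
    (∀ i : ℕ, i < n → (a + i < σ ∨ max (-(N : ℝ) / p) σ + ε < a + i)) →
    ∃ C : ℝ≥0∞, C ≠ ∞ ∧ ∀ u : Euc N → ℝ, AEStronglyMeasurable u volume →
      Wn N (σ + ε) (ENNReal.ofReal p) u ≠ ∞ →
      Wn N σ (ENNReal.ofReal p) u ≤ C * (Wn N σ (ENNReal.ofReal p) (V a n u) +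
        Wn N (σ + ε) (ENNReal.ofReal p) u) := by
  induction n with
  | zero => intro a _; exact ⟨1, by simp, fun u _ _ => by simp [V]⟩
  | succ n ih =>
    intro a hi
    obtain ⟨C, hC, h⟩ := ih (a + 1) (fun i hin => by
      have := hi (i + 1) (by omega); push_cast at this; rwa [add_assoc, add_comm 1])
    obtain ⟨C1, hC1, h1⟩ := V_bdd (N := N) hp (σ + ε) n (a + 1)
    have h2 : ∃ C : ℝ≥0∞, C ≠ ∞ ∧ ∀ u : Euc N → ℝ, AEStronglyMeasurable u volume →
      Wn N (σ + ε) (ENNReal.ofReal p) u ≠ ∞ →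
      Wn N σ (ENNReal.ofReal p) u ≤ C * (Wn N σ (ENNReal.ofReal p) (Td ((2 : ℝ) ^ a) u) +
        Wn N (σ + ε) (ENNReal.ofReal p) u) := by
      rcases hi 0 (by omega) with h0 | h0
      · simp only [Nat.cast_zero, add_zero] at h0
        exact D2 hp (by positivity) (Real.rpow_lt_rpow_of_exponent_lt (by norm_num) h0)
      · simp only [Nat.cast_zero, add_zero] at h0
        obtain ⟨C, hC, h⟩ := D1 (N := N) hp hε (c := (2 : ℝ) ^ a)
          (Real.rpow_lt_rpow_of_exponent_lt (by norm_num) h0)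
        exact ⟨C, hC, fun u hu hf => (h u hu hf).trans (by gcongr; exact le_self_add)⟩
    obtain ⟨C2, hC2, h2⟩ := h2
    refine ⟨C * (C2 + C2 * C1 + 1), by finiteness, fun u hu hf => ?_⟩
    have hm := aesm_V n (a + 1) hu
    have hb := h1 u hu
    have hf' : Wn N (σ + ε) (ENNReal.ofReal p) (V (a + 1) n u) ≠ ∞ :=
      ne_top_of_le_ne_top (ENNReal.mul_ne_top hC1 hf) hb
    refine (h u hu hf).trans ?_
    rw [mul_assoc]
    gcongr
    have h3 := h2 _ hm hf'
    change _ ≤ (C2 + C2 * C1 + 1) * (Wn N σ _ (Td ((2 : ℝ) ^ a) (V (a + 1) n u)) + _)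
    set A := Wn N σ (ENNReal.ofReal p) (Td ((2 : ℝ) ^ a) (V (a + 1) n u))
    set B := Wn N (σ + ε) (ENNReal.ofReal p) u
    calc _ ≤ C2 * (A + C1 * B) + B := by gcongr; exact h3.trans (by gcongr)
      _ = C2 * A + (C2 * C1) * B + 1 * B := by ring
      _ ≤ C2 * (A + B) + (C2 * C1) * (A + B) + 1 * (A + B) := by
        gcongr
        · exact le_self_add
        · exact le_add_self
        · exact le_add_self
      _ = _ := by ring

lemma DV1 {N : ℕ} {p σ ε : ℝ} (hp : 1 ≤ p) (hε : 0 < ε) (n : ℕ) : ∀ a : ℝ,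
    (∀ i : ℕ, i < n → (max (-(N : ℝ) / p) σ + ε < a + i)) →
    ∃ C : ℝ≥0∞, C ≠ ∞ ∧ ∀ u : Euc N → ℝ, AEStronglyMeasurable u volume →
      Wn N (σ + ε) (ENNReal.ofReal p) u ≠ ∞ →
      Wn N σ (ENNReal.ofReal p) u ≤ C * Wn N σ (ENNReal.ofReal p) (V a n u) := by
  induction n with
  | zero => intro a _; exact ⟨1, by simp, fun u _ _ => by simp [V]⟩
  | succ n ih =>
    intro a hi
    obtain ⟨C, hC, h⟩ := ih (a + 1) (fun i hin => by
      have := hi (i + 1) (by omega); push_cast at this; rwa [add_assoc, add_comm 1])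
    obtain ⟨C1, hC1, h1⟩ := V_bdd (N := N) hp (σ + ε) n (a + 1)
    have h0 := hi 0 (by omega)
    simp only [Nat.cast_zero, add_zero] at h0
    obtain ⟨C2, hC2, h2⟩ := D1 (N := N) hp hε (c := (2 : ℝ) ^ a)
          (Real.rpow_lt_rpow_of_exponent_lt (by norm_num) h0)
    refine ⟨C * C2, by finiteness, fun u hu hf => ?_⟩
    have hm := aesm_V n (a + 1) hu
    have hb := h1 u hu
    have hf' : Wn N (σ + ε) (ENNReal.ofReal p) (V (a + 1) n u) ≠ ∞ :=
      ne_top_of_le_ne_top (ENNReal.mul_ne_top hC1 hf) hb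
    refine (h u hu hf).trans ?_
    rw [mul_assoc]
    gcongr
    exact h2 _ hm hf'

/-- partial derivative -/
def pd {N : ℕ} (i : Fin N) (u : Euc N → ℝ) (x : Euc N) : ℝ :=
  fderiv ℝ u x (EuclideanSpace.single i 1)

lemma pderivList_cons {N : ℕ} (i : Fin N) (l : List (Fin N)) (u : Euc N → ℝ) :
    pderivList (i :: l) u = pderivList l (pd i u) := rfl

/-- smooth functions -/
abbrev Sm {N : ℕ} (u : Euc N → ℝ) : Prop := ContDiff ℝ (⊤ : ℕ∞) u

lemma Sm.diff {N : ℕ} {u : Euc N → ℝ} (hu : Sm u) : Differentiable ℝ u :=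
  hu.differentiable (by simp)

lemma Sm.fd {N : ℕ} {u : Euc N → ℝ} (hu : Sm u) : ContDiff ℝ (⊤ : ℕ∞) (fderiv ℝ u) :=
  hu.fderiv_right (by simp)

lemma Sm.pd {N : ℕ} {u : Euc N → ℝ} (hu : Sm u) (i : Fin N) : Sm (pd i u) :=
  hu.fd.clm_apply contDiff_const

lemma Sm.pderivList {N : ℕ} (l : List (Fin N)) : ∀ {u : Euc N → ℝ}, Sm u → Sm (pderivList l u) := by
  induction l with
  | nil => intro u hu; exact hu
  | cons i l ih => intro u hu; exact ih (hu.pd i)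

lemma Sm.dil {N : ℕ} {u : Euc N → ℝ} (hu : Sm u) (c : ℝ) : Sm (fun x => u (c • x)) :=
  hu.comp (contDiff_const_smul c)

lemma Sm.Td {N : ℕ} {u : Euc N → ℝ} (hu : Sm u) (c : ℝ) : Sm (Td c u) :=
  (hu.dil 2).sub (contDiff_const.mul hu)

lemma Sm.V {N : ℕ} (n : ℕ) : ∀ (a : ℝ) {u : Euc N → ℝ}, Sm u → Sm (V a n u) := by
  induction n with
  | zero => intro a u hu; exact hu
  | succ n ih => intro a u hu; exact (ih (a + 1) hu).Td _

lemma Td_const_mul {N : ℕ} (c d : ℝ) (u : Euc N → ℝ) :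
    Td c (fun x => d * u x) = fun x => d * Td c u x := by
  ext x; simp [Td]; ring

lemma pd_Td {N : ℕ} {u : Euc N → ℝ} (hu : Sm u) (i : Fin N) (c : ℝ) :
    pd i (Td (2 * c) u) = fun x => 2 * Td c (pd i u) x := by
  ext x
  have h1 : HasFDerivAt (fun x => u ((2 : ℝ) • x))
      ((fderiv ℝ u ((2 : ℝ) • x)).comp ((2 : ℝ) • ContinuousLinearMap.id ℝ (Euc N))) x :=
    (hu.diff _).hasFDerivAt.comp x ((hasFDerivAt_id x).const_smul (2 : ℝ))
  have h2 : HasFDerivAt (Td (2 * c) u) _ x := h1.sub ((hu.diff x).hasFDerivAt.const_mul (2 * c))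
  simp only [pd, h2.fderiv, Td]
  simp
  ring

lemma pd_V {N : ℕ} (i : Fin N) (n : ℕ) : ∀ (a : ℝ) {u : Euc N → ℝ}, Sm u →
    pd i (V (a + 1) n u) = fun x => 2 ^ n * V a n (pd i u) x := by
  induction n with
  | zero => intro a u hu; ext x; simp [V]
  | succ n ih =>
    intro a u hu
    simp only [V]
    rw [Real.rpow_add (by norm_num), Real.rpow_one, mul_comm, pd_Td (hu.V n _), ih _ hu, Td_const_mul]
    ext x; ring

lemma ftc {N : ℕ} {v : Euc N → ℝ} (hv : Sm v) (x h : Euc N) :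
    ‖v (x + h) - v x‖ₑ ≤ ∫⁻ t in Set.Icc (0 : ℝ) 1, ‖fderiv ℝ v (x + t • h) h‖ₑ := by
  have h1 : ∀ t : ℝ, HasDerivAt (fun t : ℝ => v (x + t • h)) (fderiv ℝ v (x + t • h) h) t := by
    intro t
    have h3 : HasDerivAt (fun t : ℝ => x + t • h) h t := by
      simpa using ((hasDerivAt_id t).smul_const h).const_add x
    exact ((hv.diff _).hasFDerivAt).comp_hasDerivAt t h3
  have hc : Continuous (fun t : ℝ => fderiv ℝ v (x + t • h) h) := by
    have := hv.fd.continuous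
    fun_prop
  have h2 := intervalIntegral.integral_eq_sub_of_hasDerivAt (a := 0) (b := 1)
    (fun t _ => h1 t) (hc.intervalIntegrable _ _)
  simp only [one_smul, zero_smul, add_zero] at h2
  rw [← h2, intervalIntegral.integral_of_le zero_le_one, ← integral_Icc_eq_integral_Ioc]
  exact enorm_integral_le_lintegral_enorm _

lemma fderiv_apply_eq {N : ℕ} (v : Euc N → ℝ) (x h : Euc N) :
    fderiv ℝ v x h = ∑ i, h i * pd i v x := by
  have : h = ∑ i, h i • EuclideanSpace.single i (1 : ℝ) := by
    ext j; simp [Pi.single_apply]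
  conv_lhs => rw [this]
  simp [pd]

lemma fderiv_apply_le {N : ℕ} (v : Euc N → ℝ) (x h : Euc N) :
    ‖fderiv ℝ v x h‖ₑ ≤ ∑ i, ‖pd i v x‖ₑ * ‖h‖ₑ := by
  rw [fderiv_apply_eq]
  refine (enorm_sum_le _ _).trans (Finset.sum_le_sum fun i _ => ?_)
  rw [enorm_mul, mul_comm]
  gcongr
  rw [enorm_le_iff_norm_le]
  exact PiLp.norm_apply_le h i

lemma E1 {N : ℕ} {p : ℝ} (hp : 1 ≤ p) (s : ℝ) :
    ∃ C : ℝ≥0∞, C ≠ ∞ ∧ ∀ v : Euc N → ℝ, Sm v →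
      Wn N (s + 1) (ENNReal.ofReal p) (Td 1 v) ≤ C * ∑ i, Wn N s (ENNReal.ofReal p) (pd i v) := by
  have hp0 : 0 < p := by linarith
  set b := -s * p - N with hb
  refine ⟨((((volume.restrict (Set.Icc (0 : ℝ) 1)).prod (Measure.count (α := Fin N))) Set.univ) ^ p
    * ENNReal.ofReal (2 ^ |b|)) ^ (1 / p), by finiteness, ?_⟩
  intro v hv
  apply rpow_le_of_le hp
  rw [Wn_rpow _ hp, mul_assoc]
  apply K_avg _ _ hp _ (fun z x => ‖pd z.2 v (x + z.1 • x)‖ₑ * ‖x‖ₑ)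
  · have h1 := hv.fd.continuous
    have h2 : Continuous (fun i : Fin N => (EuclideanSpace.single i (1 : ℝ) : Euc N)) :=
      continuous_of_discreteTopology
    unfold pd Function.uncurry
    beta_reduce; apply Measurable.fun_mul <;> apply Continuous.measurable <;> fun_prop
  · intro x
    have h0 := ftc hv x x
    rw [lintegral_prod _ (by
      have h1 := hv.fd.continuous
      have h2 : Continuous (fun i : Fin N => (EuclideanSpace.single i (1 : ℝ) : Euc N)) :=
        continuous_of_discreteTopology
      unfold pd
      apply AEMeasurable.fun_mul <;> apply Continuous.aemeasurable <;> fun_prop)]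
    have h1 : Td 1 v x = v (x + x) - v x := by simp [Td, two_smul]
    rw [h1]
    refine h0.trans (lintegral_mono fun t => ?_)
    rw [lintegral_count, tsum_fintype]
    exact fderiv_apply_le _ _ _
  · have : ∀ᵐ t ∂(volume.restrict (Set.Icc (0 : ℝ) 1)), t ∈ Set.Icc (0 : ℝ) 1 :=
      ae_restrict_mem measurableSet_Icc
    have h3 := (Measure.quasiMeasurePreserving_fst (μ := volume.restrict (Set.Icc (0 : ℝ) 1))
      (ν := Measure.count (α := Fin N))).ae this
    filter_upwards [h3] with z hz
    obtain ⟨t, i⟩ := z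
    simp only at hz ⊢
    have ht : 0 < 1 + t := by linarith [hz.1]
    calc K (-(s + 1) * p - N) p (fun x => ‖pd i v (x + t • x)‖ₑ * ‖x‖ₑ)
        ≤ ∫⁻ x, ENNReal.ofReal (2 ^ |b|) * (ENNReal.ofReal ((1 + ‖(1 + t) • x‖) ^ b)
          * ‖pd i v ((1 + t) • x)‖ₑ ^ p) := by
          unfold K
          apply lintegral_mono
          intro x
          have hx := norm_nonneg x
          have e1 : x + t • x = (1 + t) • x := by rw [add_smul, one_smul]
          have e2 : ‖(1 + t) • x‖ = (1 + t) * ‖x‖ := by rw [norm_smul, Real.norm_of_nonneg ht.le]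
          simp only
          rw [e1, ENNReal.mul_rpow_of_nonneg _ _ hp0.le, mul_comm (_ ^ p), ← mul_assoc, ← mul_assoc]
          refine mul_le_mul' ?_ le_rfl
          have e3 : ‖x‖ₑ ^ p ≤ ENNReal.ofReal ((1 + ‖x‖) ^ p) := by
            rw [← enn_ofReal_rpow (by positivity), ← ofReal_norm]
            gcongr; linarith
          refine (mul_le_mul_right e3 _).trans ?_
          rw [← ENNReal.ofReal_mul (by positivity), ← Real.rpow_add (by positivity),
            ← ENNReal.ofReal_mul (by positivity)]
          apply ENNReal.ofReal_le_ofReal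
          have e4 : -(s + 1) * p - N + p = b := by rw [hb]; ring
          rw [e4, e2]
          apply pow_cmp b (by norm_num) (by positivity) (by positivity)
          · nlinarith [hz.1]
          · nlinarith [hz.1, hz.2]
      _ = ENNReal.ofReal (2 ^ |b|) * (ENNReal.ofReal ((1 + t) ^ (-(N : ℝ))) *
            K b p (fun x => ‖pd i v x‖ₑ)) := by
          rw [lintegral_const_mul' _ _ (by finiteness), lintegral_dil ht
            (fun x => ENNReal.ofReal ((1 + ‖x‖) ^ b) * ‖pd i v x‖ₑ ^ p)]
          rfl
      _ ≤ ENNReal.ofReal (2 ^ |b|) * (1 * Wn N s (ENNReal.ofReal p) (pd i v) ^ p) := by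
          rw [hb, ← Wn_rpow _ hp]
          gcongr
          rw [ENNReal.ofReal_le_one]
          apply Real.rpow_le_one_of_one_le_of_nonpos (by linarith [hz.1])
          simp
      _ ≤ _ := by
          rw [one_mul]
          gcongr
          exact Finset.single_le_sum (f := fun i => Wn N s (ENNReal.ofReal p) (pd i v))
            (fun _ _ => zero_le) (Finset.mem_univ i)

lemma sum_cons {N n : ℕ} (F : List (Fin N) → ℝ≥0∞) :
    ∑ m : Fin (n + 1) → Fin N, F (List.ofFn m) =
      ∑ i : Fin N, ∑ m : Fin n → Fin N, F (i :: List.ofFn m) := by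
  rw [← (Fin.consEquiv (fun _ : Fin (n + 1) => Fin N)).sum_comp, Fintype.sum_prod_type]
  simp [Fin.consEquiv, List.ofFn_succ]

lemma EV {N : ℕ} {p : ℝ} (hp : 1 ≤ p) (s : ℝ) (n : ℕ) :
    ∃ C : ℝ≥0∞, C ≠ ∞ ∧ ∀ v : Euc N → ℝ, Sm v →
      Wn N (s + n) (ENNReal.ofReal p) (V 0 n v) ≤
        C * ∑ m : Fin n → Fin N, Wn N s (ENNReal.ofReal p) (pderivList (List.ofFn m) v) := by
  induction n with
  | zero => exact ⟨1, by simp, fun v hv => by simp [V, pderivList]⟩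
  | succ n ih =>
    obtain ⟨C, hC, h⟩ := ih
    obtain ⟨C', hC', h'⟩ := E1 (N := N) hp (s + n)
    refine ⟨C' * (‖(2 : ℝ) ^ n‖ₑ * C), by finiteness, fun v hv => ?_⟩
    have := h' _ (hv.V n (0 + 1))
    rw [sum_cons (fun l => Wn N s (ENNReal.ofReal p) (pderivList l v))]
    push_cast
    rw [← add_assoc]
    simp only [V, Real.rpow_zero]
    refine this.trans ?_
    rw [mul_assoc]
    gcongr
    rw [Finset.mul_sum]
    apply Finset.sum_le_sum
    intro i _
    rw [pd_V i n 0 hv, Wn_const_mul, mul_assoc]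
    gcongr
    exact h _ (hv.pd i)

/-- convolution -/
def cv {N : ℕ} (ρ u : Euc N → ℝ) (x : Euc N) : ℝ := ∫ y, ρ (x - y) * u y

open Convolution in
lemma cv_eq {N : ℕ} (ρ u : Euc N → ℝ) :
    cv ρ u = (ρ ⋆[ContinuousLinearMap.lsmul ℝ ℝ, volume] u) := by
  ext x
  rw [convolution_lsmul_swap]
  rfl

lemma cs_pd {N : ℕ} {ρ : Euc N → ℝ} (hc : HasCompactSupport ρ) (i : Fin N) :
    HasCompactSupport (pd i ρ) := hc.fderiv_apply ℝ _

lemma Sm_cv {N : ℕ} {ρ u : Euc N → ℝ} (hρ : Sm ρ) (hc : HasCompactSupport ρ)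
    (hu : LocallyIntegrable u volume) : Sm (cv ρ u) := by
  rw [cv_eq]
  exact hc.contDiff_convolution_left _ hρ hu

lemma pd_cv {N : ℕ} {ρ u : Euc N → ℝ} (hρ : Sm ρ) (hc : HasCompactSupport ρ)
    (hu : LocallyIntegrable u volume) (i : Fin N) : pd i (cv ρ u) = cv (pd i ρ) u := by
  ext x
  unfold pd
  have h1 := hc.hasFDerivAt_convolution_left (ContinuousLinearMap.lsmul ℝ ℝ)
    (hρ.of_le (by simp)) hu x (μ := volume)
  rw [cv_eq, h1.fderiv, convolution_eq_swap]
  rw [ContinuousLinearMap.integral_apply]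
  · simp [cv]
  · have hce := (hc.fderiv ℝ).convolutionExists_left
      ((ContinuousLinearMap.lsmul ℝ ℝ).precompL (Euc N) : (Euc N →L[ℝ] ℝ) →L[ℝ] ℝ →L[ℝ] _)
      (μ := volume) hρ.fd.continuous hu x
    exact hce.integrable_swap

lemma pderivList_cv {N : ℕ} {u : Euc N → ℝ} (hu : LocallyIntegrable u volume) (l : List (Fin N)) :
    ∀ {ρ : Euc N → ℝ}, Sm ρ → HasCompactSupport ρ →
      pderivList l (cv ρ u) = cv (pderivList l ρ) u := by
  induction l with
  | nil => intro ρ _ _; rfl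
  | cons i l ih =>
    intro ρ hρ hc
    rw [pderivList_cons, pderivList_cons, pd_cv hρ hc hu, ih (hρ.pd i) (cs_pd hc i)]

lemma pd_const_mul {N : ℕ} {u : Euc N → ℝ} (hu : Sm u) (i : Fin N) (c : ℝ) :
    pd i (fun x => c * u x) = fun x => c * pd i u x := by
  ext x
  unfold pd
  rw [((hu.diff x).hasFDerivAt.const_mul c).fderiv]
  simp

lemma pderivList_const_mul {N : ℕ} (l : List (Fin N)) (c : ℝ) : ∀ {u : Euc N → ℝ}, Sm u →
    pderivList l (fun x => c * u x) = fun x => c * pderivList l u x := by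
  induction l with
  | nil => intro u _; rfl
  | cons i l ih =>
    intro u hu
    rw [pderivList_cons, pderivList_cons, pd_const_mul hu, ih (hu.pd i)]

/-- affine change of variables -/
lemma pd_affine {N : ℕ} {u : Euc N → ℝ} (hu : Sm u) (i : Fin N) (z : Euc N) (r : ℝ) :
    pd i (fun x => u (z + r • x)) = fun x => r * pd i u (z + r • x) := by
  ext x
  have h0 : HasFDerivAt (fun x : Euc N => z + r • x) (r • ContinuousLinearMap.id ℝ (Euc N)) x :=
    ((hasFDerivAt_id x).const_smul r).const_add z
  have h1 : HasFDerivAt (fun x => u (z + r • x))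
      ((fderiv ℝ u (z + r • x)).comp (r • ContinuousLinearMap.id ℝ (Euc N))) x :=
    (hu.diff _).hasFDerivAt.comp x h0
  simp [pd, h1.fderiv]

lemma Sm.affine {N : ℕ} {u : Euc N → ℝ} (hu : Sm u) (z : Euc N) (r : ℝ) :
    Sm (fun x => u (z + r • x)) :=
  hu.comp (contDiff_const.add (contDiff_const_smul r))

lemma pderivList_affine {N : ℕ} (l : List (Fin N)) (z : Euc N) (r : ℝ) : ∀ {u : Euc N → ℝ}, Sm u →
    pderivList l (fun x => u (z + r • x)) = fun x => r ^ l.length * pderivList l u (z + r • x) := by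
  induction l with
  | nil => intro u _; simp [pderivList]
  | cons i l ih =>
    intro u hu
    rw [pderivList_cons, pderivList_cons, pd_affine hu, pderivList_const_mul _ _ ((hu.pd i).affine z r),
      ih (hu.pd i)]
    ext x; simp only [List.length_cons]; ring

lemma cv_weak {N : ℕ} {l : List (Fin N)} {u g ρ : Euc N → ℝ} (h : IsWeakDerivList l u g)
    (hρ : Sm ρ) (hc : HasCompactSupport ρ) : pderivList l (cv ρ u) = cv ρ g := by
  rw [pderivList_cv h.1 l hρ hc]
  ext x
  have h1 := h.2.2 (fun y => ρ (x + (-1 : ℝ) • y)) (hρ.affine x (-1)) (by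
    have : (fun y => ρ (x + (-1 : ℝ) • y)) = ρ ∘ (Homeomorph.subLeft x) := by
      ext y; simp [sub_eq_add_neg]
    rw [this]
    exact hc.comp_homeomorph _)
  rw [pderivList_affine l x (-1) hρ] at h1
  have h2 : ∀ y : Euc N, x + (-1 : ℝ) • y = x - y := fun y => by simp [sub_eq_add_neg]
  simp only [h2] at h1
  unfold cv
  have h3 : ((-1 : ℝ) ^ l.length) * ((-1 : ℝ) ^ l.length) = 1 := by
    rw [← mul_pow]; simp
  have h4 : ∫ y, u y * ((-1 : ℝ) ^ l.length * pderivList l ρ (x - y)) =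
      (-1 : ℝ) ^ l.length * ∫ y, pderivList l ρ (x - y) * u y := by
    rw [← integral_const_mul]; congr 1; ext y; ring
  rw [h4] at h1
  have h5 := mul_left_cancel₀ (pow_ne_zero _ (by norm_num)) h1
  rw [h5]
  congr 1; ext y; ring

lemma Wn_congr {N : ℕ} (σ : ℝ) (q : ℝ≥0∞) {u v : Euc N → ℝ} (h : u =ᵐ[volume] v) :
    Wn N σ q u = Wn N σ q v := by
  apply eLpNorm_congr_ae
  filter_upwards [h] with x hx
  rw [hx]

lemma cv_congr {N : ℕ} (ρ : Euc N → ℝ) {u v : Euc N → ℝ} (h : u =ᵐ[volume] v) :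
    cv ρ u = cv ρ v := by
  ext x
  apply integral_congr_ae
  filter_upwards [h] with y hy
  rw [hy]

lemma Wn_cv {N : ℕ} {p : ℝ} (hp : 1 ≤ p) (σ : ℝ) :
    ∃ C : ℝ≥0∞, C ≠ ∞ ∧ ∀ ρ : Euc N → ℝ, Continuous ρ → (∀ x, 0 ≤ ρ x) → ∫ x, ρ x = 1 →
      Integrable ρ volume → (∀ x, 1 < ‖x‖ → ρ x = 0) → ∀ u : Euc N → ℝ,
      AEStronglyMeasurable u volume →
      Wn N σ (ENNReal.ofReal p) (cv ρ u) ≤ C * Wn N σ (ENNReal.ofReal p) u := by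
  have hp0 : 0 < p := by linarith
  set b := -σ * p - N with hb
  refine ⟨(1 * ENNReal.ofReal (2 ^ |b|)) ^ (1 / p), by finiteness, ?_⟩
  intro ρ hρc hρ0 hρ1 hρi hρs u hu
  wlog hum : Measurable u generalizing u
  · have h1 := hu.ae_eq_mk
    rw [Wn_congr _ _ h1, cv_congr ρ h1]
    exact this _ hu.stronglyMeasurable_mk.aestronglyMeasurable hu.stronglyMeasurable_mk.measurable
  set μ := (volume : Measure (Euc N)).withDensity (fun t => ENNReal.ofReal (ρ t)) with hμ
  have hρm : Measurable (fun t => ENNReal.ofReal (ρ t)) := hρc.measurable.ennreal_ofReal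
  have hμ1 : μ Set.univ = 1 := by
    rw [hμ, withDensity_apply _ MeasurableSet.univ, Measure.restrict_univ,
      ← ofReal_integral_eq_lintegral_ofReal hρi (Filter.Eventually.of_forall hρ0), hρ1,
      ENNReal.ofReal_one]
  have : IsFiniteMeasure μ := ⟨by rw [hμ1]; simp⟩
  apply rpow_le_of_le hp
  rw [Wn_rpow _ hp, Wn_rpow _ hp, mul_assoc, ← ENNReal.one_rpow p, ← hμ1]
  apply K_avg μ _ hp _ (fun t x => ‖u (x - t)‖ₑ)
  · exact (hum.comp (measurable_snd.sub measurable_fst)).enorm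
  · intro x
    rw [hμ, lintegral_withDensity_eq_lintegral_mul _ hρm
      (show Measurable (fun t => ‖u (x - t)‖ₑ) by fun_prop)]
    unfold cv
    refine (enorm_integral_le_lintegral_enorm _).trans ?_
    rw [← lintegral_sub_left_eq_self _ x]
    apply lintegral_mono
    intro t
    simp only [Pi.mul_apply, enorm_mul]
    have e : x - (x - t) = t := by abel
    rw [e, Real.enorm_of_nonneg (hρ0 _)]
  · have hs : ∀ᵐ t ∂μ, ‖t‖ ≤ 1 := by
      rw [hμ, ae_withDensity_iff hρm]
      filter_upwards with t ht
      by_contra hcon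
      exact ht (by rw [hρs t (not_le.1 hcon)]; simp)
    filter_upwards [hs] with t ht
    unfold K
    rw [← lintegral_const_mul' _ _ (by finiteness), ← lintegral_sub_right_eq_self
      (fun x => ENNReal.ofReal (2 ^ |b|) * (ENNReal.ofReal ((1 + ‖x‖) ^ b) * ‖u x‖ₑ ^ p)) t]
    apply lintegral_mono
    intro x
    simp only
    rw [← mul_assoc]
    refine mul_le_mul' ?_ le_rfl
    rw [← ENNReal.ofReal_mul (by positivity)]
    apply ENNReal.ofReal_le_ofReal
    have h1 := norm_sub_norm_le x t
    have h2 := norm_sub_le x t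
    apply pow_cmp b (by norm_num) (by positivity) (by positivity) <;>
      linarith [norm_nonneg x, norm_nonneg (x - t)]

lemma Wn_lim {N : ℕ} (σ : ℝ) (q : ℝ≥0∞) {f : ℕ → Euc N → ℝ} {u : Euc N → ℝ} {M : ℝ≥0∞}
    (hf : ∀ n, AEStronglyMeasurable (f n) volume)
    (hlim : ∀ᵐ x, Tendsto (fun n => f n x) atTop (𝓝 (u x))) (hM : ∀ n, Wn N σ q (f n) ≤ M) :
    Wn N σ q u ≤ M := by
  have hl := Lp.eLpNorm_lim_le_liminf_eLpNorm (p := q) (μ := (volume : Measure (Euc N)))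
    (f := fun (n : ℕ) x => wt N σ q x * f n x)
    (fun n => (wt_meas σ q).aestronglyMeasurable.mul (hf n)) (fun x => wt N σ q x * u x) (by
      filter_upwards [hlim] with x hx
      exact hx.const_mul _)
  refine hl.trans ?_
  refine liminf_le_of_le ⟨0, by simp⟩ ?_
  intro b hb
  obtain ⟨n, hn⟩ := hb.exists
  exact hn.trans (hM n)

lemma lim_V {N : ℕ} (n : ℕ) : ∀ (a : ℝ) {f : ℕ → Euc N → ℝ} {u : Euc N → ℝ},
    (∀ᵐ x, Tendsto (fun n => f n x) atTop (𝓝 (u x))) →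
    ∀ᵐ x, Tendsto (fun j => V a n (f j) x) atTop (𝓝 (V a n u x)) := by
  induction n with
  | zero => intro a f u h; exact h
  | succ n ih =>
    intro a f u h
    have h1 := ih (a + 1) h
    have h2 : ∀ᵐ x : Euc N, Tendsto (fun j => V (a + 1) n (f j) ((2 : ℝ) • x)) atTop
        (𝓝 (V (a + 1) n u ((2 : ℝ) • x))) := by
      have hq : Measure.QuasiMeasurePreserving (fun x : Euc N => (2 : ℝ) • x) volume volume := by
        refine ⟨measurable_const_smul _, ?_⟩
        rw [Measure.map_addHaar_smul volume (by norm_num : (2 : ℝ) ≠ 0)]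
        exact Measure.smul_absolutelyContinuous
      exact hq.ae h1
    filter_upwards [h1, h2] with x hx hx2
    exact hx2.sub (hx.const_mul _)

lemma moll {N : ℕ} {p : ℝ} (hp : 1 ≤ p) (s σ : ℝ) :
    ∃ C : ℝ≥0∞, C ≠ ∞ ∧ ∀ {ι : Type} (L : ι → List (Fin N)) (u : Euc N → ℝ) (g : ι → Euc N → ℝ),
      LocallyIntegrable u volume → (∀ m, IsWeakDerivList (L m) u (g m)) →
      ∃ f : ℕ → Euc N → ℝ, (∀ n, Sm (f n)) ∧
        (∀ᵐ x, Tendsto (fun n => f n x) atTop (𝓝 (u x))) ∧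
        (∀ n, Wn N σ (ENNReal.ofReal p) (f n) ≤ C * Wn N σ (ENNReal.ofReal p) u) ∧
        ∀ n m, Wn N s (ENNReal.ofReal p) (pderivList (L m) (f n)) ≤
          C * Wn N s (ENNReal.ofReal p) (g m) := by
  obtain ⟨C1, hC1, h1⟩ := Wn_cv (N := N) hp σ
  obtain ⟨C2, hC2, h2⟩ := Wn_cv (N := N) hp s
  refine ⟨C1 + C2, by finiteness, ?_⟩
  intro ι L u g hu hg
  let φ : ℕ → ContDiffBump (0 : Euc N) := fun n =>
    ⟨1 / ((n : ℝ) + 2) , 2 * (1 / ((n : ℝ) + 2)), by positivity, by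
      have : 0 < 1 / ((n : ℝ) + 2) := by positivity
      linarith⟩
  have hr : ∀ n, (φ n).rOut ≤ 1 := by
    intro n
    change 2 * (1 / ((n : ℝ) + 2)) ≤ 1
    rw [mul_one_div, div_le_one (by positivity)]
    have : (0 : ℝ) ≤ n := by positivity
    linarith
  have hsm : ∀ n, Sm ((φ n).normed volume) := fun n => (φ n).contDiff_normed
  have hcs : ∀ n, HasCompactSupport ((φ n).normed volume) := fun n => (φ n).hasCompactSupport_normed
  have hz : ∀ n, ∀ x : Euc N, 1 < ‖x‖ → (φ n).normed volume x = 0 := by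
    intro n x hx
    have : x ∉ Function.support ((φ n).normed (volume : Measure (Euc N))) := by
      rw [(φ n).support_normed_eq, mem_ball_zero_iff]
      linarith [hr n]
    simpa using this
  refine ⟨fun n => cv ((φ n).normed volume) u, fun n => Sm_cv (hsm n) (hcs n) hu, ?_, ?_, ?_⟩
  · simp only [cv_eq]
    apply ContDiffBump.ae_convolution_tendsto_right_of_locallyIntegrable (K := 2) _ _ hu
    · have := tendsto_one_div_add_atTop_nhds_zero_nat (𝕜 := ℝ)
      have h3 := ((tendsto_add_atTop_iff_nat 1).2 this).const_mul (2 : ℝ)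
      simp only [mul_zero] at h3
      refine h3.congr fun n => ?_
      change _ = 2 * (1 / ((n : ℝ) + 2))
      push_cast
      ring_nf
    · exact Filter.Eventually.of_forall fun n => le_rfl
  · intro n
    refine (h1 _ (hsm n).continuous (φ n).nonneg_normed (φ n).integral_normed
      (φ n).integrable_normed (hz n) u hu.aestronglyMeasurable).trans ?_
    gcongr; exact le_self_add
  · intro n m
    rw [cv_weak (hg m) (hsm n) (hcs n)]
    refine (h2 _ (hsm n).continuous (φ n).nonneg_normed (φ n).integral_normed
      (φ n).integrable_normed (hz n) _ (hg m).2.1.aestronglyMeasurable).trans ?_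
    gcongr; exact le_add_self

lemma EV' {N : ℕ} {p : ℝ} (hp : 1 ≤ p) (s : ℝ) (k : ℕ) :
    ∃ C : ℝ≥0∞, C ≠ ∞ ∧ ∀ (u : Euc N → ℝ) (g : (Fin k → Fin N) → Euc N → ℝ),
      LocallyIntegrable u volume → (∀ m, IsWeakDerivList (List.ofFn m) u (g m)) →
      Wn N (s + k) (ENNReal.ofReal p) (V 0 k u) ≤
        C * ∑ m : Fin k → Fin N, Wn N s (ENNReal.ofReal p) (g m) := by
  obtain ⟨C, hC, h⟩ := EV (N := N) hp s k
  obtain ⟨C', hC', h'⟩ := moll (N := N) hp s (s + k)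
  refine ⟨C * C', by finiteness, fun u g hu hg => ?_⟩
  obtain ⟨f, hf, hlim, -, hb⟩ := h' _ u g hu hg
  apply Wn_lim _ _ _ (lim_V k 0 hlim)
  · intro n
    refine (h _ (hf n)).trans ?_
    rw [mul_assoc, Finset.mul_sum (a := C')]
    gcongr with m
    exact hb n m
  · intro n
    exact aesm_V k 0 (hf n).continuous.aestronglyMeasurable

lemma hoelderB {N : ℕ} {p ε : ℝ} (hp : 1 ≤ p) (hε : 0 < ε) (σ : ℝ) {q : ℝ≥0∞}
    (hq : ENNReal.ofReal p ≤ q) :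
    ∃ C : ℝ≥0∞, C ≠ ∞ ∧ ∀ u : Euc N → ℝ, AEStronglyMeasurable u volume →
      Wn N (σ + ε) (ENNReal.ofReal p) u ≤ C * Wn N σ q u := by
  have hp0 : 0 < p := by linarith
  have hPr : (ENNReal.ofReal p).toReal = p := ENNReal.toReal_ofReal hp0.le
  rcases eq_or_lt_of_le hq with h | h
  · refine ⟨1, by simp, fun u hu => ?_⟩
    rw [one_mul, ← h]
    apply eLpNorm_mono
    intro x
    rw [norm_mul, norm_mul]
    gcongr
    simp only [wt]
    rw [Real.norm_of_nonneg (by positivity), Real.norm_of_nonneg (by positivity)]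
    apply Real.rpow_le_rpow_of_exponent_le (by linarith [norm_nonneg x])
    linarith
  · have hq0 : q ≠ 0 := (lt_of_le_of_lt zero_le h).ne'
    have hd : 0 < 1 / p - 1 / q.toReal := by
      rcases eq_or_ne q ∞ with h1 | h1
      · simp [h1, hp0]
      · rw [sub_pos]
        apply one_div_lt_one_div_of_lt hp0
        rwa [← ENNReal.ofReal_lt_iff_lt_toReal hp0.le h1]
    set r := (1 / p - 1 / q.toReal)⁻¹ with hr
    have hr0 : 0 < r := by positivity
    have hri : r⁻¹ = 1 / p - 1 / q.toReal := by rw [hr, inv_inv]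
    have hqi : q⁻¹ = ENNReal.ofReal (1 / q.toReal) := by
      rcases eq_or_ne q ∞ with h1 | h1
      · simp [h1]
      · rw [one_div, ← ENNReal.toReal_inv, ENNReal.ofReal_toReal (by simp [hq0])]
    have hHT : ENNReal.HolderTriple (ENNReal.ofReal r) q (ENNReal.ofReal p) := by
      constructor
      rw [hqi, ← ENNReal.ofReal_inv_of_pos hr0, ← ENNReal.ofReal_inv_of_pos hp0,
        ← ENNReal.ofReal_add (by positivity) (by positivity), hri]
      congr 1
      rw [one_div]; ring
    let w : Euc N → ℝ := fun x => (1 + ‖x‖) ^ (-ε - (N : ℝ) / r)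
    refine ⟨eLpNorm w (ENNReal.ofReal r) volume, ?_, fun u hu => ?_⟩
    · rw [eLpNorm_eq_lintegral_rpow_enorm_toReal (by simpa using hr0) (by simp),
        ENNReal.toReal_ofReal hr0.le]
      apply ENNReal.rpow_ne_top_of_nonneg (by positivity)
      have h2 := finite_integral_one_add_norm (μ := (volume : Measure (Euc N)))
        (r := N + ε * r) (by simp; positivity)
      rw [← lt_top_iff_ne_top]
      refine lt_of_eq_of_lt ?_ h2
      congr 1; ext x
      rw [Real.enorm_of_nonneg (by positivity), enn_ofReal_rpow (by positivity)]
      congr 1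
      simp only [w]
      rw [← Real.rpow_mul (by positivity)]
      congr 1
      field_simp
      ring
    · have h3 := eLpNorm_smul_le_mul_eLpNorm (p := ENNReal.ofReal r) (q := q)
        (r := ENNReal.ofReal p) (μ := (volume : Measure (Euc N)))
        (f := fun x => wt N σ q x * u x) (φ := w)
        ((wt_meas σ q).aestronglyMeasurable.mul hu)
        (Measurable.aestronglyMeasurable (by fun_prop))
      refine le_trans (le_of_eq ?_) h3
      unfold Wn
      congr 1
      ext x
      simp only [Pi.smul_apply', smul_eq_mul, w, wt, hPr]
      rw [← mul_assoc, ← Real.rpow_add (by positivity)]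
      congr 2
      rw [div_eq_mul_inv _ r, hri]
      ring

/-- local norms -/
def Lb {N : ℕ} (R : ℝ) (q : ℝ≥0∞) (f : Euc N → ℝ) : ℝ≥0∞ :=
  eLpNorm f q (volume.restrict (ball (0 : Euc N) R))

lemma Lb_eq {N : ℕ} (R : ℝ) (q : ℝ≥0∞) (f : Euc N → ℝ) :
    Lb R q f = eLpNorm ((ball (0 : Euc N) R).indicator f) q volume := by
  rw [eLpNorm_indicator_eq_eLpNorm_restrict measurableSet_ball]; rfl

lemma Lb_dil {N : ℕ} {p t : ℝ} (hp : 1 ≤ p) (ht : 0 < t) (ht1 : t ≤ 1) (f : Euc N → ℝ) :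
    Lb 1 (ENNReal.ofReal p) (fun x => f (t • x)) ≤
      ENNReal.ofReal (t ^ (-(N : ℝ) / p)) * Lb 1 (ENNReal.ofReal p) f := by
  rw [Lb_eq, Lb_eq, ← eLpNorm_dil ht hp]
  apply eLpNorm_mono
  intro x
  by_cases hx : x ∈ ball (0 : Euc N) 1
  · rw [Set.indicator_of_mem hx, Set.indicator_of_mem]
    rw [mem_ball_zero_iff] at hx ⊢
    rw [norm_smul, Real.norm_of_nonneg ht.le]
    nlinarith [norm_nonneg x]
  · rw [Set.indicator_of_notMem hx, norm_zero]; exact norm_nonneg _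

lemma Lb_one_le {N : ℕ} {p : ℝ} (hp : 1 ≤ p) (R : ℝ) {f : Euc N → ℝ}
    (hf : AEStronglyMeasurable f volume) :
    ∫⁻ x in ball (0 : Euc N) R, ‖f x‖ₑ ≤
      volume (ball (0 : Euc N) R) ^ (1 - 1 / p) * Lb R (ENNReal.ofReal p) f := by
  have h := eLpNorm_le_eLpNorm_mul_rpow_measure_univ (p := 1) (q := ENNReal.ofReal p)
    (μ := volume.restrict (ball (0 : Euc N) R)) (f := f) (ENNReal.one_le_ofReal.2 hp) hf.restrict
  rw [eLpNorm_one_eq_lintegral_enorm, ENNReal.toReal_ofReal (by linarith), Measure.restrict_apply_univ] at h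
  rw [mul_comm]
  simpa [Lb] using h

lemma Mi {N : ℕ} {p : ℝ} (hp : 1 ≤ p) (hpN : (N : ℝ) < p) :
    ∃ C : ℝ≥0∞, C ≠ ∞ ∧ ∀ h : Euc N → ℝ, Continuous h →
      ∫⁻ t in Set.Icc (0 : ℝ) 1, ∫⁻ z in ball (0 : Euc N) 1, ‖h (t • z)‖ₑ * ‖z‖ₑ
        ≤ C * Lb 1 (ENNReal.ofReal p) h := by
  have hp0 : 0 < p := by linarith
  have hvol : volume (ball (0 : Euc N) 1) ≠ ∞ := measure_ball_lt_top.ne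
  set A := volume (ball (0 : Euc N) 1) ^ (1 - 1 / p) with hA
  have hAf : A ≠ ∞ := by
    apply ENNReal.rpow_ne_top_of_nonneg _ hvol
    rw [sub_nonneg, div_le_one hp0]; exact hp
  have h_int0 : ∫⁻ t in Set.Ioo (0 : ℝ) 1, ENNReal.ofReal (t ^ (-(N : ℝ) / p)) ≠ ∞ := by
    have h1 := (intervalIntegral.integrableOn_Ioo_rpow_iff (s := -(N : ℝ) / p) (t := 1) one_pos).2 (by
      rw [neg_div, neg_lt_neg_iff, div_lt_one hp0]; exact hpN)
    refine ne_top_of_le_ne_top h1.2.ne (lintegral_mono fun t => ?_)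
    exact Real.ofReal_le_enorm _
  refine ⟨(∫⁻ t in Set.Ioo (0 : ℝ) 1, ENNReal.ofReal (t ^ (-(N : ℝ) / p))) * A, by finiteness, ?_⟩
  intro h hh
  rw [setLIntegral_congr Ioo_ae_eq_Icc.symm, mul_assoc, ← lintegral_mul_const _ (by fun_prop)]
  apply setLIntegral_mono' measurableSet_Ioo
  intro t ht
  calc ∫⁻ z in ball (0 : Euc N) 1, ‖h (t • z)‖ₑ * ‖z‖ₑ
      ≤ ∫⁻ z in ball (0 : Euc N) 1, ‖h (t • z)‖ₑ := by
        apply setLIntegral_mono' measurableSet_ball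
        intro z hz
        rw [mem_ball_zero_iff] at hz
        apply mul_le_of_le_one_right'
        rw [← ofReal_norm, ENNReal.ofReal_le_one]
        exact hz.le
    _ ≤ A * Lb 1 (ENNReal.ofReal p) (fun z => h (t • z)) :=
        Lb_one_le hp 1 (Continuous.aestronglyMeasurable (by fun_prop))
    _ ≤ A * (ENNReal.ofReal (t ^ (-(N : ℝ) / p)) * Lb 1 (ENNReal.ofReal p) h) := by
        gcongr
        exact Lb_dil hp ht.1 ht.2.le h
    _ = _ := by ring

lemma Mi1 (h : Euc 1 → ℝ) (hh : Continuous h) :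
      ∫⁻ t in Set.Icc (0 : ℝ) 1, ∫⁻ z in ball (0 : Euc 1) 1, ‖h (t • z)‖ₑ * ‖z‖ₑ
        ≤ Lb 1 1 h := by
  have e1 : ∀ t ∈ Set.Ioo (0 : ℝ) 1, ∫⁻ z in ball (0 : Euc 1) 1, ‖h (t • z)‖ₑ * ‖z‖ₑ =
      ∫⁻ z in ball (0 : Euc 1) 1, (Set.Ioi ‖z‖).indicator (fun t =>
        ENNReal.ofReal (t ^ (-2 : ℝ)) * ‖h z‖ₑ * ‖z‖ₑ) t := by
    intro t ht
    rw [← lintegral_indicator measurableSet_ball, ← lintegral_indicator measurableSet_ball]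
    have h2 : ∀ z : Euc 1, (ball (0 : Euc 1) 1).indicator (fun z => ‖h (t • z)‖ₑ * ‖z‖ₑ) z =
      (fun y => (ball (0 : Euc 1) t).indicator (fun y => ENNReal.ofReal t⁻¹ * (‖h y‖ₑ * ‖y‖ₑ)) y)
        (t • z) := by
      intro z
      have e : t • z ∈ ball (0 : Euc 1) t ↔ z ∈ ball (0 : Euc 1) 1 := by
        rw [mem_ball_zero_iff, mem_ball_zero_iff, norm_smul, Real.norm_of_nonneg ht.1.le]
        constructor <;> intro hx <;> nlinarith [ht.1]
      simp only [Set.indicator]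
      by_cases hzz : z ∈ ball (0 : Euc 1) 1
      · rw [if_pos hzz, if_pos (e.2 hzz), enorm_smul, Real.enorm_of_nonneg ht.1.le]
        have : ENNReal.ofReal t⁻¹ * ENNReal.ofReal t = 1 := by
          rw [← ENNReal.ofReal_mul (by have := ht.1; positivity), inv_mul_cancel₀ ht.1.ne', ENNReal.ofReal_one]
        calc _ = 1 * (‖h (t • z)‖ₑ * ‖z‖ₑ) := by rw [one_mul]
          _ = _ := by rw [← this]; ring
      · rw [if_neg hzz, if_neg (fun hcon => hzz (e.1 hcon))]
    simp only [h2]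
    rw [lintegral_dil ht.1 (fun y => (ball (0 : Euc 1) t).indicator
      (fun y => ENNReal.ofReal t⁻¹ * (‖h y‖ₑ * ‖y‖ₑ)) y), ← lintegral_const_mul' _ _ (by finiteness)]
    congr 1
    ext y
    have ht0 := ht.1
    by_cases hy : ‖y‖ < t
    · rw [Set.indicator_of_mem (by simpa using hy), Set.indicator_of_mem (by simp; linarith [ht.2]),
        Set.indicator_of_mem (by simpa using hy)]
      rw [← mul_assoc, ← mul_assoc, ← ENNReal.ofReal_mul (by positivity)]
      congr 3
      rw [← Real.rpow_neg_one t, ← Real.rpow_add ht0]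
      norm_num
    · rw [Set.indicator_of_notMem (by simpa using hy), mul_zero]
      symm
      apply Set.indicator_apply_eq_zero.2
      intro _
      rw [Set.indicator_of_notMem (by simpa using hy)]
  rw [setLIntegral_congr Ioo_ae_eq_Icc.symm, setLIntegral_congr_fun measurableSet_Ioo e1]
  rw [lintegral_lintegral_swap]
  · rw [Lb, eLpNorm_one_eq_lintegral_enorm]
    apply lintegral_mono
    intro z
    simp only
    rcases eq_or_ne z 0 with hz | hz
    · simp [hz]
    · have hz0 : 0 < ‖z‖ := by positivity
      calc _ ≤ ∫⁻ t, (Set.Ioi ‖z‖).indicator (fun t =>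
            ENNReal.ofReal (t ^ (-2 : ℝ)) * ‖h z‖ₑ * ‖z‖ₑ) t := setLIntegral_le_lintegral _ _
        _ = ∫⁻ t in Set.Ioi ‖z‖, ENNReal.ofReal (t ^ (-2 : ℝ)) * (‖h z‖ₑ * ‖z‖ₑ) := by
            rw [lintegral_indicator measurableSet_Ioi]; simp only [mul_assoc]
        _ = (∫⁻ t in Set.Ioi ‖z‖, ENNReal.ofReal (t ^ (-2 : ℝ))) * (‖h z‖ₑ * ‖z‖ₑ) := by
            rw [lintegral_mul_const' _ _ (by finiteness)]
        _ = ENNReal.ofReal (‖z‖⁻¹) * (‖h z‖ₑ * ‖z‖ₑ) := by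
            rw [← ofReal_integral_eq_lintegral_ofReal
              (integrableOn_Ioi_rpow_of_lt (by norm_num) hz0)
              ((ae_restrict_mem measurableSet_Ioi).mono fun t ht => by
                have : 0 < t := hz0.trans ht
                simp only [Pi.zero_apply]
                positivity), integral_Ioi_rpow_of_lt (by norm_num) hz0]
            congr 2
            rw [← Real.rpow_neg_one]
            norm_num
        _ = _ := by
            rw [← ofReal_norm z]
            have : ENNReal.ofReal ‖z‖⁻¹ * ENNReal.ofReal ‖z‖ = 1 := by
              rw [← ENNReal.ofReal_mul (by positivity), inv_mul_cancel₀ hz0.ne', ENNReal.ofReal_one]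
            calc _ = ‖h z‖ₑ * (ENNReal.ofReal ‖z‖⁻¹ * ENNReal.ofReal ‖z‖) := by ring
              _ = _ := by rw [this, mul_one]
  · apply Measurable.aemeasurable
    have : (Function.uncurry fun (t : ℝ) (z : Euc 1) => (Set.Ioi ‖z‖).indicator (fun t =>
        ENNReal.ofReal (t ^ (-2 : ℝ)) * ‖h z‖ₑ * ‖z‖ₑ) t) =
        {w : ℝ × Euc 1 | ‖w.2‖ < w.1}.indicator (fun w =>
          ENNReal.ofReal (w.1 ^ (-2 : ℝ)) * ‖h w.2‖ₑ * ‖w.2‖ₑ) := by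
      ext ⟨t, z⟩
      simp [Set.indicator]
    rw [this]
    apply Measurable.indicator
    · have := hh.measurable
      fun_prop
    · exact measurableSet_lt (by fun_prop) (by fun_prop)

lemma Mloc {N : ℕ} {p : ℝ} (hp : 1 ≤ p) (hpN : (N : ℝ) < p ∨ (N = 1 ∧ p = 1)) :
    ∃ C : ℝ≥0∞, C ≠ ∞ ∧ ∀ v : Euc N → ℝ, Sm v →
      ‖v 0‖ₑ ≤ C * (Lb 1 (ENNReal.ofReal p) v + ∑ i, Lb 1 (ENNReal.ofReal p) (pd i v)) := by
  have hp0 : 0 < p := by linarith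
  have hMi : ∃ C : ℝ≥0∞, C ≠ ∞ ∧ ∀ h : Euc N → ℝ, Continuous h →
      ∫⁻ t in Set.Icc (0 : ℝ) 1, ∫⁻ z in ball (0 : Euc N) 1, ‖h (t • z)‖ₑ * ‖z‖ₑ
        ≤ C * Lb 1 (ENNReal.ofReal p) h := by
    rcases hpN with h | ⟨h1, h2⟩
    · exact Mi hp h
    · subst h1; subst h2
      exact ⟨1, by simp, fun h hh => by simpa using Mi1 h hh⟩
  obtain ⟨C, hC, hM⟩ := hMi
  set B := volume (ball (0 : Euc N) 1) with hB
  have hvol : B ≠ ∞ := measure_ball_lt_top.ne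
  have hvol0 : B ≠ 0 := (measure_ball_pos _ _ one_pos).ne'
  set A := B ^ (1 - 1 / p) with hA
  have hAf : A ≠ ∞ := by
    apply ENNReal.rpow_ne_top_of_nonneg _ hvol
    rw [sub_nonneg, div_le_one hp0]; exact hp
  refine ⟨B⁻¹ * (A + C), by finiteness, fun v hv => ?_⟩
  have h1 : B * ‖v 0‖ₑ ≤ A * Lb 1 (ENNReal.ofReal p) v + C * ∑ i, Lb 1 (ENNReal.ofReal p) (pd i v) := by
    calc B * ‖v 0‖ₑ = ∫⁻ z in ball (0 : Euc N) 1, ‖v 0‖ₑ := by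
          rw [setLIntegral_const, mul_comm]
      _ ≤ ∫⁻ z in ball (0 : Euc N) 1, (‖v z‖ₑ +
            ∑ i, ∫⁻ t in Set.Icc (0 : ℝ) 1, ‖pd i v (t • z)‖ₑ * ‖z‖ₑ) := by
          apply lintegral_mono
          intro z
          have hf := ftc hv 0 z
          simp only [zero_add] at hf
          have e : v 0 = v z - (v z - v 0) := by ring
          simp only
          rw [e]
          refine enorm_sub_le.trans ?_
          gcongr
          refine hf.trans ?_
          rw [← lintegral_finsetSum _ (fun i _ => by
            have := (hv.pd i).continuous.measurable
            fun_prop)]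
          exact lintegral_mono fun t => fderiv_apply_le _ _ _
      _ = (∫⁻ z in ball (0 : Euc N) 1, ‖v z‖ₑ) + ∑ i, ∫⁻ t in Set.Icc (0 : ℝ) 1,
            ∫⁻ z in ball (0 : Euc N) 1, ‖pd i v (t • z)‖ₑ * ‖z‖ₑ := by
          have hm : ∀ i, Measurable (Function.uncurry fun (z : Euc N) (t : ℝ) =>
              ‖pd i v (t • z)‖ₑ * ‖z‖ₑ) := by
            intro i
            have := (hv.pd i).continuous.measurable
            unfold Function.uncurry
            fun_prop
          rw [lintegral_add_left (by have := hv.continuous.measurable; fun_prop),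
            lintegral_finsetSum]
          · congr 1
            apply Finset.sum_congr rfl
            intro i _
            rw [lintegral_lintegral_swap (hm i).aemeasurable]
          · intro i _
            exact Measurable.lintegral_prod_right (hm i)
      _ ≤ _ := by
          rw [Finset.mul_sum]
          gcongr with i
          · exact Lb_one_le hp 1 hv.continuous.aestronglyMeasurable
          · exact hM _ (hv.pd i).continuous
  set S := ∑ i, Lb 1 (ENNReal.ofReal p) (pd i v)
  calc ‖v 0‖ₑ = B⁻¹ * (B * ‖v 0‖ₑ) := by
        rw [← mul_assoc, ENNReal.inv_mul_cancel hvol0 hvol, one_mul]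
    _ ≤ B⁻¹ * (A * Lb 1 (ENNReal.ofReal p) v + C * S) := by gcongr
    _ ≤ B⁻¹ * ((A + C) * Lb 1 (ENNReal.ofReal p) v + (A + C) * S) := by
        gcongr
        · exact le_self_add
        · exact le_add_self
    _ = _ := by ring

lemma Lb_exp {N : ℕ} {p q : ℝ} (hp : 1 ≤ p) (hpq : p ≤ q) (R : ℝ) :
    ∃ C : ℝ≥0∞, C ≠ ∞ ∧ ∀ f : Euc N → ℝ, AEStronglyMeasurable f volume →
      Lb R (ENNReal.ofReal p) f ≤ C * Lb R (ENNReal.ofReal q) f := by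
  have hp0 : 0 < p := by linarith
  refine ⟨volume (ball (0 : Euc N) R) ^ (1 / p - 1 / q), ?_, fun f hf => ?_⟩
  · apply ENNReal.rpow_ne_top_of_nonneg _ measure_ball_lt_top.ne
    rw [sub_nonneg]
    exact one_div_le_one_div_of_le hp0 hpq
  have h := eLpNorm_le_eLpNorm_mul_rpow_measure_univ (p := ENNReal.ofReal p) (q := ENNReal.ofReal q)
    (μ := volume.restrict (ball (0 : Euc N) R)) (f := f) (ENNReal.ofReal_le_ofReal hpq) hf.restrict
  rw [ENNReal.toReal_ofReal (by linarith), ENNReal.toReal_ofReal (by linarith),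
    Measure.restrict_apply_univ] at h
  rw [mul_comm]
  exact h

lemma Lb_add {N : ℕ} {q : ℝ≥0∞} (hq : 1 ≤ q) (R : ℝ) {f g : Euc N → ℝ}
    (hf : AEStronglyMeasurable f volume) (hg : AEStronglyMeasurable g volume) :
    Lb R q (fun x => f x + g x) ≤ Lb R q f + Lb R q g :=
  eLpNorm_add_le hf.restrict hg.restrict hq

lemma Lb_mono {N : ℕ} (q : ℝ≥0∞) (R : ℝ) {f g : Euc N → ℝ}
    (h : ∀ x ∈ ball (0 : Euc N) R, |f x| ≤ |g x|) : Lb R q f ≤ Lb R q g := by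
  apply eLpNorm_mono_ae
  filter_upwards [ae_restrict_mem measurableSet_ball] with x hx
  exact h x hx

lemma Lb_const_mul {N : ℕ} (q : ℝ≥0∞) (R c : ℝ) (f : Euc N → ℝ) :
    Lb R q (fun x => c * f x) = ‖c‖ₑ * Lb R q f :=
  eLpNorm_const_smul c f q _

lemma Lb_sum {N : ℕ} {q : ℝ≥0∞} (hq : 1 ≤ q) (R : ℝ) {ι : Type} (s : Finset ι) {f : ι → Euc N → ℝ}
    (hf : ∀ i, AEStronglyMeasurable (f i) volume) :
    Lb R q (fun x => ∑ i ∈ s, f i x) ≤ ∑ i ∈ s, Lb R q (f i) := by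
  have h := eLpNorm_sum_le (s := s) (f := f) (μ := volume.restrict (ball (0 : Euc N) R)) (p := q)
    (fun i _ => (hf i).restrict) hq
  refine le_trans (le_of_eq ?_) h
  unfold Lb
  congr 1
  ext x; simp

lemma Lb_abs {N : ℕ} (q : ℝ≥0∞) (R : ℝ) (f : Euc N → ℝ) :
    Lb R q (fun x => |f x|) = Lb R q f := eLpNorm_norm f

lemma fderiv_norm_le {N : ℕ} (v : Euc N → ℝ) (x : Euc N) :
    ‖fderiv ℝ v x‖ ≤ ∑ i, |pd i v x| := by
  apply ContinuousLinearMap.opNorm_le_bound _ (by positivity)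
  intro h
  rw [fderiv_apply_eq, Finset.sum_mul]
  refine (norm_sum_le _ _).trans (Finset.sum_le_sum fun i _ => ?_)
  rw [norm_mul, mul_comm, Real.norm_eq_abs]
  gcongr
  exact EuclideanSpace.norm_eq h ▸ (by
    rw [← EuclideanSpace.norm_eq h]; exact PiLp.norm_apply_le h i)

lemma S1locA {N : ℕ} {p q : ℝ} (hp : 1 ≤ p) (hpq : p ≤ q)
    (hpN : (N : ℝ) < p ∨ (N = 1 ∧ p = 1)) :
    ∃ C : ℝ≥0∞, C ≠ ∞ ∧ ∀ v : Euc N → ℝ, Sm v →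
      Lb 1 (ENNReal.ofReal q) v ≤
        C * (Lb 2 (ENNReal.ofReal p) v + ∑ i, Lb 2 (ENNReal.ofReal p) (pd i v)) := by
  obtain ⟨C, hC, hM⟩ := Mloc (N := N) hp hpN
  have hq0 : 0 < q := by linarith
  refine ⟨volume (ball (0 : Euc N) 1) ^ (1 / q) * C, ?_, fun v hv => ?_⟩
  · have : volume (ball (0 : Euc N) 1) ^ (1 / q) ≠ ∞ :=
      ENNReal.rpow_ne_top_of_nonneg (by positivity) measure_ball_lt_top.ne
    finiteness
  set M := C * (Lb 2 (ENNReal.ofReal p) v + ∑ i, Lb 2 (ENNReal.ofReal p) (pd i v)) with hMd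
  have htr : ∀ f : Euc N → ℝ, ∀ z ∈ ball (0 : Euc N) 1,
      Lb 1 (ENNReal.ofReal p) (fun x => f (z + (1:ℝ) • x)) ≤ Lb 2 (ENNReal.ofReal p) f := by
    intro f z hz
    rw [Lb_eq, Lb_eq]
    have : eLpNorm ((ball (0 : Euc N) 2).indicator f) (ENNReal.ofReal p) volume =
       eLpNorm (fun x => (ball (0 : Euc N) 2).indicator f (z + x)) (ENNReal.ofReal p) volume := by
      have hmp := measurePreserving_add_left (volume : Measure (Euc N)) z
      rw [← hmp.map_eq, (measurableEmbedding_addLeft z).eLpNorm_map_measure, hmp.map_eq]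
      rfl
    rw [this]
    apply eLpNorm_mono
    intro x
    simp only [one_smul]
    by_cases hx : x ∈ ball (0 : Euc N) 1
    · rw [Set.indicator_of_mem hx, Set.indicator_of_mem]
      rw [mem_ball_zero_iff] at hx hz ⊢
      exact (norm_add_le _ _).trans_lt (by linarith)
    · rw [Set.indicator_of_notMem hx, norm_zero]; exact norm_nonneg _
  have h1 : ∀ z ∈ ball (0 : Euc N) 1, ‖v z‖ₑ ≤ M := by
    intro z hz
    have h := hM _ (hv.affine z 1)
    simp only [smul_zero, add_zero] at h
    refine h.trans ?_
    rw [hMd]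
    gcongr with i
    · exact htr v z hz
    · rw [pd_affine hv]
      simp only [one_mul]
      exact htr _ z hz
  unfold Lb
  rw [eLpNorm_eq_lintegral_rpow_enorm_toReal (by simpa using hq0) (by simp),
        ENNReal.toReal_ofReal hq0.le]
  calc (∫⁻ x in ball (0 : Euc N) 1, ‖v x‖ₑ ^ q) ^ (1 / q)
     ≤ (∫⁻ x in ball (0 : Euc N) 1, M ^ q) ^ (1 / q) := by
        gcongr ?_ ^ _
        apply setLIntegral_mono' measurableSet_ball
        intro x hx
        exact ENNReal.rpow_le_rpow (h1 x hx) hq0.le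
    _ = _ := by
      rw [setLIntegral_const, ENNReal.mul_rpow_of_nonneg _ _ (by positivity), ← ENNReal.rpow_mul,
        mul_one_div_cancel hq0.ne', ENNReal.rpow_one, hMd]
      unfold Lb
      ring

lemma S1locB {N : ℕ} {p q : ℝ} (hp : 1 ≤ p) (hpq : p ≤ q) (hN : 2 ≤ N)
    (hq : 1 / p - 1 / (N : ℝ) ≤ 1 / q) :
    ∃ C : ℝ≥0∞, C ≠ ∞ ∧ ∀ v : Euc N → ℝ, Sm v →
      Lb 1 (ENNReal.ofReal q) v ≤
        C * (Lb 2 (ENNReal.ofReal p) v + ∑ i, Lb 2 (ENNReal.ofReal p) (pd i v)) := by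
  have hq0 : 0 < q := by linarith
  have hp0 : 0 < p := by linarith
  have hN2 : (2 : ℝ) ≤ N := by exact_mod_cast hN
  set r : ℝ := max 1 (1 / q + 1 / N)⁻¹ with hr
  have hr1 : 1 ≤ r := le_max_left _ _
  have hr0 : 0 < r := by linarith
  have hrp : r ≤ p := by
    apply max_le hp
    rw [inv_le_comm₀ (by positivity) hp0, ← one_div]; linarith
  have hrN : r < N := by
    apply max_lt (by linarith)
    rw [inv_lt_comm₀ (by positivity) (by linarith), ← one_div]
    have : 0 < 1 / q := by positivity
    linarith
  have hrq : r⁻¹ - (N : ℝ)⁻¹ ≤ q⁻¹ := by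
    have : r⁻¹ ≤ 1 / q + 1 / N := by
      rw [inv_le_comm₀ hr0 (by positivity)]; exact le_max_right _ _
    rw [one_div, one_div] at this
    linarith
  obtain ⟨C1, hC1, hE⟩ := Lb_exp (N := N) hr1 hrp 2
  let χ : ContDiffBump (0 : Euc N) := ⟨1, 3/2, by norm_num, by norm_num⟩
  have hχs : Sm (χ : Euc N → ℝ) := χ.contDiff
  obtain ⟨M, hM⟩ := (hχs.continuous_fderiv (by simp)).bounded_above_of_compact_support
    (χ.hasCompactSupport.fderiv (𝕜 := ℝ))
  have hM0 : 0 ≤ M := (norm_nonneg _).trans (hM 0)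
  set C2 := eLpNormLESNormFDerivOfLeConst ℝ (volume : Measure (Euc N)) (ball (0 : Euc N) 2) r.toNNReal q.toNNReal
  refine ⟨C2 * (ENNReal.ofReal (M + 1) * C1), by finiteness, fun v hv => ?_⟩
  have hu : ContDiff ℝ 1 (fun x => χ x * v x) := (hχs.mul hv).of_le (by simp)
  have hsub : (fun x => χ x * v x).support ⊆ ball (0 : Euc N) 2 := by
    intro x hx
    have : χ x ≠ 0 := fun h => hx (by simp [h])
    have h2 : x ∈ Function.support χ := this
    rw [χ.support_eq] at h2
    exact ball_subset_ball (by norm_num) h2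
  have hS := eLpNorm_le_eLpNorm_fderiv_of_le (volume : Measure (Euc N)) hu hsub (p := r.toNNReal) (q := q.toNNReal)
    (by simpa using hr1) (by
      rw [finrank_euclideanSpace_fin]
      rw [← NNReal.coe_lt_coe, Real.coe_toNNReal _ hr0.le]; exact_mod_cast hrN) (by
      rw [finrank_euclideanSpace_fin, NNReal.coe_inv, Real.coe_toNNReal _ hr0.le, Real.coe_toNNReal _ hq0.le]
      exact hrq) isBounded_ball
  have haesm : ∀ i, AEStronglyMeasurable (fun x => |pd i v x|) volume := fun i =>
    (hv.pd i).continuous.abs.aestronglyMeasurable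
  set S := fun x => ∑ i, |pd i v x| with hSd
  have hSa : AEStronglyMeasurable S volume := by
    apply Continuous.aestronglyMeasurable
    have := fun i => (hv.pd i).continuous
    fun_prop
  have hva := hv.continuous.abs.aestronglyMeasurable (μ := volume)
  calc Lb 1 (ENNReal.ofReal q) v ≤ eLpNorm (fun x => χ x * v x) (ENNReal.ofReal q) volume := by
        rw [Lb_eq]
        apply eLpNorm_mono
        intro x
        by_cases hx : x ∈ ball (0 : Euc N) 1
        · rw [Set.indicator_of_mem hx, χ.one_of_mem_closedBall (ball_subset_closedBall hx), one_mul]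
        · rw [Set.indicator_of_notMem hx, norm_zero]; exact norm_nonneg _
    _ ≤ C2 * eLpNorm (fderiv ℝ fun x => χ x * v x) (ENNReal.ofReal r) volume := hS
    _ ≤ C2 * Lb 2 (ENNReal.ofReal r) (fun x => (M + 1) * (|v x| + S x)) := by
        gcongr
        rw [Lb_eq]
        apply eLpNorm_mono
        intro x
        by_cases hx : x ∈ ball (0 : Euc N) 2
        · rw [Set.indicator_of_mem hx, fderiv_fun_mul hχs.diff.differentiableAt hv.diff.differentiableAt]
          have h1 := hM x
          have h2 := fderiv_norm_le v x
          have h3 : |χ x| ≤ 1 := by rw [abs_of_nonneg χ.nonneg]; exact χ.le_one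
          have h4 : 0 ≤ S x := Finset.sum_nonneg fun i _ => abs_nonneg _
          refine (norm_add_le _ _).trans ?_
          rw [norm_smul, norm_smul, Real.norm_eq_abs, Real.norm_eq_abs, Real.norm_eq_abs,
            abs_of_nonneg (by positivity : 0 ≤ (M + 1) * (|v x| + S x))]
          calc _ ≤ 1 * S x + |v x| * M := by gcongr
            _ ≤ _ := by nlinarith [abs_nonneg (v x), mul_nonneg hM0 h4]
        · have h0 : fderiv ℝ (fun x => χ x * v x) x = 0 := by
            have : x ∉ tsupport (fun x => χ x * v x) := by
              intro h
              have h' := tsupport_mul_subset_left h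
              rw [χ.tsupport_eq] at h'
              exact hx (closedBall_subset_ball (by norm_num) h')
            exact Function.notMem_support.1 fun h => this (support_fderiv_subset ℝ h)
          rw [h0, norm_zero]; exact norm_nonneg _
    _ ≤ C2 * (ENNReal.ofReal (M + 1) * (C1 * (Lb 2 (ENNReal.ofReal p) v +
          ∑ i, Lb 2 (ENNReal.ofReal p) (pd i v)))) := by
        have hp1 : 1 ≤ ENNReal.ofReal p := ENNReal.one_le_ofReal.2 hp
        rw [Lb_const_mul, Real.enorm_of_nonneg (by positivity)]
        gcongr
        refine (hE _ (hva.add hSa)).trans ?_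
        gcongr
        refine (Lb_add hp1 2 hva hSa).trans ?_
        rw [Lb_abs]
        gcongr
        refine (Lb_sum hp1 2 _ haesm).trans ?_
        gcongr
        rw [Lb_abs]
    _ = _ := by ring

lemma S1loc {N : ℕ} (hN : 1 ≤ N) {p q : ℝ} (hp : 1 ≤ p) (hpq : p ≤ q)
    (hq : 1 / p - 1 / (N : ℝ) ≤ 1 / q) :
    ∃ C : ℝ≥0∞, C ≠ ∞ ∧ ∀ v : Euc N → ℝ, Sm v →
      Lb 1 (ENNReal.ofReal q) v ≤
        C * (Lb 2 (ENNReal.ofReal p) v + ∑ i, Lb 2 (ENNReal.ofReal p) (pd i v)) := by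
  rcases Nat.lt_or_ge 1 N with h | h
  · exact S1locB hp hpq h hq
  · have : N = 1 := le_antisymm h hN
    apply S1locA hp hpq
    subst this
    rcases eq_or_lt_of_le hp with h1 | h1
    · right; exact ⟨rfl, h1.symm⟩
    · left; simpa using h1

lemma Lb_rpow {N : ℕ} (R : ℝ) {p : ℝ} (hp : 1 ≤ p) (u : Euc N → ℝ) :
    Lb R (ENNReal.ofReal p) u ^ p = K 0 p (fun x => ‖(ball (0 : Euc N) R).indicator u x‖ₑ) := by
  have hp0 : 0 < p := by linarith
  rw [Lb_eq]
  unfold K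
  rw [eLpNorm_eq_lintegral_rpow_enorm_toReal (by simpa using hp0) (by simp),
    ENNReal.toReal_ofReal hp0.le, ← ENNReal.rpow_mul, one_div_mul_cancel hp0.ne', ENNReal.rpow_one]
  simp

lemma Lb_avg {N : ℕ} {T : Type*} [MeasurableSpace T] (μ : Measure T) [IsFiniteMeasure μ]
    {p : ℝ} (hp : 1 ≤ p) (τ : T → Euc N) (hτ : Measurable τ) (hτ1 : ∀ᵐ t ∂μ, ‖τ t‖ < 1)
    (f F : Euc N → ℝ) (hf : Continuous f)
    (hF : ∀ x ∈ ball (0 : Euc N) 1, ‖F x‖ₑ ≤ ∫⁻ t, ‖f (x + τ t)‖ₑ ∂μ) :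
    Lb 1 (ENNReal.ofReal p) F ≤ μ Set.univ * Lb 2 (ENNReal.ofReal p) f := by
  have hp0 : 0 < p := by linarith
  have h := K_avg μ 0 hp (fun x => ‖(ball (0 : Euc N) 1).indicator F x‖ₑ)
    (fun t x => ‖(ball (0 : Euc N) 2).indicator f (x + τ t)‖ₑ) (by
      unfold Function.uncurry
      have : Measurable ((ball (0 : Euc N) 2).indicator f) := hf.measurable.indicator measurableSet_ball
      fun_prop) (by
      intro x
      by_cases hx : x ∈ ball (0 : Euc N) 1
      · simp only [Set.indicator_of_mem hx]
        refine (hF x hx).trans (lintegral_mono_ae ?_)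
        filter_upwards [hτ1] with t ht
        rw [Set.indicator_of_mem]
        rw [mem_ball_zero_iff] at hx ⊢
        exact (norm_add_le _ _).trans_lt (by linarith)
      · simp [Set.indicator_of_notMem hx]) (Lb 2 (ENNReal.ofReal p) f ^ p) (by
      apply Eventually.of_forall
      intro t
      apply le_of_eq
      rw [Lb_rpow 2 hp]
      unfold K
      simp only [Real.rpow_zero, ENNReal.ofReal_one, one_mul]
      exact lintegral_add_right_eq_self (μ := volume) (fun x => ‖(ball (0 : Euc N) 2).indicator f x‖ₑ ^ p) (τ t))
  rw [← Lb_rpow 1 hp] at h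
  have h2 := rpow_le_of_le hp h
  rwa [← ENNReal.rpow_mul, mul_one_div_cancel hp0.ne', ENNReal.rpow_one] at h2

lemma weak_of_Sm {N : ℕ} {u : Euc N → ℝ} (hu : Sm u) (i : Fin N) : IsWeakDerivList [i] u (pd i u) := by
  refine ⟨hu.continuous.locallyIntegrable, (hu.pd i).continuous.locallyIntegrable, fun φ hφ hc => ?_⟩
  have h := integral_mul_fderiv_eq_neg_fderiv_mul_of_integrable (μ := volume) (f := u) (g := φ)
    (v := EuclideanSpace.single i 1) (𝕜 := ℝ)
    (((hu.pd i).continuous.mul hφ.continuous).integrable_of_hasCompactSupport hc.mul_left)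
    ((hu.continuous.mul (Sm.pd hφ i).continuous).integrable_of_hasCompactSupport (cs_pd hc i).mul_left)
    ((hu.continuous.mul hφ.continuous).integrable_of_hasCompactSupport hc.mul_left)
    (fun x _ => hu.diff x) (fun x _ => Sm.diff hφ x)
  simpa [pderivList, pd] using h

lemma cv_pd {N : ℕ} {u ρ : Euc N → ℝ} (hu : Sm u) (hρ : Sm ρ) (hc : HasCompactSupport ρ) (i : Fin N) :
    cv ρ (pd i u) = cv (pd i ρ) u := by
  rw [← cv_weak (weak_of_Sm hu i) hρ hc, ← pd_cv hρ hc hu.continuous.locallyIntegrable]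
  rfl

lemma cv_pderivList {N : ℕ} (l : List (Fin N)) : ∀ {ρ : Euc N → ℝ}, Sm ρ → HasCompactSupport ρ →
    tsupport ρ ⊆ ball 0 1 → ∃ ψ : Euc N → ℝ, Sm ψ ∧ HasCompactSupport ψ ∧ tsupport ψ ⊆ ball 0 1 ∧
      ∀ u : Euc N → ℝ, Sm u → cv ρ (pderivList l u) = cv ψ u := by
  induction l with
  | nil => intro ρ hρ hc hs; exact ⟨ρ, hρ, hc, hs, fun u _ => rfl⟩
  | cons i l ih =>
    intro ρ hρ hc hs
    obtain ⟨ψ, h1, h2, h3, h4⟩ := ih hρ hc hs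
    refine ⟨pd i ψ, h1.pd i, cs_pd h2 i, ?_, fun u hu => ?_⟩
    · exact (tsupport_fderiv_apply_subset ℝ _).trans h3
    · rw [pderivList_cons, h4 _ (hu.pd i), cv_pd hu h1 h2]

lemma cv_bound {N : ℕ} {p : ℝ} (hp : 1 ≤ p) {ψ : Euc N → ℝ} (h1 : Sm ψ) (h2 : HasCompactSupport ψ)
    (h3 : tsupport ψ ⊆ ball 0 1) : ∃ C : ℝ≥0∞, C ≠ ∞ ∧ ∀ u : Euc N → ℝ, Sm u →
      Lb 1 (ENNReal.ofReal p) (cv ψ u) ≤ C * Lb 2 (ENNReal.ofReal p) u := by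
  have hm : Measurable (fun x => ‖ψ x‖ₑ) := by
    have := h1.continuous.measurable
    fun_prop
  set μ : Measure (Euc N) := volume.withDensity (fun x => ‖ψ x‖ₑ) with hμ
  have hfin : IsFiniteMeasure μ :=
    isFiniteMeasure_withDensity (h1.continuous.integrable_of_hasCompactSupport h2).2.ne
  refine ⟨μ Set.univ, measure_ne_top _ _, fun u hu => ?_⟩
  refine Lb_avg μ hp (fun t => -t) (by fun_prop) ?_ u _ hu.continuous ?_
  · rw [hμ, ae_withDensity_iff hm]
    apply Eventually.of_forall
    intro x hx
    have : x ∈ tsupport ψ := subset_tsupport _ (by simpa using hx)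
    simpa using h3 this
  · intro x _
    have e : cv ψ u x = ∫ t, ψ t * u (x + -t) := by
      unfold cv
      rw [← integral_sub_left_eq_self _ volume x]
      congr 1; ext y
      congr 2
      abel
    rw [e, hμ, lintegral_withDensity_eq_lintegral_mul _ hm (by
      have := hu.continuous.measurable
      fun_prop)]
    refine (enorm_integral_le_lintegral_enorm _).trans (le_of_eq ?_)
    congr 1; ext t
    simp

lemma sub_bound {N : ℕ} {p : ℝ} (hp : 1 ≤ p) {ρ : Euc N → ℝ} (h1 : Sm ρ) (h2 : HasCompactSupport ρ)
    (h3 : tsupport ρ ⊆ ball 0 1) (hi : ∫ x, ρ x = 1) :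
    ∃ C : ℝ≥0∞, C ≠ ∞ ∧ ∀ w : Euc N → ℝ, Sm w →
      Lb 1 (ENNReal.ofReal p) (fun x => w x - cv ρ w x) ≤ C * ∑ i, Lb 2 (ENNReal.ofReal p) (pd i w) := by
  have hm : Measurable (fun x => ‖ρ x‖ₑ) := by
    have := h1.continuous.measurable
    fun_prop
  have h_int0 := h1.continuous.integrable_of_hasCompactSupport h2 (μ := volume)
  set μ : Measure (Euc N) := volume.withDensity (fun x => ‖ρ x‖ₑ) with hμ
  have hfin : IsFiniteMeasure μ := isFiniteMeasure_withDensity h_int0.2.ne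
  have hμ1 : ∀ᵐ x ∂μ, ‖x‖ < 1 := by
    rw [hμ, ae_withDensity_iff hm]
    apply Eventually.of_forall
    intro x hx
    have : x ∈ tsupport ρ := subset_tsupport _ (by simpa using hx)
    simpa using h3 this
  set ν : Measure (Euc N × ℝ) := μ.prod (volume.restrict (Set.Icc (0:ℝ) 1)) with hν
  refine ⟨ν Set.univ, measure_ne_top _ _, fun w hw => ?_⟩
  have hcf : Continuous (fun x => ∑ i, |pd i w x|) := by
    have := fun i => (hw.pd i).continuous
    fun_prop
  refine (Lb_avg ν hp (fun t => t.2 • (-t.1)) (by fun_prop) ?_ (fun x => ∑ i, |pd i w x|) _ hcf ?_).trans ?_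
  · have a1 : ∀ᵐ t ∂ν, ‖t.1‖ < 1 := Measure.quasiMeasurePreserving_fst.ae hμ1
    have a2 : ∀ᵐ t ∂ν, t.2 ∈ Set.Icc (0:ℝ) 1 :=
      Measure.quasiMeasurePreserving_snd.ae (ae_restrict_mem measurableSet_Icc)
    filter_upwards [a1, a2] with t b1 b2
    rw [norm_smul, norm_neg, Real.norm_of_nonneg b2.1]
    nlinarith [b2.1, b2.2, norm_nonneg t.1]
  · intro x _
    have hws : Continuous fun t => ρ t * w (x + -t) := by
      have := h1.continuous; have := hw.continuous; fun_prop
    have e : w x - cv ρ w x = ∫ t, ρ t * (w x - w (x + -t)) := by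
      have e1 : cv ρ w x = ∫ t, ρ t * w (x + -t) := by
        unfold cv
        rw [← integral_sub_left_eq_self _ volume x]
        congr 1; ext y
        congr 2
        abel
      have e2 : w x = ∫ t, ρ t * w x := by
        rw [integral_mul_const, hi, one_mul]
      rw [e1]
      conv_lhs => rw [e2]
      rw [← integral_sub (h_int0.mul_const _) (hws.integrable_of_hasCompactSupport h2.mul_right)]
      congr 1; ext t; ring
    have hmm : Measurable (Function.uncurry fun (t : Euc N) (r : ℝ) => ‖∑ i, |pd i w (x + r • -t)|‖ₑ) := by
      unfold Function.uncurry
      have := hcf.measurable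
      exact (this.comp (by fun_prop : Measurable fun a : Euc N × ℝ => x + a.2 • -a.1)).enorm
    rw [e, hν, lintegral_prod (fun a : Euc N × ℝ => ‖∑ i, |pd i w (x + a.2 • -a.1)|‖ₑ) hmm.aemeasurable, hμ, lintegral_withDensity_eq_lintegral_mul _ hm (by
      exact Measurable.lintegral_prod_right hmm)]
    refine (enorm_integral_le_lintegral_enorm _).trans (lintegral_mono fun t => ?_)
    simp only [Pi.mul_apply, enorm_mul]
    by_cases ht : ρ t = 0
    · simp [ht]
    have htn : ‖t‖ < 1 := by
      have : t ∈ tsupport ρ := subset_tsupport _ ht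
      simpa using h3 this
    gcongr
    rw [enorm_sub_rev]
    refine (ftc hw x (-t)).trans (lintegral_mono fun r => ?_)
    simp only
    refine (fderiv_apply_le _ _ _).trans ?_
    rw [Real.enorm_of_nonneg (Finset.sum_nonneg fun i _ => abs_nonneg _),
      ENNReal.ofReal_sum_of_nonneg (fun i _ => abs_nonneg _)]
    gcongr with i
    rw [← Real.enorm_eq_ofReal_abs]
    apply mul_le_of_le_one_right'
    rw [enorm_neg, ← ofReal_norm, ENNReal.ofReal_le_one]
    exact htn.le
  · gcongr
    refine (Lb_sum (ENNReal.one_le_ofReal.2 hp) 2 _ (f := fun i x => |pd i w x|)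
      (fun i => (hw.pd i).continuous.abs.aestronglyMeasurable)).trans (le_of_eq ?_)
    simp only [Lb_abs]

lemma S2loc {N : ℕ} {p : ℝ} (hp : 1 ≤ p) (l : List (Fin N)) :
    ∃ C : ℝ≥0∞, C ≠ ∞ ∧ ∀ u : Euc N → ℝ, Sm u →
      Lb 1 (ENNReal.ofReal p) (pderivList l u) ≤
        C * (Lb 2 (ENNReal.ofReal p) u + ∑ i, Lb 2 (ENNReal.ofReal p) (pd i (pderivList l u))) := by
  let χ : ContDiffBump (0 : Euc N) := ⟨1/4, 1/2, by norm_num, by norm_num⟩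
  have h1 : Sm (χ.normed volume) := χ.contDiff_normed
  have h2 : HasCompactSupport (χ.normed volume) := χ.hasCompactSupport_normed
  have h3 : tsupport (χ.normed volume) ⊆ ball (0 : Euc N) 1 := by
    rw [χ.tsupport_normed_eq]
    exact closedBall_subset_ball (by norm_num)
  obtain ⟨ψ, g1, g2, g3, g4⟩ := cv_pderivList l h1 h2 h3
  obtain ⟨C1, hC1, b1⟩ := cv_bound hp g1 g2 g3
  obtain ⟨C2, hC2, b2⟩ := sub_bound hp h1 h2 h3 χ.integral_normed
  refine ⟨C1 + C2, by finiteness, fun u hu => ?_⟩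
  have hw := hu.pderivList l
  have hcv := Sm_cv g1 g2 hu.continuous.locallyIntegrable (u := u)
  have e : pderivList l u = fun x => (pderivList l u x - cv (χ.normed volume) (pderivList l u) x)
      + cv ψ u x := by
    ext x; rw [g4 u hu]; ring
  set S := ∑ i, Lb 2 (ENNReal.ofReal p) (pd i (pderivList l u)) with hS
  calc _ ≤ C2 * S + C1 * Lb 2 (ENNReal.ofReal p) u := by
        rw [e]
        refine (Lb_add (ENNReal.one_le_ofReal.2 hp) 1 ?_ hcv.continuous.aestronglyMeasurable).trans ?_
        · rw [g4 u hu]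
          exact (hw.continuous.sub hcv.continuous).aestronglyMeasurable
        · gcongr
          · exact b2 _ hw
          · exact b1 _ hu
    _ ≤ (C1 + C2) * S + (C1 + C2) * Lb 2 (ENNReal.ofReal p) u := by
        gcongr
        · exact le_add_self
        · exact le_self_add
    _ = _ := by ring

/-- the radius of the Whitney type covering -/
def rr {N : ℕ} (y : Euc N) : ℝ := (1 + ‖y‖) / 8

lemma rr_pos {N : ℕ} (y : Euc N) : 0 < rr y := by unfold rr; positivity

lemma rr_meas {N : ℕ} : Measurable (rr : Euc N → ℝ) := by unfold rr; fun_prop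

lemma near_cmp {N : ℕ} {y z : Euc N} (h : ‖z - y‖ < 2 * rr y) :
    1 + ‖y‖ ≤ 2 * (1 + ‖z‖) ∧ 1 + ‖z‖ ≤ 2 * (1 + ‖y‖) := by
  unfold rr at h
  have h1 : ‖y‖ ≤ ‖z‖ + ‖z - y‖ := by
    have := norm_sub_le z (z - y)
    simpa using this
  have h2 : ‖z‖ ≤ ‖y‖ + ‖z - y‖ := by
    have := norm_add_le y (z - y)
    simpa using this
  have := norm_nonneg y
  have := norm_nonneg z
  constructor <;> linarith

lemma ker_cmp {N : ℕ} (b : ℝ) {y z : Euc N} (h : ‖z - y‖ < 2 * rr y) :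
    rr y ^ b ≤ 16 ^ |b| * (1 + ‖z‖) ^ b ∧ (1 + ‖z‖) ^ b ≤ 16 ^ |b| * rr y ^ b := by
  obtain ⟨h1, h2⟩ := near_cmp h
  have := norm_nonneg y
  have := norm_nonneg z
  have e : 1 + ‖y‖ = 8 * rr y := by unfold rr; ring
  constructor
  · exact pow_cmp b (by norm_num) (rr_pos y) (by positivity) (by linarith [rr_pos y]) (by linarith)
  · exact pow_cmp b (by norm_num) (by positivity) (rr_pos y)  (by linarith) (by linarith [rr_pos y])

lemma vol_ball {N : ℕ} (z : Euc N) {R : ℝ} (hR : 0 < R) :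
    volume (ball z R) = ENNReal.ofReal (R ^ (N : ℝ)) * volume (ball (0 : Euc N) 1) := by
  rw [Measure.addHaar_ball_of_pos _ _ hR, finrank_euclideanSpace_fin, Real.rpow_natCast]

lemma ker_up {N : ℕ} (b : ℝ) : ∃ C : ℝ≥0∞, C ≠ ∞ ∧ ∀ z : Euc N,
    ∫⁻ y, {y | ‖z - y‖ < 2 * rr y}.indicator
      (fun y => ENNReal.ofReal (rr y ^ (-(N : ℝ))) * ENNReal.ofReal (rr y ^ b)) y
      ≤ C * ENNReal.ofReal ((1 + ‖z‖) ^ b) := by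
  set B := volume (ball (0 : Euc N) 1) with hB
  have hvol : B ≠ ∞ := measure_ball_lt_top.ne
  refine ⟨ENNReal.ofReal (16 ^ |(-(N : ℝ))|) * ENNReal.ofReal (16 ^ |b|) * B, by finiteness, fun z => ?_⟩
  have hz : 0 < 1 + ‖z‖ := by positivity
  calc _ ≤ ∫⁻ y, (ball z (1 + ‖z‖)).indicator (fun y =>
        ENNReal.ofReal (16 ^ |(-(N : ℝ))| * (1 + ‖z‖) ^ (-(N : ℝ))) *
          ENNReal.ofReal (16 ^ |b| * (1 + ‖z‖) ^ b)) y := by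
        apply lintegral_mono
        intro y
        by_cases hy : ‖z - y‖ < 2 * rr y
        · have hy' : y ∈ ball z (1 + ‖z‖) := by
            rw [mem_ball, dist_comm, dist_eq_norm]
            have := (near_cmp hy).1
            have e : 1 + ‖y‖ = 8 * rr y := by unfold rr; ring
            linarith
          simp only
          rw [Set.indicator_of_mem (by exact hy), Set.indicator_of_mem hy']
          gcongr
          · exact (ker_cmp _ hy).1
          · exact (ker_cmp _ hy).1
        · simp only
          rw [Set.indicator_of_notMem (by exact hy)]
          exact zero_le
    _ = _ := by
        rw [lintegral_indicator measurableSet_ball, setLIntegral_const, vol_ball z hz]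
        rw [ENNReal.ofReal_mul (by positivity), ENNReal.ofReal_mul (by positivity)]
        have : ENNReal.ofReal ((1 + ‖z‖) ^ (-(N : ℝ))) * ENNReal.ofReal ((1 + ‖z‖) ^ (N : ℝ)) = 1 := by
          rw [← ENNReal.ofReal_mul (by positivity), ← Real.rpow_add hz]; simp
        calc _ = ENNReal.ofReal (16 ^ |(-(N : ℝ))|) * ENNReal.ofReal (16 ^ |b|) * B *
            ENNReal.ofReal ((1 + ‖z‖) ^ b) *
            (ENNReal.ofReal ((1 + ‖z‖) ^ (-(N : ℝ))) * ENNReal.ofReal ((1 + ‖z‖) ^ (N : ℝ))) := by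
              rw [hB]; ring
          _ = _ := by rw [this, mul_one]

lemma ker_lo {N : ℕ} (b : ℝ) : ∃ C : ℝ≥0∞, C ≠ ∞ ∧ ∀ z : Euc N,
    ENNReal.ofReal ((1 + ‖z‖) ^ b) ≤ C * ∫⁻ y, {y | ‖z - y‖ < 1 * rr y}.indicator
      (fun y => ENNReal.ofReal (rr y ^ (-(N : ℝ))) * ENNReal.ofReal (rr y ^ b)) y := by
  set B := volume (ball (0 : Euc N) 1) with hB
  have hvol : B ≠ ∞ := measure_ball_lt_top.ne
  have hvol0 : B ≠ 0 := (measure_ball_pos _ _ one_pos).ne'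
  refine ⟨ENNReal.ofReal (16 ^ |(-(N : ℝ))|) * ENNReal.ofReal (16 ^ |b|) *
    ENNReal.ofReal (16 ^ (N : ℝ)) * B⁻¹, by finiteness, fun z => ?_⟩
  have hz : 0 < 1 + ‖z‖ := by positivity
  set I := ∫⁻ y, {y | ‖z - y‖ < 1 * rr y}.indicator
      (fun y => ENNReal.ofReal (rr y ^ (-(N : ℝ))) * ENNReal.ofReal (rr y ^ b)) y with hI
  have h1 : ENNReal.ofReal ((1 + ‖z‖) ^ (-(N : ℝ))) * ENNReal.ofReal ((1 + ‖z‖) ^ b) *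
      volume (ball z ((1 + ‖z‖) / 16)) ≤
      ENNReal.ofReal (16 ^ |(-(N : ℝ))|) * ENNReal.ofReal (16 ^ |b|) * I := by
    rw [← setLIntegral_const, ← lintegral_indicator measurableSet_ball, hI,
      ← lintegral_const_mul' _ _ (by finiteness)]
    apply lintegral_mono
    intro y
    by_cases hy : y ∈ ball z ((1 + ‖z‖) / 16)
    · have hy' : ‖z - y‖ < (1 + ‖z‖) / 16 := by
        rwa [mem_ball, dist_comm, dist_eq_norm] at hy
      have h2 : ‖z‖ ≤ ‖y‖ + ‖z - y‖ := by
        have := norm_add_le y (z - y)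
        simpa using this
      have h3 : ‖z - y‖ < 1 * rr y := by
        have := norm_nonneg z
        unfold rr; linarith
      have h4 : ‖z - y‖ < 2 * rr y := by linarith [rr_pos y]
      simp only
      rw [Set.indicator_of_mem hy, Set.indicator_of_mem (by exact h3)]
      calc _ ≤ ENNReal.ofReal (16 ^ |(-(N : ℝ))| * rr y ^ (-(N : ℝ))) *
          ENNReal.ofReal (16 ^ |b| * rr y ^ b) := by
            gcongr
            · exact (ker_cmp _ h4).2
            · exact (ker_cmp _ h4).2
        _ = _ := by
            rw [ENNReal.ofReal_mul (by positivity), ENNReal.ofReal_mul (by positivity)]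
            ring
    · simp only
      rw [Set.indicator_of_notMem hy]
      exact zero_le
  have h2 : ENNReal.ofReal ((1 + ‖z‖) ^ b) = ENNReal.ofReal (16 ^ (N : ℝ)) * B⁻¹ *
      (ENNReal.ofReal ((1 + ‖z‖) ^ (-(N : ℝ))) * ENNReal.ofReal ((1 + ‖z‖) ^ b) *
      volume (ball z ((1 + ‖z‖) / 16))) := by
    rw [vol_ball z (by positivity)]
    have e1 : ENNReal.ofReal ((1 + ‖z‖) ^ (-(N : ℝ))) * ENNReal.ofReal (((1 + ‖z‖)/16) ^ (N : ℝ)) *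
       ENNReal.ofReal (16 ^ (N : ℝ)) = 1 := by
      rw [← ENNReal.ofReal_mul (by positivity), ← ENNReal.ofReal_mul (by positivity),
        Real.div_rpow hz.le (by norm_num), Real.rpow_neg hz.le]
      rw [← ENNReal.ofReal_one]
      congr 1
      have := Real.rpow_pos_of_pos hz N
      field_simp
    calc _ = ENNReal.ofReal ((1 + ‖z‖) ^ b) * (B⁻¹ * B) * (ENNReal.ofReal ((1 + ‖z‖) ^ (-(N : ℝ))) *
        ENNReal.ofReal (((1 + ‖z‖)/16) ^ (N : ℝ)) * ENNReal.ofReal (16 ^ (N : ℝ))) := by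
          rw [e1, ENNReal.inv_mul_cancel hvol0 hvol]; simp
      _ = _ := by ring
  rw [h2]
  calc _ ≤ ENNReal.ofReal (16 ^ (N : ℝ)) * B⁻¹ * (ENNReal.ofReal (16 ^ |(-(N : ℝ))|) *
        ENNReal.ofReal (16 ^ |b|) * I) := by gcongr
    _ = _ := by ring

/-- scaled local norm -/
def Sl {N : ℕ} (c β : ℝ) (q : ℝ≥0∞) (h : Euc N → ℝ) (y : Euc N) : ℝ≥0∞ :=
  ENNReal.ofReal (rr y ^ (-β)) * Lb c q (fun x => h (y + rr y • x))

lemma Sl_rpow {N : ℕ} (c β : ℝ) {p : ℝ} (hp : 1 ≤ p) (h : Euc N → ℝ) (y : Euc N) :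
    Sl c β (ENNReal.ofReal p) h y ^ p = ENNReal.ofReal (rr y ^ (-β * p - N)) *
      ∫⁻ z, {z | ‖z - y‖ < c * rr y}.indicator (fun z => ‖h z‖ₑ ^ p) z := by
  have hp0 : 0 < p := by linarith
  have hr := rr_pos y
  unfold Sl
  rw [ENNReal.mul_rpow_of_nonneg _ _ hp0.le, Lb_rpow c hp, enn_ofReal_rpow (by positivity),
    ← Real.rpow_mul hr.le]
  have e : K 0 p (fun x => ‖(ball (0 : Euc N) c).indicator (fun x => h (y + rr y • x)) x‖ₑ) =
      ENNReal.ofReal (rr y ^ (-(N : ℝ))) *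
        ∫⁻ z, {z | ‖z - y‖ < c * rr y}.indicator (fun z => ‖h z‖ₑ ^ p) z := by
    rw [← lintegral_add_left_eq_self _ y, ← lintegral_dil hr (fun x =>
      {z | ‖z - y‖ < c * rr y}.indicator (fun z => ‖h z‖ₑ ^ p) (y + x))]
    unfold K
    congr 1; ext x
    simp only [Real.rpow_zero, ENNReal.ofReal_one, one_mul]
    by_cases hx : ‖x‖ < c
    · rw [Set.indicator_of_mem (by simpa using hx), Set.indicator_of_mem]
      show ‖y + rr y • x - y‖ < _
      rw [add_sub_cancel_left, norm_smul, Real.norm_of_nonneg hr.le, mul_comm]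
      gcongr
    · rw [Set.indicator_of_notMem (by simpa using hx), Set.indicator_of_notMem]
      · simp [hp0]
      · show ¬ (‖y + rr y • x - y‖ < _)
        rw [add_sub_cancel_left, norm_smul, Real.norm_of_nonneg hr.le, mul_comm]
        intro hcon
        exact hx (lt_of_mul_lt_mul_right hcon hr.le)
  rw [e, ← mul_assoc, ← ENNReal.ofReal_mul (by positivity), ← Real.rpow_add hr]
  rfl

lemma Sl_int {N : ℕ} (c β : ℝ) {p : ℝ} (hp : 1 ≤ p) {h : Euc N → ℝ} (hh : Continuous h) :
    ∫⁻ y, ENNReal.ofReal (rr y ^ (-(N : ℝ))) * Sl c β (ENNReal.ofReal p) h y ^ p =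
    ∫⁻ z, (∫⁻ y, {y | ‖z - y‖ < c * rr y}.indicator (fun y =>
      ENNReal.ofReal (rr y ^ (-(N : ℝ))) * ENNReal.ofReal (rr y ^ (-β * p - N))) y) * ‖h z‖ₑ ^ p := by
  have hp0 : 0 < p := by linarith
  have hrm := rr_meas (N := N)
  have hhm := hh.measurable
  have hM : Measurable fun w : Euc N × Euc N => {w : Euc N × Euc N | ‖w.2 - w.1‖ < c * rr w.1}.indicator
      (fun w => ENNReal.ofReal (rr w.1 ^ (-(N : ℝ))) * ENNReal.ofReal (rr w.1 ^ (-β * p - N)) * ‖h w.2‖ₑ ^ p) w := by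
    apply Measurable.indicator
    · fun_prop
    · exact measurableSet_lt (by fun_prop) (by fun_prop)
  have e1 : ∀ y, ENNReal.ofReal (rr y ^ (-(N : ℝ))) * Sl c β (ENNReal.ofReal p) h y ^ p =
      ∫⁻ z, {w : Euc N × Euc N | ‖w.2 - w.1‖ < c * rr w.1}.indicator
      (fun w => ENNReal.ofReal (rr w.1 ^ (-(N : ℝ))) * ENNReal.ofReal (rr w.1 ^ (-β * p - N)) * ‖h w.2‖ₑ ^ p) (y, z) := by
    intro y
    rw [Sl_rpow c β hp, ← mul_assoc, ← lintegral_const_mul' _ _ (by finiteness)]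
    congr 1; ext z
    simp only [Set.indicator, Set.mem_ofPred_eq]
    split_ifs <;> simp
  simp only [e1]
  rw [lintegral_lintegral_swap (by exact hM.aemeasurable)]
  congr 1; ext z
  rw [← lintegral_mul_const _ (by
    apply Measurable.indicator
    · fun_prop
    · exact measurableSet_lt (by fun_prop) (by fun_prop))]
  congr 1; ext y
  simp only [Set.indicator, Set.mem_ofPred_eq]
  split_ifs <;> simp

lemma G_lower {N : ℕ} (α : ℝ) {q : ℝ} (hq : 1 ≤ q) : ∃ C : ℝ≥0∞, C ≠ ∞ ∧ ∀ f : Euc N → ℝ,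
    Continuous f → Wn N α (ENNReal.ofReal q) f ^ q ≤
    C * ∫⁻ y, ENNReal.ofReal (rr y ^ (-(N : ℝ))) * Sl 1 α (ENNReal.ofReal q) f y ^ q := by
  obtain ⟨C, hC, h⟩ := ker_lo (N := N) (-α * q - N)
  refine ⟨C, hC, fun f hf => ?_⟩
  rw [Wn_rpow α hq, Sl_int 1 α hq hf, ← lintegral_const_mul' _ _ hC]
  unfold K
  apply lintegral_mono
  intro z
  simp only
  rw [← mul_assoc]
  gcongr
  exact h z

lemma G_upper {N : ℕ} (β : ℝ) {p : ℝ} (hp : 1 ≤ p) : ∃ C : ℝ≥0∞, C ≠ ∞ ∧ ∀ h : Euc N → ℝ,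
    Continuous h → (∀ y, Sl 2 β (ENNReal.ofReal p) h y ^ p ≤ C * Wn N β (ENNReal.ofReal p) h ^ p) ∧
    ∫⁻ y, ENNReal.ofReal (rr y ^ (-(N : ℝ))) * Sl 2 β (ENNReal.ofReal p) h y ^ p ≤
      C * Wn N β (ENNReal.ofReal p) h ^ p := by
  obtain ⟨C, hC, h⟩ := ker_up (N := N) (-β * p - N)
  set D := ENNReal.ofReal (16 ^ |-β * p - N|) with hD
  refine ⟨C + D, by finiteness, fun f hf => ⟨fun y => ?_, ?_⟩⟩
  · rw [Wn_rpow β hp, Sl_rpow 2 β hp, ← lintegral_const_mul' _ _ (by finiteness)]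
    unfold K
    rw [← lintegral_const_mul' _ _ (by finiteness)]
    apply lintegral_mono
    intro z
    simp only
    by_cases hz : ‖z - y‖ < 2 * rr y
    · rw [Set.indicator_of_mem (by exact hz), ← mul_assoc]
      gcongr
      refine (ENNReal.ofReal_le_ofReal (ker_cmp _ hz).1).trans ?_
      rw [ENNReal.ofReal_mul (by positivity)]
      gcongr
      exact le_add_self
    · rw [Set.indicator_of_notMem (by exact hz), mul_zero]; exact zero_le
  · rw [Wn_rpow β hp, Sl_int 2 β hp hf]
    unfold K
    rw [← lintegral_const_mul' _ _ (by finiteness)]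
    apply lintegral_mono
    intro z
    simp only
    rw [← mul_assoc]
    gcongr
    exact (h z).trans (by gcongr; exact le_self_add)

lemma Sl_meas {N : ℕ} (c β : ℝ) {p : ℝ} (hp : 1 ≤ p) {h : Euc N → ℝ} (hh : Continuous h) :
    Measurable fun y => Sl c β (ENNReal.ofReal p) h y ^ p := by
  have hp0 : 0 < p := by linarith
  have hrm := rr_meas (N := N)
  have hhm := hh.measurable
  have hM : Measurable (Function.uncurry fun (y : Euc N) (z : Euc N) =>
      {w : Euc N × Euc N | ‖w.2 - w.1‖ < c * rr w.1}.indicator (fun w => ‖h w.2‖ₑ ^ p) (y, z)) := by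
    apply Measurable.indicator
    · fun_prop
    · exact measurableSet_lt (by fun_prop) (by fun_prop)
  have h2 := Measurable.lintegral_prod_right hM (ν := volume)
  simp only [Sl_rpow c β hp]
  apply Measurable.fun_mul
  · fun_prop
  · exact h2

lemma Gq {N : ℕ} {ι : Type} [Fintype ι] {p q : ℝ} (hp : 1 ≤ p) (hpq : p ≤ q) (α : ℝ) (β : ι → ℝ)
    {C0 : ℝ≥0∞} (hC0 : C0 ≠ ∞) : ∃ C : ℝ≥0∞, C ≠ ∞ ∧ ∀ (f : Euc N → ℝ) (h : ι → Euc N → ℝ),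
      Continuous f → (∀ j, Continuous (h j)) →
      (∀ y, Sl 1 α (ENNReal.ofReal q) f y ≤ C0 * ∑ j, Sl 2 (β j) (ENNReal.ofReal p) (h j) y) →
      Wn N α (ENNReal.ofReal q) f ≤ C * ∑ j, Wn N (β j) (ENNReal.ofReal p) (h j) := by
  have hp0 : 0 < p := by linarith
  have hq : 1 ≤ q := by linarith
  have hq0 : 0 < q := by linarith
  have hqp : 0 ≤ q / p - 1 := by rw [sub_nonneg, one_le_div hp0]; exact hpq
  obtain ⟨C1, hC1, hlow⟩ := G_lower (N := N) α hq
  choose D hD hup using fun j => G_upper (N := N) (β j) hp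
  set n : ℝ≥0∞ := ((Finset.univ : Finset ι).card : ℝ≥0∞) with hn
  set E := ∑ j, D j ^ (q / p) with hE
  have hDE : ∀ j, D j ^ (q / p) ≠ ∞ := fun j => ENNReal.rpow_ne_top_of_nonneg (by positivity) (hD j)
  have hnf : n ^ (q - 1) ≠ ∞ := ENNReal.rpow_ne_top_of_nonneg (by linarith) (by simp [hn])
  have hCq : C0 ^ q ≠ ∞ := ENNReal.rpow_ne_top_of_nonneg (by linarith) hC0
  have hEf : E ≠ ∞ := by rw [hE]; exact ENNReal.sum_ne_top.2 fun j _ => hDE j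
  have hB : C1 * (C0 ^ q * n ^ (q - 1)) * E ≠ ∞ := by finiteness
  refine ⟨(C1 * (C0 ^ q * n ^ (q - 1)) * E) ^ (1 / q),
    ENNReal.rpow_ne_top_of_nonneg (by positivity) hB, fun f h hf hh hyp => ?_⟩
  apply rpow_le_of_le hq
  set W := ∑ j, Wn N (β j) (ENNReal.ofReal p) (h j) with hW
  refine (hlow f hf).trans ?_
  have hpt : ∀ y, Sl 1 α (ENNReal.ofReal q) f y ^ q ≤ (C0 ^ q * n ^ (q - 1)) *
      ∑ j, (D j * Wn N (β j) (ENNReal.ofReal p) (h j) ^ p) ^ (q / p - 1) *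
        Sl 2 (β j) (ENNReal.ofReal p) (h j) y ^ p := by
    intro y
    calc _ ≤ (C0 * ∑ j, Sl 2 (β j) (ENNReal.ofReal p) (h j) y) ^ q := by gcongr; exact hyp y
      _ ≤ C0 ^ q * (n ^ (q - 1) * ∑ j, Sl 2 (β j) (ENNReal.ofReal p) (h j) y ^ q) := by
          rw [ENNReal.mul_rpow_of_nonneg _ _ hq0.le]
          gcongr
          exact ENNReal.rpow_sum_le_const_mul_sum_rpow _ _ hq
      _ ≤ _ := by
          rw [← mul_assoc]
          gcongr with j
          have e : Sl 2 (β j) (ENNReal.ofReal p) (h j) y ^ q =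
            (Sl 2 (β j) (ENNReal.ofReal p) (h j) y ^ p) ^ (q / p - 1) * Sl 2 (β j) (ENNReal.ofReal p) (h j) y ^ p := by
            rw [← ENNReal.rpow_mul, ← ENNReal.rpow_add_of_nonneg _ _ (by positivity) hp0.le]
            congr 1
            field_simp
            ring
          rw [e]
          gcongr
          exact (hup j (h j) (hh j)).1 y
  have hrm : Measurable fun y : Euc N => ENNReal.ofReal (rr y ^ (-(N : ℝ))) := by
    have := rr_meas (N := N)
    fun_prop
  calc C1 * ∫⁻ y, ENNReal.ofReal (rr y ^ (-(N : ℝ))) * Sl 1 α (ENNReal.ofReal q) f y ^ q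
      ≤ C1 * ∫⁻ y, (C0 ^ q * n ^ (q - 1)) *
         ∑ j, (D j * Wn N (β j) (ENNReal.ofReal p) (h j) ^ p) ^ (q / p - 1) *
        (ENNReal.ofReal (rr y ^ (-(N : ℝ))) * Sl 2 (β j) (ENNReal.ofReal p) (h j) y ^ p) := by
        refine mul_le_mul_right (lintegral_mono fun y => ?_) _
        refine (mul_le_mul_right (hpt y) _).trans (le_of_eq ?_)
        rw [mul_left_comm, Finset.mul_sum]
        congr 1
        apply Finset.sum_congr rfl
        intro j _
        ring
    _ = C1 * ((C0 ^ q * n ^ (q - 1)) *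
         ∑ j, (D j * Wn N (β j) (ENNReal.ofReal p) (h j) ^ p) ^ (q / p - 1) *
         ∫⁻ y, (ENNReal.ofReal (rr y ^ (-(N : ℝ))) * Sl 2 (β j) (ENNReal.ofReal p) (h j) y ^ p)) := by
        have hmj : ∀ j, Measurable fun y =>
          ENNReal.ofReal (rr y ^ (-(N : ℝ))) * Sl 2 (β j) (ENNReal.ofReal p) (h j) y ^ p :=
          fun j => hrm.fun_mul (Sl_meas 2 (β j) hp (hh j))
        rw [lintegral_const_mul' _ _ (by finiteness), lintegral_finsetSum]
        · congr 2
          apply Finset.sum_congr rfl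
          intro j _
          rw [lintegral_const_mul _ (hmj j)]
        · intro j _
          exact (hmj j).const_mul _
    _ ≤ C1 * ((C0 ^ q * n ^ (q - 1)) * ∑ j, D j ^ (q / p) * W ^ q) := by
        refine mul_le_mul_right (mul_le_mul_right (Finset.sum_le_sum fun j _ => ?_) _) _
        refine (mul_le_mul_right (hup j (h j) (hh j)).2 _).trans ?_
        set w := Wn N (β j) (ENNReal.ofReal p) (h j) with hw
        have hwW : w ≤ W := Finset.single_le_sum (f := fun j => Wn N (β j) (ENNReal.ofReal p) (h j))
          (fun _ _ => zero_le) (Finset.mem_univ j)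
        calc (D j * w ^ p) ^ (q / p - 1) * (D j * w ^ p) = (D j * w ^ p) ^ (q / p) := by
              have := ENNReal.rpow_add_of_nonneg (x := D j * w ^ p) _ _ hqp zero_le_one
              rw [ENNReal.rpow_one] at this
              rw [← this]
              congr 1; ring
          _ = D j ^ (q / p) * w ^ q := by
              rw [ENNReal.mul_rpow_of_nonneg _ _ (by positivity), ← ENNReal.rpow_mul]
              congr 2; field_simp
          _ ≤ _ := by gcongr
    _ = _ := by rw [← Finset.sum_mul]; ring

lemma Ginf {N : ℕ} {ι : Type} [Fintype ι] {p : ℝ} (hp : 1 ≤ p) (α : ℝ) (β : ι → ℝ)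
    {C0 : ℝ≥0∞} (hC0 : C0 ≠ ∞) : ∃ C : ℝ≥0∞, C ≠ ∞ ∧ ∀ (f : Euc N → ℝ) (h : ι → Euc N → ℝ),
      (∀ j, Continuous (h j)) →
      (∀ y, ENNReal.ofReal (rr y ^ (-α)) * ‖f y‖ₑ ≤ C0 * ∑ j, Sl 2 (β j) (ENNReal.ofReal p) (h j) y) →
      Wn N α ∞ f ≤ C * ∑ j, Wn N (β j) (ENNReal.ofReal p) (h j) := by
  have hp0 : 0 < p := by linarith
  choose D hD hup using fun j => G_upper (N := N) (β j) hp
  have hDf : ∀ j, D j ^ (1 / p) ≠ ∞ := fun j => ENNReal.rpow_ne_top_of_nonneg (by positivity) (hD j)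
  have hEf : ∑ j, D j ^ (1 / p) ≠ ∞ := ENNReal.sum_ne_top.2 fun j _ => hDf j
  refine ⟨ENNReal.ofReal (16 ^ |-α|) * (C0 * ∑ j, D j ^ (1 / p)), by finiteness, fun f h hh hyp => ?_⟩
  unfold Wn
  rw [eLpNorm_exponent_top]
  apply eLpNormEssSup_le_of_ae_enorm_bound
  apply Eventually.of_forall
  intro y
  have hy : ‖y - y‖ < 2 * rr y := by simp [rr_pos y]
  rw [enorm_mul, Real.enorm_of_nonneg (wt_pos _ _ _).le]
  calc _ ≤ ENNReal.ofReal (16 ^ |-α|) * (ENNReal.ofReal (rr y ^ (-α)) * ‖f y‖ₑ) := by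
        rw [← mul_assoc, ← ENNReal.ofReal_mul (by positivity)]
        gcongr
        simp only [wt, ENNReal.toReal_top, _root_.div_zero, _root_.sub_zero]
        exact (ker_cmp _ hy).2
    _ ≤ ENNReal.ofReal (16 ^ |-α|) * (C0 * ∑ j, Sl 2 (β j) (ENNReal.ofReal p) (h j) y) := by
        exact mul_le_mul_right (hyp y) _
    _ ≤ ENNReal.ofReal (16 ^ |-α|) * (C0 * ∑ j, (∑ j, D j ^ (1 / p)) * Wn N (β j) (ENNReal.ofReal p) (h j)) := by
        gcongr with j
        refine (rpow_le_of_le hp ((hup j (h j) (hh j)).1 y)).trans ?_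
        gcongr
        exact Finset.single_le_sum (f := fun j => D j ^ (1 / p)) (fun _ _ => zero_le) (Finset.mem_univ j)
    _ = _ := by
        rw [← Finset.mul_sum]
        unfold Wn
        ring

lemma Lb_le_Lb {N : ℕ} {R R' : ℝ} (h : R ≤ R') (q : ℝ≥0∞) (f : Euc N → ℝ) : Lb R q f ≤ Lb R' q f :=
  eLpNorm_mono_measure _ (Measure.restrict_mono (ball_subset_ball h) le_rfl)

lemma Sl_pd {N : ℕ} (c β : ℝ) (q : ℝ≥0∞) {v : Euc N → ℝ} (hv : Sm v) (i : Fin N) (y : Euc N) :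
    ENNReal.ofReal (rr y ^ (-β)) * Lb c q (pd i (fun x => v (y + rr y • x))) =
      Sl c (β - 1) q (pd i v) y := by
  have hr := rr_pos y
  rw [pd_affine hv, Lb_const_mul, Real.enorm_of_nonneg hr.le, ← mul_assoc,
    ← ENNReal.ofReal_mul (by positivity)]
  unfold Sl
  congr 2
  rw [← Real.rpow_add_one hr.ne']
  congr 1; ring

lemma S1 {N : ℕ} (hN : 1 ≤ N) {p q : ℝ} (hp : 1 ≤ p) (hpq : p ≤ q)
    (hq : 1 / p - 1 / (N : ℝ) ≤ 1 / q) (σ : ℝ) :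
    ∃ C : ℝ≥0∞, C ≠ ∞ ∧ ∀ v : Euc N → ℝ, Sm v →
      Wn N σ (ENNReal.ofReal q) v ≤
        C * (Wn N σ (ENNReal.ofReal p) v + ∑ i, Wn N (σ - 1) (ENNReal.ofReal p) (pd i v)) := by
  obtain ⟨C0, hC0, h0⟩ := S1loc hN hp hpq hq
  obtain ⟨C, hC, hG⟩ := Gq (N := N) (ι := Option (Fin N)) hp hpq σ (fun o => o.elim σ (fun _ => σ - 1)) hC0
  refine ⟨C, hC, fun v hv => ?_⟩
  have h1 := hG v (fun o => o.elim v (fun i => pd i v)) hv.continuous (by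
    intro j
    cases j with
    | none => exact hv.continuous
    | some i => exact (hv.pd i).continuous) (by
    intro y
    rw [Fintype.sum_option]
    simp only [Option.elim]
    have h2 := mul_le_mul_right (h0 _ (hv.affine y (rr y))) (ENNReal.ofReal (rr y ^ (-σ)))
    refine h2.trans (le_of_eq ?_)
    rw [mul_left_comm, mul_add, Finset.mul_sum]
    congr 2
    exact Finset.sum_congr rfl fun i _ => Sl_pd 2 σ _ hv i y)
  rw [Fintype.sum_option] at h1
  exact h1

lemma Sinf {N : ℕ} {p : ℝ} (hp : 1 ≤ p) (hpN : (N : ℝ) < p ∨ (N = 1 ∧ p = 1)) (σ : ℝ) :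
    ∃ C : ℝ≥0∞, C ≠ ∞ ∧ ∀ v : Euc N → ℝ, Sm v →
      Wn N σ ∞ v ≤
        C * (Wn N σ (ENNReal.ofReal p) v + ∑ i, Wn N (σ - 1) (ENNReal.ofReal p) (pd i v)) := by
  obtain ⟨C0, hC0, h0⟩ := Mloc hp hpN
  obtain ⟨C, hC, hG⟩ := Ginf (N := N) (ι := Option (Fin N)) hp σ (fun o => o.elim σ (fun _ => σ - 1)) hC0
  refine ⟨C, hC, fun v hv => ?_⟩
  have h1 := hG v (fun o => o.elim v (fun i => pd i v)) (by
    intro j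
    cases j with
    | none => exact hv.continuous
    | some i => exact (hv.pd i).continuous) (by
    intro y
    rw [Fintype.sum_option]
    simp only [Option.elim]
    have h2 := mul_le_mul_right (h0 _ (hv.affine y (rr y))) (ENNReal.ofReal (rr y ^ (-σ)))
    simp only [smul_zero, add_zero] at h2
    refine h2.trans ?_
    rw [mul_left_comm, mul_add, Finset.mul_sum]
    refine mul_le_mul_right ?_ _
    refine add_le_add ?_ (Finset.sum_le_sum fun i _ => ?_)
    · exact mul_le_mul_right (Lb_le_Lb (by norm_num) _ _) _
    · rw [← Sl_pd 2 σ _ hv i y]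
      exact mul_le_mul_right (Lb_le_Lb (by norm_num) _ _) _)
  rw [Fintype.sum_option] at h1
  exact h1

lemma S2 {N : ℕ} {p : ℝ} (hp : 1 ≤ p) (l : List (Fin N)) (σ : ℝ) :
    ∃ C : ℝ≥0∞, C ≠ ∞ ∧ ∀ u : Euc N → ℝ, Sm u →
      Wn N (σ - l.length) (ENNReal.ofReal p) (pderivList l u) ≤
        C * (Wn N σ (ENNReal.ofReal p) u +
          ∑ i, Wn N (σ - l.length - 1) (ENNReal.ofReal p) (pd i (pderivList l u))) := by
  obtain ⟨C0, hC0, h0⟩ := S2loc hp l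
  obtain ⟨C, hC, hG⟩ := Gq (N := N) (ι := Option (Fin N)) hp le_rfl (σ - l.length)
    (fun o => o.elim σ (fun _ => σ - l.length - 1)) hC0
  refine ⟨C, hC, fun v hv => ?_⟩
  have hl := hv.pderivList l
  have h1 := hG (pderivList l v) (fun o => o.elim v (fun i => pd i (pderivList l v))) hl.continuous (by
    intro j
    cases j with
    | none => exact hv.continuous
    | some i => exact (hl.pd i).continuous) (by
    intro y
    have hr := rr_pos y
    rw [Fintype.sum_option]
    simp only [Option.elim]
    have h2 := mul_le_mul_right (h0 _ (hv.affine y (rr y))) (ENNReal.ofReal (rr y ^ (-σ)))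
    rw [pderivList_affine l y _ hv] at h2
    have key : ∀ f : Euc N → ℝ, ∀ c : ℝ, ENNReal.ofReal (rr y ^ (-σ)) * Lb c (ENNReal.ofReal p)
        (fun x => rr y ^ l.length * f x) =
        ENNReal.ofReal (rr y ^ (-(σ - l.length))) * Lb c (ENNReal.ofReal p) f := by
      intro f c
      rw [Lb_const_mul, Real.enorm_of_nonneg (by positivity), ← mul_assoc,
        ← ENNReal.ofReal_mul (by positivity), ← Real.rpow_natCast, ← Real.rpow_add hr]
      congr 3; ring
    rw [key] at h2
    refine h2.trans (le_of_eq ?_)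
    rw [mul_left_comm, mul_add, Finset.mul_sum]
    congr 2
    refine Finset.sum_congr rfl fun i _ => ?_
    rw [pd_const_mul (hl.affine y _), key, Sl_pd 2 _ _ hl i y])
  rw [Fintype.sum_option] at h1
  exact h1

/-- weighted norm of all derivatives of order `j` -/
def Tj {N : ℕ} (σ p : ℝ) (j : ℕ) (u : Euc N → ℝ) : ℝ≥0∞ :=
  ∑ m : Fin j → Fin N, Wn N (σ - j) (ENNReal.ofReal p) (pderivList (List.ofFn m) u)

/-- weighted Sobolev embedding for smooth functions -/
def Emb (N : ℕ) (p : ℝ) (q : ℝ≥0∞) (k : ℕ) : Prop := ∀ σ : ℝ, ∃ C : ℝ≥0∞, C ≠ ∞ ∧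
  ∀ u : Euc N → ℝ, Sm u → Wn N σ q u ≤ C * ∑ j ∈ Finset.range (k + 1), Tj σ p j u

lemma Tj_zero {N : ℕ} (σ p : ℝ) (u : Euc N → ℝ) : Tj σ p 0 u = Wn N σ (ENNReal.ofReal p) u := by
  simp [Tj, pderivList]

lemma Tj_succ {N : ℕ} (σ p : ℝ) (j : ℕ) (u : Euc N → ℝ) :
    Tj σ p (j + 1) u = ∑ i, Tj (σ - 1) p j (pd i u) := by
  unfold Tj
  rw [sum_cons (fun l => Wn N (σ - ((j + 1 : ℕ) : ℝ)) (ENNReal.ofReal p) (pderivList l u))]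
  simp only [pderivList_cons]
  have : σ - ((j + 1 : ℕ) : ℝ) = σ - 1 - j := by push_cast; ring
  rw [this]

lemma Emb_self (N : ℕ) (p : ℝ) (k : ℕ) : Emb N p (ENNReal.ofReal p) k := by
  intro σ
  refine ⟨1, by simp, fun u _ => ?_⟩
  rw [one_mul, ← Tj_zero]
  exact Finset.single_le_sum (f := fun j => Tj σ p j u) (fun _ _ => zero_le) (by simp)

lemma Emb_step {N : ℕ} {p : ℝ} {q1 q : ℝ≥0∞} {k : ℕ}
    (h1 : ∀ σ : ℝ, ∃ C : ℝ≥0∞, C ≠ ∞ ∧ ∀ v : Euc N → ℝ, Sm v →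
      Wn N σ q v ≤ C * (Wn N σ q1 v + ∑ i, Wn N (σ - 1) q1 (pd i v)))
    (h : Emb N p q1 k) : Emb N p q (k + 1) := by
  intro σ
  obtain ⟨C1, hC1, g1⟩ := h1 σ
  obtain ⟨C2, hC2, g2⟩ := h σ
  obtain ⟨C3, hC3, g3⟩ := h (σ - 1)
  refine ⟨C1 * (C2 + C3), by finiteness, fun u hu => ?_⟩
  refine (g1 u hu).trans ?_
  rw [mul_assoc]
  refine mul_le_mul_right ?_ _
  rw [add_mul]
  refine add_le_add ((g2 u hu).trans ?_) ?_
  · refine mul_le_mul_right ?_ _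
    exact Finset.sum_le_sum_of_subset (Finset.range_subset_range.2 (by omega))
  · calc _ ≤ ∑ i, C3 * ∑ j ∈ Finset.range (k + 1), Tj (σ - 1) p j (pd i u) :=
          Finset.sum_le_sum fun i _ => g3 _ (hu.pd i)
      _ = C3 * ∑ j ∈ Finset.range (k + 1), Tj σ p (j + 1) u := by
          rw [← Finset.mul_sum, Finset.sum_comm]
          simp only [Tj_succ]
      _ ≤ _ := by
          refine mul_le_mul_right ?_ _
          rw [Finset.sum_range_succ' (fun j => Tj σ p j u) (k + 1)]
          exact le_self_add

lemma Emb_fin {N : ℕ} (hN : 1 ≤ N) {p : ℝ} (hp : 1 ≤ p) (k : ℕ) : ∀ {q : ℝ}, p ≤ q →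
    1 / p - k / (N : ℝ) ≤ 1 / q → Emb N p (ENNReal.ofReal q) k := by
  have hp0 : 0 < p := by linarith
  have hN0 : (0 : ℝ) < N := by exact_mod_cast hN
  induction k with
  | zero =>
    intro q hpq hq
    have hq0 : 0 < q := by linarith
    have : q ≤ p := by
      simp only [Nat.cast_zero, zero_div, _root_.zero_div, sub_zero, _root_.sub_zero] at hq
      exact (one_div_le_one_div hp0 hq0).1 hq
    rw [le_antisymm this hpq]
    exact Emb_self N p 0
  | succ k ih =>
    intro q hpq hq
    have hq0 : 0 < q := by linarith
    have hm : 0 < min (1 / p) (1 / q + 1 / N) := lt_min (by positivity) (by positivity)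
    set q1 := 1 / (min (1 / p) (1 / q + 1 / N)) with hq1
    have e1 : 1 / q1 = min (1 / p) (1 / q + 1 / N) := by rw [hq1, one_div_one_div]
    have hq10 : 0 < q1 := by positivity
    have hpq1 : p ≤ q1 := by
      rw [← one_div_le_one_div hq10 hp0, e1]; exact min_le_left _ _
    have hq1q : q1 ≤ q := by
      rw [← one_div_le_one_div hq0 hq10, e1]
      apply le_min
      · exact one_div_le_one_div_of_le hp0 hpq
      · have : 0 < 1 / (N : ℝ) := by positivity
        linarith
    apply Emb_step (q1 := ENNReal.ofReal q1)
    · apply S1 hN (hp.trans hpq1) hq1q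
      rw [e1]
      linarith [min_le_right (1 / p) (1 / q + 1 / N)]
    · apply ih hpq1
      rw [e1]
      apply le_min
      · have : 0 ≤ (k : ℝ) / N := by positivity
        linarith
      · push_cast at hq
        rw [add_div] at hq
        linarith

lemma Emb_inf {N : ℕ} (hN : 1 ≤ N) {p : ℝ} (hp : 1 ≤ p) {k : ℕ} (hk : 1 ≤ k)
    (h : (N : ℝ) < k * p ∨ (N = 1 ∧ p = 1)) : Emb N p ∞ k := by
  have hp0 : 0 < p := by linarith
  have hN0 : (0 : ℝ) < N := by exact_mod_cast hN
  obtain ⟨k, rfl⟩ : ∃ k', k = k' + 1 := ⟨k - 1, by omega⟩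
  by_cases hpN : (N : ℝ) < p ∨ (N = 1 ∧ p = 1)
  · exact Emb_step (Sinf hp hpN) (Emb_self N p k)
  · push Not at hpN
    have h1 : (N : ℝ) < ((k + 1 : ℕ) : ℝ) * p := by
      rcases h with h | h
      · exact h
      · exact absurd h.2 (hpN.2 h.1)
    set x := max 0 (1 / p - k / N) with hx
    have hx0 : 0 ≤ x := le_max_left _ _
    have hxN : x < 1 / N := by
      apply max_lt (by positivity)
      push_cast at h1
      have : 1 / p < (k + 1) / N := by
        rw [div_lt_div_iff₀ hp0 hN0]; linarith
      rw [add_div] at this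
      linarith
    have hy : 0 < (x + 1 / N) / 2 := by
      have : 0 < 1 / (N : ℝ) := by positivity
      positivity
    set p1 := 1 / ((x + 1 / N) / 2) with hp1
    have hp10 : 0 < p1 := by positivity
    have e1 : 1 / p1 = (x + 1 / N) / 2 := by rw [hp1, one_div_one_div]
    have hNp1 : (N : ℝ) < p1 := by
      rw [← one_div_lt_one_div hp10 hN0, e1]; linarith
    have hpp1 : p ≤ p1 := hpN.1.trans hNp1.le
    apply Emb_step (Sinf (hp.trans hpp1) (Or.inl hNp1))
    apply Emb_fin hN hp k hpp1
    rw [e1]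
    have := le_max_right 0 (1 / p - k / N)
    linarith

lemma pderivList_concat {N : ℕ} (l : List (Fin N)) (i : Fin N) : ∀ u : Euc N → ℝ,
    pderivList (l ++ [i]) u = pd i (pderivList l u) := by
  induction l with
  | nil => intro u; rfl
  | cons j l ih => intro u; rw [List.cons_append, pderivList_cons, pderivList_cons, ih]

lemma Tj_down {N : ℕ} {p : ℝ} (hp : 1 ≤ p) (σ : ℝ) (j : ℕ) : ∃ C : ℝ≥0∞, C ≠ ∞ ∧
    ∀ u : Euc N → ℝ, Sm u → Tj σ p j u ≤ C * (Tj σ p 0 u + Tj σ p (j + 1) u) := by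
  choose C hC h using fun m : Fin j → Fin N => S2 (N := N) hp (List.ofFn m) σ
  refine ⟨∑ m, C m, ENNReal.sum_ne_top.2 fun m _ => hC m, fun u hu => ?_⟩
  rw [Finset.sum_mul]
  unfold Tj
  refine Finset.sum_le_sum fun m _ => ?_
  have h1 := h m u hu
  rw [List.length_ofFn] at h1
  refine h1.trans ?_
  refine mul_le_mul_right ?_ _
  refine add_le_add ?_ ?_
  · simp [pderivList]
  · have e : σ - (j : ℝ) - 1 = σ - ((j + 1 : ℕ) : ℝ) := by push_cast; ring
    rw [e]
    let φ : Fin N → (Fin (j + 1) → Fin N) := fun i => Fin.snoc (α := fun _ => Fin N) m i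
    have hφ : Function.Injective φ := by
      intro a b hab
      have := congrFun hab (Fin.last j)
      simpa [φ] using this
    have hof : ∀ i, List.ofFn (φ i) = List.ofFn m ++ [i] := by
      intro i
      rw [List.ofFn_succ_last]
      simp [φ]
    calc _ = ∑ i, Wn N (σ - ((j + 1 : ℕ) : ℝ)) (ENNReal.ofReal p) (pderivList (List.ofFn (φ i)) u) := by
          refine Finset.sum_congr rfl fun i _ => ?_
          rw [hof, pderivList_concat]
      _ ≤ _ := by
          rw [← Finset.sum_image (f := fun m => Wn N (σ - ((j + 1 : ℕ) : ℝ)) (ENNReal.ofReal p) (pderivList (List.ofFn m) u))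
            (fun a _ b _ hab => hφ hab)]
          exact Finset.sum_le_sum_of_subset (Finset.subset_univ _)

lemma Tj_all {N : ℕ} {p : ℝ} (hp : 1 ≤ p) (σ : ℝ) (d : ℕ) : ∀ j : ℕ, ∃ C : ℝ≥0∞, C ≠ ∞ ∧
    ∀ u : Euc N → ℝ, Sm u → Tj σ p j u ≤ C * (Tj σ p 0 u + Tj σ p (j + d) u) := by
  induction d with
  | zero =>
    intro j
    exact ⟨1, by simp, fun u _ => by rw [one_mul, add_zero]; exact le_add_self⟩
  | succ d ih =>
    intro j
    obtain ⟨C1, hC1, h1⟩ := Tj_down (N := N) hp σ j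
    obtain ⟨C2, hC2, h2⟩ := ih (j + 1)
    refine ⟨C1 * (1 + C2), by finiteness, fun u hu => ?_⟩
    have e : j + 1 + d = j + (d + 1) := by ring
    have h3 := h2 u hu
    rw [e] at h3
    refine (h1 u hu).trans ?_
    rw [mul_assoc]
    refine mul_le_mul_right ?_ _
    rw [add_mul, one_mul]
    exact add_le_add le_self_add h3

lemma Emb_main {N : ℕ} {p : ℝ} (hp : 1 ≤ p) {q : ℝ≥0∞} {k : ℕ} (hE : Emb N p q k) (s : ℝ) :
    ∃ C : ℝ≥0∞, C ≠ ∞ ∧ ∀ (u : Euc N → ℝ) (g : (Fin k → Fin N) → Euc N → ℝ),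
      LocallyIntegrable u volume → (∀ m, IsWeakDerivList (List.ofFn m) u (g m)) →
      Wn N (s + k) q u ≤ C * (Wn N (s + k) (ENNReal.ofReal p) u + ∑ m, Wn N s (ENNReal.ofReal p) (g m)) := by
  obtain ⟨C1, hC1, h1⟩ := hE (s + k)
  choose D hD h2 using fun j => Tj_all (N := N) hp (s + k) (k - j) j
  obtain ⟨C3, hC3, h3⟩ := moll (N := N) hp s (s + k)
  have hDf : ∑ j ∈ Finset.range (k + 1), D j ≠ ∞ := ENNReal.sum_ne_top.2 fun j _ => hD j
  refine ⟨C1 * (∑ j ∈ Finset.range (k + 1), D j) * C3, by finiteness, fun u g hu hg => ?_⟩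
  obtain ⟨f, hf, hlim, hf1, hf2⟩ := h3 (fun m : Fin k → Fin N => List.ofFn m) u g hu hg
  refine Wn_lim _ _ (fun n => (hf n).continuous.aestronglyMeasurable) hlim (fun n => ?_)
  refine (h1 _ (hf n)).trans ?_
  rw [mul_assoc, mul_assoc]
  refine mul_le_mul_right ?_ _
  rw [Finset.sum_mul]
  refine Finset.sum_le_sum fun j hj => ?_
  have hjk : j + (k - j) = k := by
    have := Finset.mem_range.1 hj
    omega
  have h4 := h2 j (f n) (hf n)
  rw [hjk] at h4
  refine h4.trans ?_
  refine mul_le_mul_right ?_ _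
  rw [mul_add, Finset.mul_sum, Tj_zero]
  refine add_le_add (hf1 n) ?_
  unfold Tj
  refine Finset.sum_le_sum fun m _ => ?_
  rw [add_sub_cancel_right]
  exact hf2 n m

lemma Emb_Ijp {N : ℕ} (hN : 1 ≤ N) {p : ℝ} (hp : 1 ≤ p) {k : ℕ} (hk : 1 ≤ k) {q : ℝ≥0∞}
    (hq : q ∈ Ijp N k p) : ENNReal.ofReal p ≤ q ∧ Emb N p q k := by
  have hp0 : 0 < p := by linarith
  have hN0 : (0 : ℝ) < N := by exact_mod_cast hN
  have hk0 : (0 : ℝ) < k := by exact_mod_cast hk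
  have key : ENNReal.ofReal p ≤ q → q ≠ ∞ → 1 / p - k / (N : ℝ) ≤ 1 / q.toReal → Emb N p q k := by
    intro h1 h2 h3
    have h4 : p ≤ q.toReal := (ENNReal.ofReal_le_iff_le_toReal h2).1 h1
    have := Emb_fin hN hp k h4 h3
    rwa [ENNReal.ofReal_toReal h2] at this
  unfold Ijp at hq
  split_ifs at hq with h1 h2
  · refine ⟨hq.1, key hq.1 hq.2.ne ?_⟩
    have : 1 / p - k / (N : ℝ) = 0 := by
      rw [h1.1]; field_simp; simp
    rw [this]; positivity
  · have hd : 0 < (N : ℝ) - k * p := by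
      rw [lt_div_iff₀ hk0] at h2; linarith
    have hqt : q ≠ ∞ := ne_top_of_le_ne_top ENNReal.ofReal_ne_top hq.2
    have h4 : p ≤ q.toReal := (ENNReal.ofReal_le_iff_le_toReal hqt).1 hq.1
    have h5 : q.toReal ≤ (N : ℝ) * p / ((N : ℝ) - k * p) :=
      ENNReal.toReal_le_of_le_ofReal (by positivity) hq.2
    refine ⟨hq.1, key hq.1 hqt ?_⟩
    have h6 : 1 / p - k / (N : ℝ) = 1 / ((N : ℝ) * p / ((N : ℝ) - k * p)) := by
      field_simp
    rw [h6]
    exact one_div_le_one_div_of_le (by linarith) h5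
  · have h3 : (N : ℝ) ≤ k * p := by
      have := (div_le_iff₀ hk0).1 (not_lt.1 h2)
      linarith
    refine ⟨hq.1, ?_⟩
    by_cases hqt : q = ∞
    · subst hqt
      apply Emb_inf hN hp hk
      rcases eq_or_lt_of_le h3 with h | h
      · right
        have hN1 : N = 1 := by
          by_contra hne
          exact h1 ⟨by rw [eq_div_iff hk0.ne']; linarith, by omega⟩
        refine ⟨hN1, ?_⟩
        have hk1 : (1 : ℝ) ≤ k := by exact_mod_cast hk
        rw [hN1] at h
        push_cast at h
        nlinarith
      · left; exact h
    · apply key hq.1 hqt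
      have : 1 / p ≤ k / (N : ℝ) := by
        rw [div_le_div_iff₀ hp0 hN0]; linarith
      have h5 : 0 ≤ 1 / q.toReal := by positivity
      linarith

lemma exists_eps (k : ℕ) (σ b : ℝ) (hb : b < 0) :
    ∃ ε : ℝ, 0 < ε ∧ ∀ i : ℕ, i < k → σ < i → max b σ + ε < (0 : ℝ) + i := by
  have h : ∀ᶠ ε : ℝ in 𝓝[>] 0, ∀ i ∈ Finset.range k, σ < (i : ℝ) → max b σ + ε < (0 : ℝ) + i := by
    rw [Filter.eventually_all_finset]
    intro i _
    by_cases hi : σ < i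
    · have h1 : max b σ < i := max_lt (lt_of_lt_of_le hb (by positivity)) hi
      have h2 : ∀ᶠ ε : ℝ in 𝓝[>] 0, ε < i - max b σ :=
        mem_nhdsWithin_of_mem_nhds (Iio_mem_nhds (by linarith))
      filter_upwards [h2] with ε hε _
      linarith
    · exact Filter.Eventually.of_forall fun _ h => absurd h hi
  obtain ⟨ε, h1, h2⟩ := (h.and self_mem_nhdsWithin).exists
  exact ⟨ε, h2, fun i hi => h1 i (by simpa using hi)⟩

lemma lowB {N : ℕ} (hN : 1 ≤ N) {p s : ℝ} (hp : 1 ≤ p) {k : ℕ}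
    (hs : ∀ m : ℕ, 1 ≤ m → m ≤ k → s ≠ -(m : ℝ)) {q : ℝ≥0∞} (hq : ENNReal.ofReal p ≤ q) :
    ∃ C : ℝ≥0∞, C ≠ ∞ ∧ ∀ (u : Euc N → ℝ) (g : (Fin k → Fin N) → Euc N → ℝ),
      LocallyIntegrable u volume → (∀ m, IsWeakDerivList (List.ofFn m) u (g m)) →
      Wn N (s + k) q u ≠ ∞ →
      Wn N (s + k) (ENNReal.ofReal p) u ≤
        C * (Wn N (s + k) q u + ∑ m, Wn N s (ENNReal.ofReal p) (g m)) := by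
  have hb : -(N : ℝ) / p < 0 := by
    have : (0 : ℝ) < N := by exact_mod_cast hN
    exact div_neg_of_neg_of_pos (by linarith) (by linarith)
  obtain ⟨ε, hε, he⟩ := exists_eps k (s + k) _ hb
  obtain ⟨C1, hC1, h1⟩ := hoelderB (N := N) hp hε (s + k) hq
  obtain ⟨C2, hC2, h2⟩ := DV (N := N) (σ := s + k) hp hε k 0 (by
    intro i hi
    rcases lt_trichotomy (i : ℝ) (s + k) with h | h | h
    · left; linarith
    · exfalso
      apply hs (k - i) (by omega) (by omega)
      rw [Nat.cast_sub hi.le]; linarith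
    · right; exact he i hi h)
  obtain ⟨C3, hC3, h3⟩ := EV' (N := N) hp s k
  refine ⟨C2 * (C3 + C1), by finiteness, fun u g hu hg hfin => ?_⟩
  have hm := hu.aestronglyMeasurable
  have h4 := h1 u hm
  have h5 : Wn N (s + k + ε) (ENNReal.ofReal p) u ≠ ∞ :=
    ne_top_of_le_ne_top (ENNReal.mul_ne_top hC1 hfin) h4
  refine (h2 u hm h5).trans ?_
  rw [mul_assoc]
  refine mul_le_mul_right ?_ _
  refine (add_le_add (h3 u g hu hg) h4).trans ?_
  rw [add_mul]
  refine add_le_add (mul_le_mul_right le_add_self _) (mul_le_mul_right le_self_add _)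

lemma lowB2 {N : ℕ} (hN : 1 ≤ N) {p s : ℝ} (hp : 1 ≤ p) {k : ℕ} (hs : s < -(k : ℝ)) :
    ∃ C : ℝ≥0∞, C ≠ ∞ ∧ ∀ (u : Euc N → ℝ) (g : (Fin k → Fin N) → Euc N → ℝ),
      LocallyIntegrable u volume → (∀ m, IsWeakDerivList (List.ofFn m) u (g m)) →
      Wn N (s + k) (ENNReal.ofReal p) u ≠ ∞ →
      Wn N (s + k) (ENNReal.ofReal p) u ≤ C * ∑ m, Wn N s (ENNReal.ofReal p) (g m) := by
  have hb : -(N : ℝ) / p < 0 := by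
    have : (0 : ℝ) < N := by exact_mod_cast hN
    exact div_neg_of_neg_of_pos (by linarith) (by linarith)
  obtain ⟨ε, hε, he⟩ := exists_eps k (s + k) _ hb
  obtain ⟨C1, hC1, h1⟩ := hoelderB (N := N) hp hε (s + k) (le_refl (ENNReal.ofReal p))
  obtain ⟨C2, hC2, h2⟩ := DV1 (N := N) (σ := s + k) hp hε k 0 (by
    intro i hi
    have : (0 : ℝ) ≤ i := by positivity
    exact he i hi (by linarith))
  obtain ⟨C3, hC3, h3⟩ := EV' (N := N) hp s k
  refine ⟨C2 * C3, by finiteness, fun u g hu hg hfin => ?_⟩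
  have hm := hu.aestronglyMeasurable
  have h5 : Wn N (s + k + ε) (ENNReal.ofReal p) u ≠ ∞ :=
    ne_top_of_le_ne_top (ENNReal.mul_ne_top hC1 hfin) (h1 u hm)
  refine (h2 u hm h5).trans ?_
  rw [mul_assoc]
  exact mul_le_mul_right (h3 u g hu hg) _

lemma abs_le_gradNormK {N k : ℕ} (g : (Fin k → Fin N) → Euc N → ℝ) (m : Fin k → Fin N) (x : Euc N) :
    |g m x| ≤ |gradNormK g x| := by
  unfold gradNormK
  rw [abs_of_nonneg (Real.sqrt_nonneg _)]
  apply Real.abs_le_sqrt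
  exact Finset.single_le_sum (f := fun m => g m x ^ 2) (fun _ _ => sq_nonneg _) (Finset.mem_univ m)

lemma gradNormK_le {N k : ℕ} (g : (Fin k → Fin N) → Euc N → ℝ) (x : Euc N) :
    gradNormK g x ≤ ∑ m, |g m x| := by
  unfold gradNormK
  apply Real.sqrt_le_iff.2 ⟨Finset.sum_nonneg fun _ _ => abs_nonneg _, ?_⟩
  have := Finset.sum_sq_le_sq_sum_of_nonneg (s := Finset.univ) (f := fun m => |g m x|)
    (fun _ _ => abs_nonneg _)
  simpa using this

lemma grad_fin {N k : ℕ} {s : ℝ} {q : ℝ≥0∞} {g : (Fin k → Fin N) → Euc N → ℝ}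
    (hg : ∀ m, MemLs N s q (g m)) : Wn N s q (gradNormK g) ≠ ∞ := by
  have h : MemLp (fun x => ∑ m, ‖wt N s q x * g m x‖) q volume :=
    memLp_finsetSum _ fun m _ => (hg m).norm
  refine ne_top_of_le_ne_top h.2.ne (eLpNorm_mono fun x => ?_)
  have hw := (wt_pos (N := N) s q x).le
  rw [norm_mul, Real.norm_of_nonneg hw, Real.norm_of_nonneg (show 0 ≤ gradNormK g x from Real.sqrt_nonneg _),
    Real.norm_of_nonneg (Finset.sum_nonneg fun _ _ => norm_nonneg _)]
  simp only [norm_mul, Real.norm_of_nonneg hw, ← Finset.mul_sum]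
  exact mul_le_mul_of_nonneg_left (gradNormK_le g x) hw

lemma sum_le_grad {N k : ℕ} (s : ℝ) (q : ℝ≥0∞) (g : (Fin k → Fin N) → Euc N → ℝ) :
    ∑ m, Wn N s q (g m) ≤ (Fintype.card (Fin k → Fin N) : ℝ≥0∞) * Wn N s q (gradNormK g) := by
  refine (Finset.sum_le_card_nsmul _ _ _ fun m _ => Wn_mono s q (abs_le_gradNormK g m)).trans ?_
  rw [nsmul_eq_mul]; rfl

lemma toReal_bd {a b c C D : ℝ≥0∞} (hb : b ≠ ∞) (hc : c ≠ ∞) (hC : C ≠ ∞) (hD : D ≠ ∞) {S : ℝ≥0∞}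
    (hS : S ≤ D * c) (h : a ≤ C * (b + S)) :
    a.toReal ≤ (C * (1 + D)).toReal * (b.toReal + c.toReal) := by
  have : a ≤ C * (1 + D) * (b + c) := by
    refine h.trans ?_
    rw [mul_assoc]
    refine mul_le_mul_right ?_ _
    calc b + S ≤ b + D * c := by gcongr
      _ ≤ (1 + D) * b + (1 + D) * c := by
        refine add_le_add ?_ ?_
        · rw [add_mul, one_mul]; exact le_self_add
        · rw [add_mul]; exact le_add_self
      _ = _ := by ring
  have h2 := ENNReal.toReal_mono (by finiteness) this
  rwa [ENNReal.toReal_mul (a := C * (1 + D)), ENNReal.toReal_add hb hc] at h2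

lemma memLs_iff {N : ℕ} {s : ℝ} {q : ℝ≥0∞} {u : Euc N → ℝ} (hu : LocallyIntegrable u volume) :
    MemLs N s q u ↔ Wn N s q u ≠ ∞ := by
  constructor
  · intro h; exact h.2.ne
  · intro h
    exact ⟨(wt_meas s q).aestronglyMeasurable.mul hu.aestronglyMeasurable, lt_top_iff_ne_top.2 h⟩

end WS

/-- Theorem 12(iii). For `k ≥ 1`, `1 ≤ p < ∞`, `s ∉ {-k,…,-1}` and
`q ∈ I_{k,p}`, the spaces `W^{k,q,p}_s` and `W^{k,p,p}_s` coincide as sets and have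
equivalent norms; moreover, if `s < -k`, the norm of `W^{k,p,p}_s` is equivalent to the
seminorm `u ↦ ‖|∇^k u|‖_{L^p_s}`. -/
theorem stmt_18 {N : ℕ} (hN : 1 ≤ N) (k : ℕ) (hk : 1 ≤ k) (p s : ℝ) (hp : 1 ≤ p)
    (hs : ∀ m : ℕ, 1 ≤ m → m ≤ k → s ≠ -(m : ℝ)) :
    (∀ q ∈ Ijp N k p,
      ∃ C : ℝ, 0 < C ∧
        ∀ (u : Euc N → ℝ) (g : (Fin k → Fin N) → Euc N → ℝ),
          (∀ m, IsWeakDerivList (List.ofFn m) u (g m)) →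
          (∀ m, MemLs N s (ENNReal.ofReal p) (g m)) →
          (MemLs N (s + k) q u ↔ MemLs N (s + k) (ENNReal.ofReal p) u) ∧
          (MemLs N (s + k) q u →
            LsNorm N (s + k) (ENNReal.ofReal p) u
                + LsNorm N s (ENNReal.ofReal p) (gradNormK g)
              ≤ C * (LsNorm N (s + k) q u
                + LsNorm N s (ENNReal.ofReal p) (gradNormK g)) ∧
            LsNorm N (s + k) q u + LsNorm N s (ENNReal.ofReal p) (gradNormK g)
              ≤ C * (LsNorm N (s + k) (ENNReal.ofReal p) u
                + LsNorm N s (ENNReal.ofReal p) (gradNormK g)))) ∧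
    (s < -(k : ℝ) →
      ∃ C : ℝ, 0 < C ∧
        ∀ (u : Euc N → ℝ) (g : (Fin k → Fin N) → Euc N → ℝ),
          (∀ m, IsWeakDerivList (List.ofFn m) u (g m)) →
          (∀ m, MemLs N s (ENNReal.ofReal p) (g m)) →
          MemLs N (s + k) (ENNReal.ofReal p) u →
          LsNorm N s (ENNReal.ofReal p) (gradNormK g)
              ≤ C * (LsNorm N (s + k) (ENNReal.ofReal p) u
                + LsNorm N s (ENNReal.ofReal p) (gradNormK g)) ∧
          LsNorm N (s + k) (ENNReal.ofReal p) u
              + LsNorm N s (ENNReal.ofReal p) (gradNormK g)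
            ≤ C * LsNorm N s (ENNReal.ofReal p) (gradNormK g)) := by
  have m0 : Fin k → Fin N := fun _ => ⟨0, hN⟩
  have hD : (Fintype.card (Fin k → Fin N) : ℝ≥0∞) ≠ ∞ := ENNReal.natCast_ne_top _
  constructor
  · intro q hq
    obtain ⟨hpq, hE⟩ := WS.Emb_Ijp hN hp hk hq
    obtain ⟨A, hA, hA1⟩ := WS.lowB hN hp hs hpq
    obtain ⟨B, hB, hB1⟩ := WS.Emb_main hp hE s
    set D : ℝ≥0∞ := (Fintype.card (Fin k → Fin N) : ℝ≥0∞) with hDdef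
    set A' := (A * (1 + D)).toReal
    set B' := (B * (1 + D)).toReal
    have hA'0 : 0 ≤ A' := ENNReal.toReal_nonneg
    have hB'0 : 0 ≤ B' := ENNReal.toReal_nonneg
    refine ⟨A' + B' + 1, by positivity, fun u g hw hg => ?_⟩
    have hu : LocallyIntegrable u volume := (hw m0).1
    have hG := WS.grad_fin hg
    have hS := WS.sum_le_grad s (ENNReal.ofReal p) g
    have hSf := ne_top_of_le_ne_top (ENNReal.mul_ne_top hD hG) hS
    have iff1 : MemLs N (s + k) q u ↔ MemLs N (s + k) (ENNReal.ofReal p) u := by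
      rw [WS.memLs_iff hu, WS.memLs_iff hu]
      constructor
      · intro h
        exact ne_top_of_le_ne_top (ENNReal.mul_ne_top hA (ENNReal.add_ne_top.2 ⟨h, hSf⟩))
          (hA1 u g hu hw h)
      · intro h
        exact ne_top_of_le_ne_top (ENNReal.mul_ne_top hB (ENNReal.add_ne_top.2 ⟨h, hSf⟩))
          (hB1 u g hu hw)
    refine ⟨iff1, fun h => ?_⟩
    have hqf := (WS.memLs_iff hu).1 h
    have hpf := (WS.memLs_iff hu).1 (iff1.1 h)
    have e1 : LsNorm N (s + k) (ENNReal.ofReal p) u ≤ A' * (LsNorm N (s + k) q u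
        + LsNorm N s (ENNReal.ofReal p) (gradNormK g)) :=
      WS.toReal_bd hqf hG hA hD hS (hA1 u g hu hw hqf)
    have e2 : LsNorm N (s + k) q u ≤ B' * (LsNorm N (s + k) (ENNReal.ofReal p) u
        + LsNorm N s (ENNReal.ofReal p) (gradNormK g)) :=
      WS.toReal_bd hpf hG hB hD hS (hB1 u g hu hw)
    have n1 : 0 ≤ LsNorm N (s + k) (ENNReal.ofReal p) u := ENNReal.toReal_nonneg
    have n2 : 0 ≤ LsNorm N (s + k) q u := ENNReal.toReal_nonneg
    have n3 : 0 ≤ LsNorm N s (ENNReal.ofReal p) (gradNormK g) := ENNReal.toReal_nonneg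
    have f1 := mul_nonneg hB'0 (add_nonneg n2 n3)
    have f2 := mul_nonneg hA'0 (add_nonneg n1 n3)
    constructor <;> linarith
  · intro hs'
    obtain ⟨A, hA, hA1⟩ := WS.lowB2 (N := N) hN hp hs'
    set D : ℝ≥0∞ := (Fintype.card (Fin k → Fin N) : ℝ≥0∞) with hDdef
    set A' := (A * (1 + D)).toReal
    have hA'0 : 0 ≤ A' := ENNReal.toReal_nonneg
    refine ⟨A' + 1, by positivity, fun u g hw hg hmem => ?_⟩
    have hu : LocallyIntegrable u volume := (hw m0).1
    have hG := WS.grad_fin hg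
    have hS := WS.sum_le_grad s (ENNReal.ofReal p) g
    have hpf := (WS.memLs_iff hu).1 hmem
    have e1 : LsNorm N (s + k) (ENNReal.ofReal p) u ≤ A' * ((0 : ℝ≥0∞).toReal
        + LsNorm N s (ENNReal.ofReal p) (gradNormK g)) :=
      WS.toReal_bd (by simp) hG hA hD hS (by rw [zero_add]; exact hA1 u g hu hw hpf)
    rw [ENNReal.toReal_zero, zero_add] at e1
    have n1 : 0 ≤ LsNorm N (s + k) (ENNReal.ofReal p) u := ENNReal.toReal_nonneg
    have n3 : 0 ≤ LsNorm N s (ENNReal.ofReal p) (gradNormK g) := ENNReal.toReal_nonneg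
    have f2 := mul_nonneg hA'0 (add_nonneg n1 n3)
    constructor <;> linarith

end
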